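/- Let X be a smooth prime Fano threefold of genus 4 contained in a non-singular quadric hypersurface Q ⊂ P^5. Then the equation f of X in the homogeneous coordinate ring of Q is the pfaffian of a 6 × 6 skew-symmetric matrix M of linear forms on Q, i.e. M represents a map ψ: O_Q(-1)^6 → O_Q^6 with Pf(M) = f. -/

import Mathlib

noncomputable section

open MvPolynomial Matrix

/-- The pfaffian of a `2n × 2n` matrix `M` over a commutative `ℚ`-algebra, given by the
classical formula `Pf(M) = (1/(2^n n!)) ∑_{σ ∈ S_{2n}} sgn(σ) ∏_{i<n} M_{σ(2i), σ(2i+1)}`.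
For a skew-symmetric matrix it satisfies `Pf(M)^2 = det M`. -/
def pfaffian {R : Type*} [CommRing R] [Algebra ℚ R] {n : ℕ}
    (M : Matrix (Fin (2 * n)) (Fin (2 * n)) R) : R :=
  algebraMap ℚ R ((2 ^ n * n.factorial : ℚ)⁻¹) *
    ∑ σ : Equiv.Perm (Fin (2 * n)),
      (Equiv.Perm.sign σ : ℤ) •
        ∏ i : Fin n,
          M (σ ⟨2 * i.val, by have := i.isLt; omega⟩)
            (σ ⟨2 * i.val + 1, by have := i.isLt; omega⟩)

end

section
open Cardinal

theorem auto_exists (S : Set ℂ) (hS : S.Countable) : ∃ A : Set ℂ, A.Countable ∧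
    ∀ t t' : ℂ, t ∉ A → t' ∉ A → ∃ σ : ℂ ≃+* ℂ, (∀ s ∈ S, σ s = s) ∧ σ t = t' := by
  classical
  let F : IntermediateField ℚ ℂ := IntermediateField.adjoin ℚ S
  have hF : #F ≤ ℵ₀ := by
    refine (IntermediateField.cardinalMk_adjoin_le ℚ S).trans ?_
    simp [hS.le_aleph0]
  have hFc : Countable F := by rwa [← Cardinal.mk_le_aleph0_iff]
  refine ⟨{x | IsAlgebraic F x}, ?_, ?_⟩
  · exact Algebraic.countable F ℂ
  · intro t t' ht ht'
    have key : ∀ t : ℂ, ¬ IsAlgebraic F t → ∃ B : Set ℂ, t ∈ B ∧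
        IsTranscendenceBasis F ((↑) : B → ℂ) ∧ #B = #ℂ := by
      intro t ht
      have h1 : AlgebraicIndepOn F id ({t} : Set ℂ) := by
        have : Transcendental F t := ht
        refine (algebraicIndependent_unique_type_iff (ι := ({t} : Set ℂ)) (x := fun i => id (i:ℂ))).2 ?_
        exact this
      obtain ⟨B, hB, hB'⟩ := exists_isTranscendenceBasis_superset h1
      refine ⟨B, hB rfl, hB', ?_⟩
      have := IsAlgClosed.cardinal_eq_cardinal_transcendence_basis_of_aleph0_lt' _ hB' hF
        (by simpa using Cardinal.aleph0_lt_continuum)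
      exact this.symm
    obtain ⟨B, hB, hBt, hBc⟩ := key t ht
    obtain ⟨B', hB', hBt', hBc'⟩ := key t' ht'
    obtain ⟨e0⟩ := Cardinal.eq.1 (hBc.trans hBc'.symm)
    let e : B ≃ B' := e0.trans (Equiv.swap (e0 ⟨t, hB⟩) ⟨t', hB'⟩)
    have he : e ⟨t, hB⟩ = ⟨t', hB'⟩ := by simp [e]
    let _ := IsAlgClosed.isAlgClosure_of_transcendence_basis _ hBt
    let _ := IsAlgClosed.isAlgClosure_of_transcendence_basis _ hBt'
    let f : Algebra.adjoin F (Set.range ((↑) : B → ℂ)) ≃ₐ[F] Algebra.adjoin F (Set.range ((↑) : B' → ℂ)) :=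
      (hBt.1.aevalEquiv.symm.trans (MvPolynomial.renameEquiv F e)).trans hBt'.1.aevalEquiv
    refine ⟨IsAlgClosure.equivOfEquiv ℂ ℂ f.toRingEquiv, ?_, ?_⟩
    · intro s hs
      have hsF : s ∈ F := IntermediateField.subset_adjoin _ _ hs
      have := IsAlgClosure.equivOfEquiv_algebraMap ℂ ℂ f.toRingEquiv (algebraMap F _ ⟨s, hsF⟩)
      have h2 : f.toRingEquiv (algebraMap F _ ⟨s, hsF⟩) = algebraMap F _ ⟨s, hsF⟩ := f.commutes _
      rw [h2] at this
      exact this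
    · have hh := IsAlgClosure.equivOfEquiv_algebraMap ℂ ℂ f.toRingEquiv (hBt.1.aevalEquiv (MvPolynomial.X ⟨t, hB⟩))
      have h2 : f.toRingEquiv (hBt.1.aevalEquiv (MvPolynomial.X ⟨t, hB⟩)) = hBt'.1.aevalEquiv (MvPolynomial.X ⟨t', hB'⟩) := by
        change f _ = _
        simp [f, he]
      rw [h2] at hh
      have h3 : (algebraMap _ ℂ) (hBt.1.aevalEquiv (MvPolynomial.X ⟨t, hB⟩)) = t := by simp
      have h4 : (algebraMap _ ℂ) (hBt'.1.aevalEquiv (MvPolynomial.X ⟨t', hB'⟩)) = t' := by simp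
      rw [h3, h4] at hh
      exact hh

end

section
open Cardinal

theorem der_poly (F : IntermediateField ℚ ℂ) {B : Set ℂ} (f : B → ℂ) :
    ∃ d : MvPolynomial B F →ₗ[F] ℂ, (∀ b, d (MvPolynomial.X b) = f b) ∧ d 1 = 0 ∧
      ∀ p p', d (p * p') = MvPolynomial.aeval ((↑) : B → ℂ) p * d p' + MvPolynomial.aeval ((↑) : B → ℂ) p' * d p := by
  let _ : Module (MvPolynomial B F) ℂ := Module.compHom ℂ (MvPolynomial.aeval (R := F) ((↑) : B → ℂ)).toRingHom
  have hs : ∀ (p : MvPolynomial B F) (z : ℂ), p • z = MvPolynomial.aeval ((↑) : B → ℂ) p * z := fun p z => rfl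
  have : IsScalarTower F (MvPolynomial B F) ℂ := by
    constructor
    intro x y z
    rw [hs, hs, map_smul, smul_mul_assoc]
  let d := MvPolynomial.mkDerivation F f
  refine ⟨d.toLinearMap, fun b => MvPolynomial.mkDerivation_X _ _ _, d.map_one_eq_zero, fun p p' => ?_⟩
  have := d.leibniz p p'
  rw [hs, hs] at this
  exact this

open scoped IntermediateField.algebraAdjoinAdjoin in
theorem der_extend (F : IntermediateField ℚ ℂ) {B : Set ℂ}
    (hB : IsTranscendenceBasis F ((↑) : B → ℂ)) (f : B → ℂ) :
    ∃ D : Derivation ℤ ℂ ℂ, (∀ s ∈ F, D s = 0) ∧ ∀ b : B, D b = f b := by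
  classical
  let A := Algebra.adjoin F (Set.range ((↑) : B → ℂ))
  let L := IntermediateField.adjoin F (Set.range ((↑) : B → ℂ))
  let e : MvPolynomial B F ≃ₐ[F] A := hB.1.aevalEquiv
  obtain ⟨d0, h0, h1, h2⟩ := der_poly F f
  have he : ∀ p, ((e p : A) : ℂ) = MvPolynomial.aeval ((↑) : B → ℂ) p := fun p => hB.1.algebraMap_aevalEquiv p
  let d : Derivation F A ℂ := Derivation.mk' (d0 ∘ₗ e.symm.toLinearMap) (by
    intro a b
    have ha : ((a : A) : ℂ) = MvPolynomial.aeval ((↑) : B → ℂ) (e.symm a) := by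
      rw [← he]; simp
    have hb : ((b : A) : ℂ) = MvPolynomial.aeval ((↑) : B → ℂ) (e.symm b) := by
      rw [← he]; simp
    change d0 (e.symm (a * b)) = (a : ℂ) * d0 (e.symm b) + (b : ℂ) * d0 (e.symm a)
    rw [map_mul, h2, ← ha, ← hb])
  have e1 : Algebra.FormallyEtale A L := Algebra.FormallyEtale.of_isLocalization (nonZeroDivisors _)
  have hal : Algebra.IsAlgebraic L ℂ := by
    have := hB.isAlgebraic_field
    exact this
  have e2 : Algebra.FormallyEtale L ℂ := Algebra.FormallyEtale.of_isSeparable L ℂ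
  have e3 : Algebra.FormallyEtale A ℂ := Algebra.FormallyEtale.comp A L ℂ
  have hbc := KaehlerDifferential.isBaseChange_of_formallyEtale F A ℂ
  let φ := hbc.lift d.liftKaehlerDifferential
  let D : Derivation F ℂ ℂ := φ.compDer (KaehlerDifferential.D F ℂ)
  have hD : ∀ a : A, D a = d a := by
    intro a
    have h5 := hbc.lift_eq d.liftKaehlerDifferential (KaehlerDifferential.D F A a)
    rw [KaehlerDifferential.map_D, Derivation.liftKaehlerDifferential_comp_D] at h5
    exact h5
  refine ⟨D.restrictScalars ℤ, ?_, ?_⟩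
  · intro s hs
    exact D.map_algebraMap ⟨s, hs⟩
  · intro b
    have : ((b : ℂ)) = ((e (MvPolynomial.X b) : A) : ℂ) := by rw [he]; simp
    change D b = f b
    rw [this, hD]
    change d0 (e.symm (e _)) = _
    simp [h0]

theorem der_exists (S : Set ℂ) (hS : S.Countable) : ∃ (t : Fin 4 → ℂ) (D : Fin 4 → Derivation ℤ ℂ ℂ),
    (∀ i, ∀ s ∈ S, D i s = 0) ∧ ∀ i j, D i (t j) = if i = j then 1 else 0 := by
  classical
  let F : IntermediateField ℚ ℂ := IntermediateField.adjoin ℚ S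
  have hF : #F ≤ ℵ₀ := by
    refine (IntermediateField.cardinalMk_adjoin_le ℚ S).trans ?_
    simp [hS.le_aleph0]
  obtain ⟨B, hB⟩ := exists_isTranscendenceBasis F ℂ
  have hBc := IsAlgClosed.cardinal_eq_cardinal_transcendence_basis_of_aleph0_lt' _ hB hF
        (by simpa using Cardinal.aleph0_lt_continuum)
  have hinf : Infinite B := by
    rw [Cardinal.infinite_iff, ← hBc]
    simpa using Cardinal.aleph0_le_continuum
  let g := Infinite.natEmbedding B
  choose D hD1 hD2 using fun i : Fin 4 => der_extend F hB (fun b => if b = g i then 1 else 0)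
  refine ⟨fun i => g i, D, fun i s hs => hD1 i s (IntermediateField.subset_adjoin _ _ hs), ?_⟩
  intro i j
  rw [hD2]
  have : (g (j:ℕ) = g (i:ℕ)) ↔ i = j := by
    rw [g.injective.eq_iff, Fin.val_inj, eq_comm]
  simp [this]

end

section
open Topology Filter

theorem open_image {E G : Type*} [NormedAddCommGroup E] [NormedSpace ℂ E] [CompleteSpace E]
    [NormedAddCommGroup G] [NormedSpace ℂ G] [CompleteSpace G]
    (f : ℂ × E → G) (hf : ContDiff ℂ 1 f) (w : E)
    (hdir : ∀ y, ∃ δ : E, HasDerivAt (fun z : ℂ => f (0, w + z • δ)) y 0) :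
    ∀ᶠ t in 𝓝 (0:ℂ), ∃ x, f (t, x) = f (0, w) := by
  have hs : HasStrictFDerivAt f (fderiv ℂ f (0, w)) (0, w) :=
    hf.contDiffAt.hasStrictFDerivAt (by simp)
  set f' := fderiv ℂ f (0, w)
  have hval : ∀ y, ∃ δ : E, f' (0, δ) = y := by
    intro y
    obtain ⟨δ, hδ⟩ := hdir y
    refine ⟨δ, ?_⟩
    have h1 : HasDerivAt (fun z : ℂ => ((0:ℂ), w + z • δ)) ((0:ℂ), δ) 0 := by
      refine HasDerivAt.prodMk (hasDerivAt_const _ _) ?_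
      simpa using ((hasDerivAt_id (0:ℂ)).smul_const δ).const_add w
    have h2 : HasFDerivAt f f' ((fun z : ℂ => ((0:ℂ), w + z • δ)) 0) := by
      simpa using hs.hasFDerivAt
    exact (h2.comp_hasDerivAt (0:ℂ) h1).unique hδ
  let F : ℂ × E → ℂ × G := fun p => (p.1, f p)
  have hF : HasStrictFDerivAt F ((ContinuousLinearMap.fst ℂ ℂ E).prod f') (0, w) :=
    hasStrictFDerivAt_fst.prodMk hs
  have hsurj : ((ContinuousLinearMap.fst ℂ ℂ E).prod f').range = ⊤ := by
    rw [LinearMap.range_eq_top]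
    rintro ⟨t, y⟩
    obtain ⟨δ, hδ⟩ := hval (y - f' (t, 0))
    refine ⟨(t, δ), ?_⟩
    have : ((t, δ) : ℂ × E) = (t, 0) + (0, δ) := by simp
    have h3 : f' (t, δ) = y := by rw [this, map_add, hδ]; abel
    exact Prod.ext rfl h3
  have hm := hF.map_nhds_eq_of_surj hsurj
  have h4 : ∀ᶠ y in 𝓝 (F (0, w)), ∃ x, F x = y := by
    rw [← hm, eventually_map]
    exact Eventually.of_forall fun x => ⟨x, rfl⟩
  have h5 : Tendsto (fun t : ℂ => (t, f (0, w))) (𝓝 0) (𝓝 (F (0, w))) := by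
    have : Continuous (fun t : ℂ => (t, f (0, w))) := by fun_prop
    exact this.tendsto 0
  filter_upwards [h5.eventually h4] with t ht
  obtain ⟨⟨a, b⟩, hx⟩ := ht
  simp only [F, Prod.mk.injEq] at hx
  obtain ⟨rfl, hx⟩ := hx
  exact ⟨b, hx⟩

theorem homotopy {ι : Type*} [Fintype ι] (S : Set ℂ) (hS : S.Countable)
    (h : ℂ → (ι → ℂ) → (ι → ℂ))
    (hσ : ∀ σ : ℂ ≃+* ℂ, (∀ s ∈ S, σ s = s) → ∀ t ξ, h t ξ = 0 → h (σ t) (fun i => σ (ξ i)) = 0)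
    (hC : ContDiff ℂ 1 (fun p : ℂ × (ι → ℂ) => h p.1 p.2)) (ξ0 : ι → ℂ) (h0 : h 0 ξ0 = 0)
    (hdir : ∀ y, ∃ δ : ι → ℂ, HasDerivAt (fun z : ℂ => h 0 (ξ0 + z • δ)) y 0)
    (t1 : ℂ) (ε : ℝ) (hε : 0 < ε) : ∃ t, ‖t - t1‖ < ε ∧ ∃ ξ, h t ξ = 0 := by
  obtain ⟨A, hA, hA2⟩ := auto_exists S hS
  have hd : Dense Aᶜ := hA.dense_compl ℂ
  have h1 := open_image (fun p : ℂ × (ι → ℂ) => h p.1 p.2) hC ξ0 hdir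
  rw [Metric.eventually_nhds_iff] at h1
  obtain ⟨e, he, h1⟩ := h1
  obtain ⟨s, hs, hsA⟩ := hd.exists_dist_lt 0 he
  obtain ⟨t, ht, htA⟩ := hd.exists_dist_lt t1 hε
  rw [dist_comm] at hsA htA
  obtain ⟨ξ, hξ⟩ := h1 hsA
  obtain ⟨σ, hσ1, hσ2⟩ := hA2 s t hs ht
  refine ⟨t, by simpa [dist_eq_norm] using htA, fun i => σ (ξ i), ?_⟩
  rw [← hσ2]
  exact hσ σ hσ1 s ξ (by simpa [h0] using hξ)

end

section
open Topology Filter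

theorem limit_compact {X : Type*} [TopologicalSpace X] (K : Set X) (hK : IsCompact K)
    (C : Set (ℂ × X)) (hC : IsClosed C)
    (h : ∀ ε : ℝ, 0 < ε → ∃ t : ℂ, ‖t - 1‖ < ε ∧ ∃ x ∈ K, (t, x) ∈ C) : ∃ x ∈ K, ((1:ℂ), x) ∈ C := by
  by_contra hcon
  push Not at hcon
  have h1 : ∀ᶠ t in 𝓝 (1:ℂ), ∀ x ∈ K, (t, x) ∉ C := by
    refine hK.eventually_forall_of_forall_eventually ?_
    intro x hx
    exact hC.isOpen_compl.mem_nhds (hcon x hx)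
  rw [Metric.eventually_nhds_iff] at h1
  obtain ⟨e, he, h1⟩ := h1
  obtain ⟨t, ht, x, hx, hxC⟩ := h e he
  exact h1 (by simpa [dist_eq_norm] using ht) x hx hxC

theorem eigen (R : Fin 3 → Fin 3 → Fin 3 → ℂ) : ∃ w : Fin 3 → ℂ, w ≠ 0 ∧
    ∀ k l, w k * (∑ i, ∑ j, R i j l * w i * w j) = w l * (∑ i, ∑ j, R i j k * w i * w j) := by
  let R0 : Fin 3 → Fin 3 → Fin 3 → ℂ := fun i j k => if i = j ∧ j = k then 1 else 0
  let Q : ℂ → (Fin 3 → ℂ) → Fin 3 → ℂ := fun t w k =>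
    ∑ i, ∑ j, (R0 i j k + t * (R i j k - R0 i j k)) * w i * w j
  let S : Set ℂ := Set.range (fun p : Fin 3 × Fin 3 × Fin 3 => R p.1 p.2.1 p.2.2)
  have hS : S.Countable := Set.countable_range _
  have hQC : ∀ k, ContDiff ℂ 1 (fun p : ℂ × (Fin 3 → ℂ) => Q p.1 p.2 k) := by
    intro k
    simp only [Q]
    fun_prop
  have hQσ : ∀ σ : ℂ ≃+* ℂ, (∀ s ∈ S, σ s = s) → ∀ t w k, Q (σ t) (fun i => σ (w i)) k = σ (Q t w k) := by
    intro σ h t w k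
    have h1 : ∀ i j k, σ (R i j k) = R i j k := fun i j k => h _ ⟨(i, j, k), rfl⟩
    have h2 : ∀ i j k, σ (R0 i j k) = R0 i j k := by
      intro i j k
      simp only [R0]
      split_ifs <;> simp
    simp [Q, map_sum, h1, h2]
  let hh : ℂ → (Fin 2 → ℂ) → (Fin 2 → ℂ) := fun t ξ =>
    ![Q t ![1, ξ 0, ξ 1] 1 - ξ 0 * Q t ![1, ξ 0, ξ 1] 0, Q t ![1, ξ 0, ξ 1] 2 - ξ 1 * Q t ![1, ξ 0, ξ 1] 0]
  have hv : ContDiff ℂ 1 (fun p : ℂ × (Fin 2 → ℂ) => ((p.1, ![1, p.2 0, p.2 1]) : ℂ × (Fin 3 → ℂ))) := by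
    refine contDiff_fst.prodMk (contDiff_pi.2 fun i => ?_)
    fin_cases i <;> simp <;> fun_prop
  have hsol := homotopy S hS hh (by
    intro σ h t ξ hz
    have hz0 := congrFun hz 0
    have hz1 := congrFun hz 1
    have hw : (fun i => σ ((![1, ξ 0, ξ 1] : Fin 3 → ℂ) i)) = ![1, σ (ξ 0), σ (ξ 1)] := by
      ext i; fin_cases i <;> simp
    simp only [hh, ← hw, hQσ σ h]
    simp only [hh, Matrix.cons_val_zero, Matrix.cons_val_one, Pi.zero_apply] at hz0 hz1
    ext i
    fin_cases i
    · simp [← map_mul, ← map_sub, hz0]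
    · simp [← map_mul, ← map_sub, hz1]) (by
    refine contDiff_pi.2 fun i => ?_
    have h1 := fun k => (hQC k).comp hv
    simp only [Function.comp_def] at h1
    fin_cases i
    · simp [hh]
      exact (h1 1).sub ((by fun_prop : ContDiff ℂ 1 fun p : ℂ × (Fin 2 → ℂ) => p.2 0).mul (h1 0))
    · simp [hh]
      exact (h1 2).sub ((by fun_prop : ContDiff ℂ 1 fun p : ℂ × (Fin 2 → ℂ) => p.2 1).mul (h1 0)))
    0 (by
      ext i
      fin_cases i <;> simp [hh, Q, R0, Fin.sum_univ_three]) (by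
      intro y
      refine ⟨-y, ?_⟩
      rw [hasDerivAt_pi]
      intro i
      have h1 : ∀ y0 : ℂ, HasDerivAt (fun z : ℂ => (z * y0) * (z * y0) + z * y0) y0 0 := by
        intro y0
        have := ((hasDerivAt_id (0:ℂ)).mul_const y0)
        have h2 := (this.mul this).add this
        simp only [id, one_mul, zero_mul, mul_zero, add_zero, zero_add] at h2
        exact h2
      fin_cases i
      · simpa [hh, Q, R0, Fin.sum_univ_three] using h1 (y 0)
      · simpa [hh, Q, R0, Fin.sum_univ_three] using h1 (y 1)) 1
  obtain ⟨w, hw, hwC⟩ := limit_compact (Metric.sphere (0 : Fin 3 → ℂ) 1) (isCompact_sphere _ _)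
    {p | ∀ k l, p.2 k * Q p.1 p.2 l = p.2 l * Q p.1 p.2 k} (by
      simp only [Set.ofPred_forall]
      refine isClosed_iInter fun k => isClosed_iInter fun l => isClosed_eq ?_ ?_
      · exact (by fun_prop : Continuous fun p : ℂ × (Fin 3 → ℂ) => p.2 k).mul (hQC l).continuous
      · exact (by fun_prop : Continuous fun p : ℂ × (Fin 3 → ℂ) => p.2 l).mul (hQC k).continuous) (by
      intro ε hε
      obtain ⟨t, ht, ξ, hξ⟩ := hsol ε hε
      refine ⟨t, ht, ?_⟩
      set w : Fin 3 → ℂ := ![1, ξ 0, ξ 1] with hw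
      have hw0 : w ≠ 0 := fun h => by simpa [hw] using congrFun h 0
      have hQs : ∀ (a : ℂ) k, Q t (a • w) k = a ^ 2 * Q t w k := by
        intro a k
        simp only [Q, Finset.mul_sum, Pi.smul_apply, smul_eq_mul]
        refine Finset.sum_congr rfl fun i _ => Finset.sum_congr rfl fun j _ => by ring
      have e1 : Q t w 1 = w 1 * Q t w 0 := by
        have := congrFun hξ 0
        simp only [hh, ← hw] at this
        simpa [sub_eq_zero, hw] using this
      have e2 : Q t w 2 = w 2 * Q t w 0 := by
        have := congrFun hξ 1
        simp only [hh, ← hw] at this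
        simpa [sub_eq_zero, hw] using this
      have e0 : Q t w 0 = w 0 * Q t w 0 := by simp [hw]
      have e : ∀ k, Q t w k = w k * Q t w 0 := by
        intro k
        fin_cases k
        · exact e0
        · exact e1
        · exact e2
      refine ⟨((‖w‖⁻¹ : ℝ) : ℂ) • w, ?_, ?_⟩
      · have : ‖w‖ ≠ 0 := norm_ne_zero_iff.2 hw0
        simp [norm_smul, this]
      · intro k l
        simp only [hQs, Pi.smul_apply, smul_eq_mul]
        rw [e k, e l]
        ring)
  refine ⟨w, fun h => by simp [h] at hw, ?_⟩
  intro k l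
  have := hwC k l
  simpa [Q] using this

end

section
open Topology Filter

abbrev V6 := Fin 6 → ℂ

structure Sm (B : V6 →ₗ[ℂ] V6 →ₗ[ℂ] ℂ) (T : V6 →ₗ[ℂ] V6 →ₗ[ℂ] V6 →ₗ[ℂ] ℂ) : Prop where
  bs : ∀ u v, B u v = B v u
  t12 : ∀ u v w, T u v w = T v u w
  t23 : ∀ u v w, T u v w = T u w v
  nd : ∀ v, (∀ w, B v w = 0) → v = 0
  sm : ∀ a, a ≠ 0 → B a a = 0 → T a a a = 0 → ∃ w, B a w = 0 ∧ T a a w ≠ 0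

theorem span_exists {ι : Type*} [Fintype ι] (hι : Fintype.card ι = 6) (v : ι → V6)
    (hv : LinearIndependent ℂ v) (y : V6) : ∃ c : ι → ℂ, y = ∑ i, c i • v i := by
  have hne : Nonempty ι := Fintype.card_pos_iff.1 (by omega)
  let b := basisOfLinearIndependentOfCardEqFinrank hv (by simp [hι])
  refine ⟨fun i => b.repr y i, ?_⟩
  conv_lhs => rw [← b.sum_repr y]
  simp [b]

theorem func_exists {ι W : Type*} [AddCommGroup W] [Module ℂ W] (e : ι → W)
    (he : LinearIndependent ℂ e) (y : ι → ℂ) : ∃ φ : W →ₗ[ℂ] ℂ, ∀ i, φ (e i) = y i := by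
  let b := Module.Basis.span he
  obtain ⟨φ, hφ⟩ := LinearMap.exists_extend (b.constr ℂ y)
  refine ⟨φ, fun i => ?_⟩
  have h1 : (b i : W) = e i := by
    simp [b, Module.Basis.span_apply]
  have h2 : φ (b i) = b.constr ℂ y (b i) := by rw [← hφ]; rfl
  rw [← h1, h2, Module.Basis.constr_basis]

theorem Sm.surj {B T} (H : Sm B T) (φ : V6 →ₗ[ℂ] ℂ) : ∃ v, ∀ w, B v w = φ w := by
  have hinj : Function.Injective B := by
    rw [injective_iff_map_eq_zero]
    intro v hv
    exact H.nd v fun w => by rw [hv]; rfl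
  have hs : Function.Surjective B := by
    refine (LinearMap.injective_iff_surjective_of_finrank_eq_finrank ?_).1 hinj
    exact (Subspace.dual_finrank_eq (K := ℂ) (V := V6)).symm
  obtain ⟨v, hv⟩ := hs φ
  exact ⟨v, fun w => by rw [hv]⟩

theorem Sm.dual {B T} (H : Sm B T) {ι : Type*} (e : ι → V6)
    (he : LinearIndependent ℂ e) (y : ι → ℂ) : ∃ v, ∀ i, B (e i) v = y i := by
  obtain ⟨φ, hφ⟩ := func_exists e he y
  obtain ⟨v, hv⟩ := H.surj φ
  exact ⟨v, fun i => by rw [H.bs, hv, hφ]⟩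

theorem no_plane {B T} (H : Sm B T) (e : Fin 3 → V6) (he : LinearIndependent ℂ e)
    (h1 : ∀ i j, B (e i) (e j) = 0) (h2 : ∀ i j k, T (e i) (e j) (e k) = 0) : False := by
  choose f hf using fun j : Fin 3 => H.dual e he (fun i => if i = j then 1 else 0)
  obtain ⟨w, hw, hw2⟩ := eigen (fun i j k => T (e i) (e j) (f k))
  have hind : LinearIndependent ℂ (Sum.elim e f) := by
    rw [Fintype.linearIndependent_iff] at he ⊢
    intro g hg
    simp only [Fintype.sum_sum_type, Sum.elim_inl, Sum.elim_inr] at hg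
    have hb : ∀ j, g (Sum.inr j) = 0 := by
      intro j
      have := congrArg (B (e j)) hg
      simpa [h1, hf] using this
    simp only [hb, zero_smul, Finset.sum_const_zero, add_zero] at hg
    have ha := he (fun i => g (Sum.inl i)) hg
    rintro (i | j)
    · exact ha i
    · exact hb j
  set a := ∑ i, w i • e i with ha
  have ha0 : a ≠ 0 := by
    intro h
    rw [Fintype.linearIndependent_iff] at he
    exact hw (funext fun i => he w h i)
  have hTa : ∀ y, T a a y = ∑ i, ∑ j, w i * (w j * T (e i) (e j) y) := by
    intro y
    simp only [ha, map_sum, map_smul, LinearMap.sum_apply, LinearMap.smul_apply, smul_eq_mul, Finset.mul_sum]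
    refine Finset.sum_congr rfl fun i _ => Finset.sum_congr rfl fun j _ => by rw [H.t12]
  obtain ⟨y, hy1, hy2⟩ := H.sm a ha0 (by simp [ha, h1]) (by rw [hTa]; simp [ha, h2])
  obtain ⟨c, hc⟩ := span_exists (by simp) _ hind y
  simp only [Fintype.sum_sum_type, Sum.elim_inl, Sum.elim_inr] at hc
  obtain ⟨m, hm⟩ : ∃ m, w m ≠ 0 := by
    by_contra h
    push Not at h
    exact hw (funext h)
  have hfa : ∀ j, B a (f j) = w j := by
    intro j
    simp [ha, hf]
  have hea : ∀ j, B a (e j) = 0 := by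
    intro j
    simp [ha, h1]
  have e1 : ∑ j, c (Sum.inr j) * w j = 0 := by
    have := hy1
    rw [hc] at this
    simpa [hfa, hea] using this
  have e2 : T a a y = ∑ k, c (Sum.inr k) * T a a (f k) := by
    rw [hc]
    have : ∀ k, T a a (e k) = 0 := fun k => by rw [hTa]; simp [h2]
    simp [this]
  have e3 : ∀ k, w m * T a a (f k) = w k * T a a (f m) := by
    intro k
    have := hw2 m k
    rw [hTa, hTa]
    convert this using 2 <;> refine Finset.sum_congr rfl fun i _ => Finset.sum_congr rfl fun j _ => by ring
  apply hy2
  have : w m * T a a y = 0 := by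
    rw [e2, Finset.mul_sum]
    calc _ = ∑ k, c (Sum.inr k) * w k * T a a (f m) := by
            refine Finset.sum_congr rfl fun k _ => ?_
            rw [← mul_assoc, mul_comm (w m), mul_assoc, e3]; ring
      _ = 0 := by rw [← Finset.sum_mul, e1, zero_mul]
  simpa [hm] using this

end

section
open Topology Filter

/-- coordinatewise derivation -/
def ap (D : Derivation ℤ ℂ ℂ) (v : V6) : V6 := fun i => D (v i)

theorem ap_add (D : Derivation ℤ ℂ ℂ) (u v : V6) : ap D (u + v) = ap D u + ap D v := by
  ext i; simp [ap]
theorem ap_smul (D : Derivation ℤ ℂ ℂ) (c : ℂ) (v : V6) : ap D (c • v) = D c • v + c • ap D v := by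
  ext i; simp [ap]; ring
theorem add_ap (D D' : Derivation ℤ ℂ ℂ) (v : V6) : ap (D + D') v = ap D v + ap D' v := by
  ext i; simp [ap]
theorem smul_ap (c : ℂ) (D : Derivation ℤ ℂ ℂ) (v : V6) : ap (c • D) v = c • ap D v := by
  ext i; simp [ap]
theorem br_ap (D D' : Derivation ℤ ℂ ℂ) (v : V6) : ap ⁅D, D'⁆ v = ap D (ap D' v) - ap D' (ap D v) := by
  ext i; simp [ap, Derivation.commutator_apply]

structure Dv (B : V6 →ₗ[ℂ] V6 →ₗ[ℂ] ℂ) (T : V6 →ₗ[ℂ] V6 →ₗ[ℂ] V6 →ₗ[ℂ] ℂ)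
    (𝔇 : Submodule ℂ (Derivation ℤ ℂ ℂ)) : Prop where
  br : ∀ D ∈ 𝔇, ∀ D' ∈ 𝔇, ⁅D, D'⁆ ∈ 𝔇
  dB : ∀ D ∈ 𝔇, ∀ u v, D (B u v) = B (ap D u) v + B u (ap D v)
  dT : ∀ D ∈ 𝔇, ∀ u v w, D (T u v w) = T (ap D u) v w + T u (ap D v) w + T u v (ap D w)

theorem cubic_root (g0 g1 g2 g3 : ℂ) : ∃ u1 u2 : ℂ, (u1 ≠ 0 ∨ u2 ≠ 0) ∧
    g0 * u1 ^ 3 + g1 * u1 ^ 2 * u2 + g2 * u1 * u2 ^ 2 + g3 * u2 ^ 3 = 0 := by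
  by_cases h : g0 = 0
  · exact ⟨1, 0, by simp, by simp [h]⟩
  · have hd := Polynomial.degree_cubic (b := g1) (c := g2) (d := g3) h
    obtain ⟨x, hx⟩ := IsAlgClosed.exists_root _ (by rw [hd]; norm_num)
    refine ⟨x, 1, by simp, ?_⟩
    simpa [Polynomial.IsRoot] using hx

theorem quad_root (g0 g1 g2 : ℂ) : ∃ u1 u2 : ℂ, (u1 ≠ 0 ∨ u2 ≠ 0) ∧
    g0 * u1 ^ 2 + g1 * u1 * u2 + g2 * u2 ^ 2 = 0 := by
  by_cases h : g0 = 0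
  · exact ⟨1, 0, by simp, by simp [h]⟩
  · have hd := Polynomial.degree_quadratic (b := g1) (c := g2) h
    obtain ⟨x, hx⟩ := IsAlgClosed.exists_root _ (by rw [hd]; norm_num)
    refine ⟨x, 1, by simp, ?_⟩
    simpa [Polynomial.IsRoot] using hx

/-- the data of a line with adapted basis -/
structure LineB (B : V6 →ₗ[ℂ] V6 →ₗ[ℂ] ℂ) (T : V6 →ₗ[ℂ] V6 →ₗ[ℂ] V6 →ₗ[ℂ] ℂ)
    (f1 f2 : V6) : Prop where
  ind : ∀ a b : ℂ, a • f1 + b • f2 = 0 → a = 0 ∧ b = 0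
  b11 : B f1 f1 = 0
  b12 : B f1 f2 = 0
  b22 : B f2 f2 = 0
  t111 : T f1 f1 f1 = 0
  t112 : T f1 f1 f2 = 0
  t122 : T f1 f2 f2 = 0
  t222 : T f2 f2 f2 = 0

theorem adapted {B T} (H : Sm B T) {f1 f2 h1 h2 : V6} (L : LineB B T f1 f2)
    (hind : ∀ a b c d : ℂ, a • f1 + b • f2 + c • h1 + d • h2 = 0 → a = 0 ∧ b = 0 ∧ c = 0 ∧ d = 0)
    (h11 : B f1 h1 = 0) (h21 : B f2 h1 = 0) (h12 : B f1 h2 = 0) (h22 : B f2 h2 = 0) :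
    ∃ p1 p2 : V6, B f1 p1 = 1 ∧ B f1 p2 = 0 ∧ B f2 p1 = 0 ∧ B f2 p2 = 1 ∧
      ∀ y, ∃ a b c d : ℂ, y = a • f1 + b • f2 + c • h1 + d • h2 + B f1 y • p1 + B f2 y • p2 := by
  have hli : LinearIndependent ℂ ![f1, f2] := by
    rw [LinearIndependent.pair_iff]
    exact L.ind
  obtain ⟨p1, hp1⟩ := H.dual _ hli ![1, 0]
  obtain ⟨p2, hp2⟩ := H.dual _ hli ![0, 1]
  have a1 := hp1 0
  have a2 := hp1 1
  have a3 := hp2 0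
  have a4 := hp2 1
  simp at a1 a2 a3 a4
  refine ⟨p1, p2, a1, a3, a2, a4, ?_⟩
  have b21 : B f2 f1 = 0 := by rw [H.bs]; exact L.b12
  have h6 : LinearIndependent ℂ ![f1, f2, h1, h2, p1, p2] := by
    rw [Fintype.linearIndependent_iff]
    intro g hg
    simp [Fin.sum_univ_succ] at hg
    have e1 := congrArg (B f1) hg
    have e2 := congrArg (B f2) hg
    simp [L.b11, L.b12, L.b22, b21, h11, h12, h21, h22, a1, a2, a3, a4] at e1 e2
    obtain ⟨k1, k2, k3, k4⟩ := hind (g 0) (g 1) (g 2) (g 3) (by rw [← hg, e1, e2]; simp [add_assoc])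
    intro i
    fin_cases i <;> assumption
  intro y
  obtain ⟨c, hc⟩ := span_exists (by simp) _ h6 y
  simp [Fin.sum_univ_succ] at hc
  have e1 := congrArg (B f1) hc
  have e2 := congrArg (B f2) hc
  simp [L.b11, L.b12, L.b22, b21, h11, h12, h21, h22, a1, a2, a3, a4] at e1 e2
  refine ⟨c 0, c 1, c 2, c 3, ?_⟩
  rw [e1, e2, hc]
  simp [add_assoc]

theorem LineB.tu {B T} (H : Sm B T) {f1 f2 : V6} (u1 u2 : ℂ) (y : V6) :
    T (u1 • f1 + u2 • f2) (u1 • f1 + u2 • f2) y =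
      u1 ^ 2 * T f1 f1 y + 2 * u1 * u2 * T f1 f2 y + u2 ^ 2 * T f2 f2 y := by
  simp [H.t12 f2 f1 y]; ring

theorem LineB.nonvan {B T} (H : Sm B T) {f1 f2 h1 h2 p1 p2 : V6} (L : LineB B T f1 f2)
    (hsp : ∀ y, ∃ a b c d : ℂ, y = a • f1 + b • f2 + c • h1 + d • h2 + B f1 y • p1 + B f2 y • p2)
    (u1 u2 : ℂ) (hu : u1 ≠ 0 ∨ u2 ≠ 0)
    (e1 : u1 ^ 2 * T f1 f1 h1 + 2 * u1 * u2 * T f1 f2 h1 + u2 ^ 2 * T f2 f2 h1 = 0)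
    (e2 : u1 ^ 2 * T f1 f1 h2 + 2 * u1 * u2 * T f1 f2 h2 + u2 ^ 2 * T f2 f2 h2 = 0)
    (e3 : u2 * (u1 ^ 2 * T f1 f1 p1 + 2 * u1 * u2 * T f1 f2 p1 + u2 ^ 2 * T f2 f2 p1)
      - u1 * (u1 ^ 2 * T f1 f1 p2 + 2 * u1 * u2 * T f1 f2 p2 + u2 ^ 2 * T f2 f2 p2) = 0) : False := by
  set u := u1 • f1 + u2 • f2 with hu'
  have hu0 : u ≠ 0 := by
    intro h
    obtain ⟨k1, k2⟩ := L.ind _ _ h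
    simp [k1, k2] at hu
  have b21 : B f2 f1 = 0 := by rw [H.bs]; exact L.b12
  have tu := LineB.tu (f1 := f1) (f2 := f2) H u1 u2
  rw [← hu'] at tu
  have T1 : T u u f1 = 0 := by
    rw [tu, L.t111, H.t23, L.t112, H.t23, H.t12, H.t23, L.t122]; ring
  have T2 : T u u f2 = 0 := by
    rw [tu, L.t112, L.t122, L.t222]; ring
  obtain ⟨y, hy1, hy2⟩ := H.sm u hu0 (by simp [hu', L.b11, L.b12, L.b22, b21])
    (by conv_lhs => rw [hu', map_add, map_smul, map_smul, ← hu', T1, T2]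
        simp)
  apply hy2
  have hB : u1 * B f1 y + u2 * B f2 y = 0 := by simpa [hu'] using hy1
  obtain ⟨a, b, c, d, hy⟩ := hsp y
  have E : T u u y = B f1 y * T u u p1 + B f2 y * T u u p2 := by
    conv_lhs => rw [hy]
    simp only [map_add, map_smul, T1, T2, smul_eq_mul]
    rw [tu h1, tu h2, e1, e2]; ring
  rw [← tu, ← tu] at e3
  rw [E]
  rcases hu with h | h
  · have : u1 * (B f1 y * T u u p1 + B f2 y * T u u p2) = 0 := by
      linear_combination (T u u p1) * hB - B f2 y * e3
    simpa [h] using this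
  · have : u2 * (B f1 y * T u u p1 + B f2 y * T u u p2) = 0 := by
      linear_combination (T u u p2) * hB + B f1 y * e3
    simpa [h] using this

theorem LineB.section {B T 𝔇} (H : Sm B T) (K : Dv B T 𝔇) {f1 f2 h1 h2 p1 p2 : V6} (L : LineB B T f1 f2)
    (hsp : ∀ y, ∃ a b c d : ℂ, y = a • f1 + b • f2 + c • h1 + d • h2 + B f1 y • p1 + B f2 y • p2)
    (D) (hD : D ∈ 𝔇) : ∃ c z11 z12 z21 z22 a b a' b' : ℂ,
      c = B f1 (ap D f2) ∧
      ap D f1 = a • f1 + b • f2 + z11 • h1 + z12 • h2 - c • p2 ∧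
      ap D f2 = a' • f1 + b' • f2 + z21 • h1 + z22 • h2 + c • p1 ∧
      ∀ u1 u2, c * (u2 * (u1 ^ 2 * T f1 f1 p1 + 2 * u1 * u2 * T f1 f2 p1 + u2 ^ 2 * T f2 f2 p1)
      - u1 * (u1 ^ 2 * T f1 f1 p2 + 2 * u1 * u2 * T f1 f2 p2 + u2 ^ 2 * T f2 f2 p2)) +
      (u1 * z11 + u2 * z21) * (u1 ^ 2 * T f1 f1 h1 + 2 * u1 * u2 * T f1 f2 h1 + u2 ^ 2 * T f2 f2 h1) +
      (u1 * z12 + u2 * z22) * (u1 ^ 2 * T f1 f1 h2 + 2 * u1 * u2 * T f1 f2 h2 + u2 ^ 2 * T f2 f2 h2) = 0 := by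
  have k11 := K.dB D hD f1 f1
  have k12 := K.dB D hD f1 f2
  have k22 := K.dB D hD f2 f2
  rw [L.b11, H.bs (ap D f1)] at k11
  rw [L.b12, H.bs (ap D f1)] at k12
  rw [L.b22, H.bs (ap D f2)] at k22
  simp only [map_zero] at k11 k12 k22
  have B11 : B f1 (ap D f1) = 0 := by linear_combination (-1/2) * k11
  have B22 : B f2 (ap D f2) = 0 := by linear_combination (-1/2) * k22
  have B21 : B f2 (ap D f1) = - B f1 (ap D f2) := by linear_combination - k12
  obtain ⟨a, b, z11, z12, hs1⟩ := hsp (ap D f1)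
  obtain ⟨a', b', z21, z22, hs2⟩ := hsp (ap D f2)
  rw [B11, B21] at hs1
  rw [B22] at hs2
  have t211 : T f1 f2 f1 = 0 := by rw [H.t23, L.t112]
  have t212 : T f2 f2 f1 = 0 := (H.t23 _ _ _).trans ((H.t12 _ _ _).trans L.t122)
  have d111 := K.dT D hD f1 f1 f1
  have d112 := K.dT D hD f1 f1 f2
  have d122 := K.dT D hD f1 f2 f2
  have d222 := K.dT D hD f2 f2 f2
  have r1 : ∀ x y z, T x y z = T y z x := fun x y z => by rw [H.t12, H.t23]
  have r2 : ∀ x y z, T x y z = T z x y := fun x y z => by rw [H.t23, H.t12]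
  rw [L.t111, r1 (ap D f1), H.t23 f1 (ap D f1) f1, map_zero] at d111
  rw [L.t112, r1 (ap D f1), H.t23 f1 (ap D f1) f2, map_zero] at d112
  rw [L.t122, r1 (ap D f1), H.t23 f1 (ap D f2) f2, map_zero] at d122
  rw [L.t222, r1 (ap D f2), H.t23 f2 (ap D f2) f2, map_zero] at d222
  set c := B f1 (ap D f2) with hc
  refine ⟨c, z11, z12, z21, z22, a, b, a', b', rfl, ?_, ?_, ?_⟩
  · conv_lhs => rw [hs1]
    simp [sub_eq_add_neg]
  · conv_lhs => rw [hs2]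
    simp
  · intro u1 u2
    have E : ∀ g g', T g g' (ap D f1) = a * T g g' f1 + b * T g g' f2 + z11 * T g g' h1 + z12 * T g g' h2 - c * T g g' p2 := by
      intro g g'
      conv_lhs => rw [hs1]
      simp [sub_eq_add_neg]
    have E' : ∀ g g', T g g' (ap D f2) = a' * T g g' f1 + b' * T g g' f2 + z21 * T g g' h1 + z22 * T g g' h2 + c * T g g' p1 := by
      intro g g'
      conv_lhs => rw [hs2]
      simp
    simp only [E, E', L.t111, L.t112, L.t122, L.t222, t211, t212] at d111 d112 d122 d222
    linear_combination (-1/3) * u1 ^ 3 * d111 - u1 ^ 2 * u2 * d112 - u1 * u2 ^ 2 * d122 - (1/3) * u2 ^ 3 * d222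

end

section
open Topology Filter

def Stab (D : Derivation ℤ ℂ ℂ) (W : Submodule ℂ V6) : Prop := ∀ v ∈ W, ap D v ∈ W

theorem stab_pair {D : Derivation ℤ ℂ ℂ} {f1 f2 : V6} (h1 : ap D f1 ∈ Submodule.span ℂ {f1, f2})
    (h2 : ap D f2 ∈ Submodule.span ℂ {f1, f2}) : Stab D (Submodule.span ℂ {f1, f2}) := by
  intro v hv
  obtain ⟨a, b, rfl⟩ := Submodule.mem_span_pair.1 hv
  have m1 : f1 ∈ Submodule.span ℂ {f1, f2} := Submodule.subset_span (by simp)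
  have m2 : f2 ∈ Submodule.span ℂ {f1, f2} := Submodule.subset_span (by simp)
  rw [ap_add, ap_smul, ap_smul]
  exact add_mem (add_mem (Submodule.smul_mem _ _ m1) (Submodule.smul_mem _ _ h1))
    (add_mem (Submodule.smul_mem _ _ m2) (Submodule.smul_mem _ _ h2))

theorem LineB.ders {B T 𝔇} (H : Sm B T) (K : Dv B T 𝔇) {f1 f2 : V6} (L : LineB B T f1 f2)
    (D) (hD : D ∈ 𝔇) : B f1 (ap D f1) = 0 ∧ B f2 (ap D f2) = 0 ∧ B f2 (ap D f1) = - B f1 (ap D f2) ∧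
      T f1 f1 (ap D f1) = 0 ∧ 2 * T f1 f2 (ap D f1) + T f1 f1 (ap D f2) = 0 ∧
      T f2 f2 (ap D f1) + 2 * T f1 f2 (ap D f2) = 0 ∧ T f2 f2 (ap D f2) = 0 := by
  have k11 := K.dB D hD f1 f1
  have k12 := K.dB D hD f1 f2
  have k22 := K.dB D hD f2 f2
  rw [L.b11, H.bs (ap D f1)] at k11
  rw [L.b12, H.bs (ap D f1)] at k12
  rw [L.b22, H.bs (ap D f2)] at k22
  simp only [map_zero] at k11 k12 k22
  have d111 := K.dT D hD f1 f1 f1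
  have d112 := K.dT D hD f1 f1 f2
  have d122 := K.dT D hD f1 f2 f2
  have d222 := K.dT D hD f2 f2 f2
  have r1 : ∀ x y z, T x y z = T y z x := fun x y z => by rw [H.t12, H.t23]
  rw [L.t111, r1 (ap D f1), H.t23 f1 (ap D f1) f1, map_zero] at d111
  rw [L.t112, r1 (ap D f1), H.t23 f1 (ap D f1) f2, map_zero] at d112
  rw [L.t122, r1 (ap D f1), H.t23 f1 (ap D f2) f2, map_zero] at d122
  rw [L.t222, r1 (ap D f2), H.t23 f2 (ap D f2) f2, map_zero] at d222
  refine ⟨?_, ?_, ?_, ?_, ?_, ?_, ?_⟩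
  · linear_combination (-1/2) * k11
  · linear_combination (-1/2) * k22
  · linear_combination - k12
  · linear_combination (-1/3) * d111
  · linear_combination - d112
  · linear_combination - d122
  · linear_combination (-1/3) * d222

theorem caseA {B T 𝔇} (H : Sm B T) (K : Dv B T 𝔇) {f1 f2 : V6} (L : LineB B T f1 f2)
    (E) (hE : E ∈ 𝔇) (hc : B f1 (ap E f2) = 0)
    (hind : ∀ a b c d : ℂ, a • f1 + b • f2 + c • ap E f1 + d • ap E f2 = 0 → a = 0 ∧ b = 0 ∧ c = 0 ∧ d = 0)
    (D) (hD : D ∈ 𝔇) : ∃ k : ℂ, Stab (D - k • E) (Submodule.span ℂ {f1, f2}) := by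
  obtain ⟨b1, b2, b3, t1, t2, t3, t4⟩ := L.ders H K E hE
  rw [hc, neg_zero] at b3
  obtain ⟨p1, p2, q11, q12, q21, q22, hsp⟩ := adapted H L hind b1 b3 hc b2
  have hnv := L.nonvan H hsp
  obtain ⟨c, z11, z12, z21, z22, a, b, a', b', -, hs1, hs2, heq⟩ := L.section H K hsp D hD
  set α1 := 2 * T f1 f2 (ap E f1) with hα1
  set α2 := T f2 f2 (ap E f1) with hα2
  have t2' : T f1 f1 (ap E f2) = - α1 := by linear_combination t2
  have t3' : 2 * T f1 f2 (ap E f2) = - α2 := by linear_combination t3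
  by_cases h0 : α1 = 0 ∧ α2 = 0
  · exfalso
    obtain ⟨h1, h2⟩ := h0
    obtain ⟨u1, u2, hu, hroot⟩ := cubic_root (- T f1 f1 p2) (T f1 f1 p1 - 2 * T f1 f2 p2)
      (2 * T f1 f2 p1 - T f2 f2 p2) (T f2 f2 p1)
    refine hnv u1 u2 hu ?_ ?_ ?_
    · linear_combination u1 ^ 2 * t1 + u1 * u2 * h1 + u2 ^ 2 * h2
    · linear_combination u1 ^ 2 * t2' + u1 * u2 * t3' + u2 ^ 2 * t4 - u1 ^ 2 * h1 - u1 * u2 * h2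
    · linear_combination hroot
  · have hv : α2 ≠ 0 ∨ -α1 ≠ 0 := by
      by_contra h
      push Not at h
      exact h0 ⟨by simpa using h.2, h.1⟩
    have ea : ∀ u1 u2, u1 ^ 2 * T f1 f1 (ap E f1) + 2 * u1 * u2 * T f1 f2 (ap E f1) + u2 ^ 2 * T f2 f2 (ap E f1)
        = u2 * (α1 * u1 + α2 * u2) := fun u1 u2 => by linear_combination u1 ^ 2 * t1
    have eb : ∀ u1 u2, u1 ^ 2 * T f1 f1 (ap E f2) + 2 * u1 * u2 * T f1 f2 (ap E f2) + u2 ^ 2 * T f2 f2 (ap E f2)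
        = - u1 * (α1 * u1 + α2 * u2) := fun u1 u2 => by
          linear_combination u1 ^ 2 * t2' + u1 * u2 * t3' + u2 ^ 2 * t4
    have hc0 : c = 0 := by
      by_contra hc0
      refine hnv α2 (-α1) hv (by rw [ea]; ring) (by rw [eb]; ring) ?_
      have := heq α2 (-α1)
      rw [ea, eb] at this
      have h3 : c * ((-α1) * (α2 ^ 2 * T f1 f1 p1 + 2 * α2 * (-α1) * T f1 f2 p1 + (-α1) ^ 2 * T f2 f2 p1)
        - α2 * (α2 ^ 2 * T f1 f1 p2 + 2 * α2 * (-α1) * T f1 f2 p2 + (-α1) ^ 2 * T f2 f2 p2)) = 0 := by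
        linear_combination this
      simpa [hc0] using h3
    simp only [eb, hc0] at heq
    have g10 := heq 1 0
    have g01 := heq 0 1
    have g11 := heq 1 1
    have g1m := heq 1 (-1)
    have g21 := heq 1 2
    ring_nf at g10 g01 g11 g1m g21
    -- coefficient identities
    have c1 : z12 * α1 = 0 := by linear_combination z11 * t1 - g10
    have c4 : z21 * α2 = 0 := by linear_combination g01
    have c2 : (z11 - z22) * α1 - z12 * α2 = 0 := by
      linear_combination (g11 - g1m) / 2 - g01 - z21 * t1
    have c3 : (z11 - z22) * α2 + z21 * α1 = 0 := by
      linear_combination (g11 + g1m) / 2 - g10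
    have hz : z12 = 0 ∧ z21 = 0 ∧ z11 = z22 := by
      by_cases h1 : α1 = 0
      · have h2 : α2 ≠ 0 := fun h => h0 ⟨h1, h⟩
        simp only [h1, mul_zero, add_zero, zero_sub, neg_eq_zero, mul_eq_zero, h2, or_false] at c2 c3 c4
        exact ⟨c2, c4, by linear_combination c3⟩
      · simp only [mul_eq_zero, h1, or_false] at c1
        simp only [c1, zero_mul, sub_zero, mul_eq_zero, h1, or_false] at c2
        simp only [c2, zero_mul, zero_add, mul_eq_zero, h1, or_false] at c3
        exact ⟨c1, c3, by linear_combination c2⟩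
    obtain ⟨hz1, hz2, hz3⟩ := hz
    refine ⟨z11, stab_pair ?_ ?_⟩
    · rw [sub_eq_add_neg, add_ap, ← neg_smul, smul_ap, hs1, hz1, hc0]
      refine Submodule.mem_span_pair.2 ⟨a, b, ?_⟩
      module
    · rw [sub_eq_add_neg, add_ap, ← neg_smul, smul_ap, hs2, hz2, hc0, hz3]
      refine Submodule.mem_span_pair.2 ⟨a', b', ?_⟩
      module


theorem pick_perp {B T} (H : Sm B T) {f1 f2 χ : V6} : ∃ h2, B f1 h2 = 0 ∧ B f2 h2 = 0 ∧
    h2 ∉ Submodule.span ℂ {f1, f2, χ} := by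
  by_contra hcon
  push Not at hcon
  let φ : V6 →ₗ[ℂ] (ℂ × ℂ) := (B f1).prod (B f2)
  have hk : LinearMap.ker φ ≤ Submodule.span ℂ {f1, f2, χ} := by
    intro h hh
    have : B f1 h = 0 ∧ B f2 h = 0 := by simpa [φ, LinearMap.mem_ker] using hh
    exact hcon h this.1 this.2
  have h1 := LinearMap.finrank_range_add_finrank_ker φ
  have h2 : Module.finrank ℂ (LinearMap.range φ) ≤ 2 := by
    have := Submodule.finrank_le (LinearMap.range φ)
    simpa using this
  have h3 := Submodule.finrank_mono hk
  have h4 : Module.finrank ℂ (Submodule.span ℂ {f1, f2, χ}) ≤ 3 := by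
    have := finrank_span_finset_le_card (R := ℂ) ({f1, f2, χ} : Finset V6)
    have h5 : ({f1, f2, χ} : Finset V6).card ≤ 3 := Finset.card_le_three
    rw [show ((({f1, f2, χ} : Finset V6)) : Set V6) = {f1, f2, χ} by simp] at this
    unfold Set.finrank at this
    omega
  have h6 : Module.finrank ℂ V6 = 6 := by simp
  omega

end

section
open Topology Filter
set_option linter.unusedSimpArgs false
set_option linter.unusedVariables false

theorem mem_span3 {f1 f2 f3 v : V6} : v ∈ Submodule.span ℂ {f1, f2, f3} ↔ ∃ a b c : ℂ, v = a • f1 + b • f2 + c • f3 := by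
  rw [Submodule.mem_span_triple]
  constructor <;> rintro ⟨a, b, c, h⟩ <;> exact ⟨a, b, c, h.symm⟩

theorem caseB {B T 𝔇} (H : Sm B T) (K : Dv B T 𝔇) {f1 f2 : V6} (L : LineB B T f1 f2)
    (E) (hE : E ∈ 𝔇) (a2 b2 : ℂ) (hE2 : ap E f2 = a2 • f1 + b2 • f2)
    (hχ : ap E f1 ∉ Submodule.span ℂ {f1, f2})
    (D') (hD' : D' ∈ 𝔇) : ∃ k : ℂ, Stab (D' - k • E) (Submodule.span ℂ {f1, f2}) := by
  obtain ⟨b1, -, b3, t1, t2, t3, -⟩ := L.ders H K E hE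
  set χ := ap E f1 with hχd
  have t211 : T f1 f2 f1 = 0 := by rw [H.t23, L.t112]
  have t212 : T f2 f2 f1 = 0 := (H.t23 _ _ _).trans ((H.t12 _ _ _).trans L.t122)
  rw [hE2] at b3 t2 t3
  simp only [map_add, map_smul, L.b11, L.b12, L.t111, L.t112, L.t122, t211, smul_eq_mul, mul_zero, add_zero, neg_zero] at b3 t2 t3
  have t2' : T f1 f2 χ = 0 := by linear_combination t2 / 2
  obtain ⟨h2, hp1, hp2, hn⟩ := pick_perp H (f1 := f1) (f2 := f2) (χ := χ)
  have hind3 : ∀ a b c : ℂ, a • f1 + b • f2 + c • χ = 0 → a = 0 ∧ b = 0 ∧ c = 0 := by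
    intro a b c h
    have hc : c = 0 := by
      by_contra hc
      apply hχ
      refine Submodule.mem_span_pair.2 ⟨-c⁻¹ * a, -c⁻¹ * b, ?_⟩
      have h' : c • χ = - (a • f1 + b • f2) := by rw [eq_neg_iff_add_eq_zero, ← h]; abel
      have : χ = c⁻¹ • (c • χ) := by rw [smul_smul, inv_mul_cancel₀ hc, one_smul]
      rw [this, h']; module
    rw [hc, zero_smul, add_zero] at h
    exact ⟨(L.ind _ _ h).1, (L.ind _ _ h).2, hc⟩
  have hind : ∀ a b c d : ℂ, a • f1 + b • f2 + c • χ + d • h2 = 0 → a = 0 ∧ b = 0 ∧ c = 0 ∧ d = 0 := by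
    intro a b c d h
    have hd : d = 0 := by
      by_contra hd
      apply hn
      refine mem_span3.2 ⟨-d⁻¹ * a, -d⁻¹ * b, -d⁻¹ * c, ?_⟩
      have h' : d • h2 = - (a • f1 + b • f2 + c • χ) := by rw [eq_neg_iff_add_eq_zero, ← h]; abel
      have : h2 = d⁻¹ • (d • h2) := by rw [smul_smul, inv_mul_cancel₀ hd, one_smul]
      rw [this, h']; module
    rw [hd, zero_smul, add_zero] at h
    obtain ⟨k1, k2, k3⟩ := hind3 _ _ _ h
    exact ⟨k1, k2, k3, hd⟩
  obtain ⟨p1, p2, q11, q12, q21, q22, hsp⟩ := adapted H L hind b1 b3 hp1 hp2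
  have hnv := L.nonvan H hsp
  have key : ∀ D ∈ 𝔇, ∃ a b z a' b' z' : ℂ, ap D f1 = a • f1 + b • f2 + z • χ ∧
      ap D f2 = a' • f1 + b' • f2 + z' • χ := by
    intro D hD
    obtain ⟨c, z11, z12, z21, z22, a, b, a', b', -, hs1, hs2, heq⟩ := L.section H K hsp D hD
    simp only [t1, t2', t3, mul_zero, add_zero, zero_add] at heq hnv
    have hc0 : c = 0 := by
      by_contra hc0
      obtain ⟨u1, u2, hu, hr⟩ := quad_root (T f1 f1 h2) (2 * T f1 f2 h2) (T f2 f2 h2)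
      have hr' : u1 ^ 2 * T f1 f1 h2 + 2 * u1 * u2 * T f1 f2 h2 + u2 ^ 2 * T f2 f2 h2 = 0 := by
        linear_combination hr
      have := heq u1 u2
      rw [hr', mul_zero, add_zero] at this
      exact hnv u1 u2 hu trivial hr' (by simpa [hc0] using this)
    simp only [hc0, zero_mul, zero_add] at heq
    have hz : z12 = 0 ∧ z22 = 0 := by
      by_contra hz
      have g10 := heq 1 0
      have g01 := heq 0 1
      have g11 := heq 1 1
      have g1m := heq 1 (-1)
      have c1 : z12 * T f1 f1 h2 = 0 := by linear_combination g10
      have c2 : z22 * T f2 f2 h2 = 0 := by linear_combination g01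
      have c3 : z12 * T f2 f2 h2 + 2 * z22 * T f1 f2 h2 = 0 := by linear_combination (g11 + g1m) / 2 - g10
      have c4 : 2 * z12 * T f1 f2 h2 + z22 * T f1 f1 h2 = 0 := by linear_combination (g11 - g1m) / 2 - g01
      have hb : T f1 f1 h2 = 0 ∧ T f1 f2 h2 = 0 ∧ T f2 f2 h2 = 0 := by
        by_cases hz1 : z12 = 0
        · have hz2 : z22 ≠ 0 := fun h => hz ⟨hz1, h⟩
          simp [hz1, hz2] at c2 c3 c4
          exact ⟨c4, c3, c2⟩
        · simp [hz1] at c1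
          simp [hz1, c1] at c4
          simp [hz1, c4] at c3
          exact ⟨c1, c4, c3⟩
      obtain ⟨u1, u2, hu, hroot⟩ := cubic_root (- T f1 f1 p2) (T f1 f1 p1 - 2 * T f1 f2 p2)
        (2 * T f1 f2 p1 - T f2 f2 p2) (T f2 f2 p1)
      exact hnv u1 u2 hu trivial (by simp [hb]) (by linear_combination hroot)
    refine ⟨a, b, z11, a', b', z21, ?_, ?_⟩
    · rw [hs1, hz.1, hc0]; module
    · rw [hs2, hz.2, hc0]; module
  obtain ⟨a, b, k1, a', b', k2, e1, e2⟩ := key D' hD'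
  by_cases hk2 : k2 = 0
  · refine ⟨k1, stab_pair ?_ ?_⟩
    · rw [sub_eq_add_neg, add_ap, ← neg_smul, smul_ap, e1]
      refine Submodule.mem_span_pair.2 ⟨a, b, ?_⟩
      rw [← hχd]; module
    · rw [sub_eq_add_neg, add_ap, ← neg_smul, smul_ap, e2, hk2, hE2]
      refine Submodule.mem_span_pair.2 ⟨a' - k1 * a2, b' - k1 * b2, ?_⟩
      module
  exfalso
  have hEχ : ∃ x y z : ℂ, ap E χ = x • f1 + y • f2 + z • χ := by
    obtain ⟨_, _, _, m1, m2, m3, -, hbr⟩ := key _ (K.br D' hD' E hE)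
    rw [br_ap, hE2, e2, ap_add, ap_smul, ap_smul, ap_add, ap_add, ap_smul, ap_smul, ap_smul, e1, e2, hE2,
      ← hχd] at hbr
    have h' : k2 • ap E χ ∈ Submodule.span ℂ {f1, f2, χ} := by
      refine mem_span3.2 ⟨D' a2 + a2 * a + b2 * a' - E a' - b' * a2 - m1,
        a2 * b + D' b2 + b2 * b' - E b' - b' * b2 - m2, a2 * k1 + b2 * k2 - a' - E k2 - m3, ?_⟩
      linear_combination (norm := module) -hbr
    have := Submodule.smul_mem _ k2⁻¹ h'
    rw [smul_smul, inv_mul_cancel₀ hk2, one_smul] at this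
    exact mem_span3.1 this
  obtain ⟨x, y, z, hEχ⟩ := hEχ
  have sy : ∀ u v w, T u v w = T w v u := fun u v w => by rw [H.t12, H.t23, H.t12]
  have Bχ : B χ χ = 0 := by
    have := K.dB E hE f1 χ
    rw [b1, map_zero, ← hχd, hEχ] at this
    simp [L.b11, L.b12, b1] at this
    exact this.symm
  have T2χ : T f2 χ χ = 0 := by
    have := K.dT E hE f1 f2 χ
    rw [t2', map_zero, ← hχd, hEχ, hE2] at this
    simp [t1, t2', L.t112, t211, H.t23 f1 f2 f2, L.t122] at this
    rw [H.t12 f2]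
    exact this.symm
  have T1χ : T f1 χ χ = 0 := by
    have := K.dT E hE f1 f1 χ
    rw [t1, map_zero, ← hχd, hEχ] at this
    simp [t1, t2', L.t111, L.t112, H.t12 χ f1] at this
    linear_combination - this / 2
  have Tχ : T χ χ χ = 0 := by
    have := K.dT E hE f1 χ χ
    rw [T1χ, map_zero, ← hχd, hEχ] at this
    simp [T1χ, H.t23 f1 χ f1, H.t23 f1 χ f2, t1, t2'] at this
    exact this.symm
  have g1 : T f1 χ f1 = 0 := by rw [H.t23, t1]
  have g2 : T f1 χ f2 = 0 := by rw [H.t23, t2']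
  have g3 : T f2 χ f2 = 0 := by rw [H.t23, t3]
  have g4 : T f2 f1 χ = 0 := by rw [H.t12, t2']
  have g5 : T f2 χ f1 = 0 := by rw [H.t23, g4]
  have g6 : T f2 f1 f1 = 0 := by rw [H.t12, t211]
  have g7 : T f2 f1 f2 = 0 := by rw [H.t12, L.t122]
  refine no_plane H ![f1, f2, χ] ?_ ?_ ?_
  · rw [Fintype.linearIndependent_iff]
    intro g hg
    simp [Fin.sum_univ_succ, ← add_assoc] at hg
    obtain ⟨h1, h2, h3⟩ := hind3 _ _ _ hg
    intro i; fin_cases i <;> assumption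
  · intro i j
    fin_cases i <;> fin_cases j <;> simp [L.b11, L.b12, L.b22, b1, b3, Bχ, H.bs f2 f1, H.bs χ f1, H.bs χ f2]
  · intro i j k
    fin_cases i <;> fin_cases j <;> fin_cases k <;>
      simp [L.t111, L.t112, L.t122, L.t222, t211, t212, t1, t2', t3, g1, g2, g3, g4, g5, g6, g7, T1χ, T2χ, Tχ, H.t12 χ f1, H.t12 χ f2,
       H.t23 χ χ f1, H.t23 χ χ f2]

theorem LineB.rebase {B T} (H : Sm B T) {f1 f2 : V6} (L : LineB B T f1 f2) (c d : ℂ) (hc : c ≠ 0) :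
    LineB B T f2 (c • f1 + d • f2) := by
  have t211 : T f1 f2 f1 = 0 := by rw [H.t23, L.t112]
  have t212 : T f2 f2 f1 = 0 := (H.t23 _ _ _).trans ((H.t12 _ _ _).trans L.t122)
  have b21 : B f2 f1 = 0 := by rw [H.bs, L.b12]
  have g6 : T f2 f1 f1 = 0 := by rw [H.t12, t211]
  have g7 : T f2 f1 f2 = 0 := by rw [H.t12, L.t122]
  constructor
  · intro a b h
    obtain ⟨h1, h2⟩ := L.ind (b * c) (a + b * d) (by rw [← h]; module)
    have hb : b = 0 := by simpa [hc] using h1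
    exact ⟨by simpa [hb] using h2, hb⟩
  all_goals simp [L.b11, L.b12, L.b22, L.t111, L.t112, L.t122, L.t222, t211, t212, b21, g6, g7]

theorem line_rank0 {B T 𝔇} (H : Sm B T) (K : Dv B T 𝔇) {f1 f2 : V6} (L : LineB B T f1 f2)
    (E) (hE : E ∈ 𝔇) (hc : B f1 (ap E f2) = 0) (D') (hD' : D' ∈ 𝔇) :
    ∃ c1 c2 : ℂ, (c1 ≠ 0 ∨ c2 ≠ 0) ∧ Stab (c1 • D' + c2 • E) (Submodule.span ℂ {f1, f2}) := by
  have fin : (∃ k : ℂ, Stab (D' - k • E) (Submodule.span ℂ {f1, f2})) →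
     ∃ c1 c2 : ℂ, (c1 ≠ 0 ∨ c2 ≠ 0) ∧ Stab (c1 • D' + c2 • E) (Submodule.span ℂ {f1, f2}) := by
    rintro ⟨k, hk⟩
    exact ⟨1, -k, by simp, by rw [one_smul, neg_smul, ← sub_eq_add_neg]; exact hk⟩
  by_cases hind : ∀ a b c d : ℂ, a • f1 + b • f2 + c • ap E f1 + d • ap E f2 = 0 → a = 0 ∧ b = 0 ∧ c = 0 ∧ d = 0
  · exact fin (caseA H K L E hE hc hind D' hD')
  · push Not at hind
    obtain ⟨a, b, c, d, hrel, hne⟩ := hind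
    by_cases h0 : c = 0
    · have hd : d ≠ 0 := by
        rintro rfl
        rw [h0, zero_smul, zero_smul, add_zero, add_zero] at hrel
        obtain ⟨h1, h2⟩ := L.ind _ _ hrel
        exact hne h1 h2 h0 rfl
      have e2 : ap E f2 = (-d⁻¹ * a) • f1 + (-d⁻¹ * b) • f2 := by
        have h' : d • ap E f2 = - (a • f1 + b • f2) := by
          rw [eq_neg_iff_add_eq_zero, ← hrel, h0, zero_smul]; abel
        have : ap E f2 = d⁻¹ • (d • ap E f2) := by rw [smul_smul, inv_mul_cancel₀ hd, one_smul]
        rw [this, h']; module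
      by_cases hm : ap E f1 ∈ Submodule.span ℂ {f1, f2}
      · refine ⟨0, 1, by simp, ?_⟩
        rw [zero_smul, zero_add, one_smul]
        exact stab_pair hm (Submodule.mem_span_pair.2 ⟨_, _, e2.symm⟩)
      · exact fin (caseB H K L E hE _ _ e2 hm D' hD')
    · have L' := L.rebase H c d h0
      have hspan : Submodule.span ℂ {f2, c • f1 + d • f2} = Submodule.span ℂ {f1, f2} := by
        apply le_antisymm
        · rw [Submodule.span_le]
          rintro x (rfl | rfl)
          · exact Submodule.subset_span (by simp)
          · exact Submodule.mem_span_pair.2 ⟨c, d, rfl⟩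
        · rw [Submodule.span_le]
          rintro x (rfl | rfl)
          · refine Submodule.mem_span_pair.2 ⟨- c⁻¹ * d, c⁻¹, ?_⟩
            rw [smul_add, smul_smul, inv_mul_cancel₀ h0]; module
          · exact Submodule.subset_span (by simp)
      have e2 : ap E (c • f1 + d • f2) ∈ Submodule.span ℂ {f2, c • f1 + d • f2} := by
        rw [hspan, Submodule.mem_span_pair]
        refine ⟨E c - a, E d - b, ?_⟩
        rw [ap_add, ap_smul, ap_smul]
        linear_combination (norm := module) -hrel
      rw [← hspan]
      rw [← hspan] at fin
      by_cases hm : ap E f2 ∈ Submodule.span ℂ {f2, c • f1 + d • f2}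
      · refine ⟨0, 1, by simp, ?_⟩
        rw [zero_smul, zero_add, one_smul]
        exact stab_pair hm e2
      · obtain ⟨x, y, hxy⟩ := Submodule.mem_span_pair.1 e2
        exact fin (caseB H K L' E hE _ _ hxy.symm hm D' hD')

theorem line_rank {B T 𝔇} (H : Sm B T) (K : Dv B T 𝔇) {f1 f2 : V6} (L : LineB B T f1 f2)
    (D1) (hD1 : D1 ∈ 𝔇) (D2) (hD2 : D2 ∈ 𝔇) :
    ∃ c1 c2 : ℂ, (c1 ≠ 0 ∨ c2 ≠ 0) ∧ Stab (c1 • D1 + c2 • D2) (Submodule.span ℂ {f1, f2}) := by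
  by_cases h : B f1 (ap D2 f2) = 0
  · exact line_rank0 H K L D2 hD2 h D1 hD1
  · set a := B f1 (ap D2 f2) with ha
    set b := B f1 (ap D1 f2) with hb
    obtain ⟨c1, c2, hne, hs⟩ := line_rank0 H K L (a • D1 - b • D2)
      (sub_mem (Submodule.smul_mem _ _ hD1) (Submodule.smul_mem _ _ hD2))
      (by rw [sub_eq_add_neg, ← neg_smul, add_ap, smul_ap, smul_ap, map_add, map_smul, map_smul, ← ha, ← hb]
          simp; ring) D2 hD2
    refine ⟨c2 * a, c1 - c2 * b, ?_, ?_⟩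
    · by_cases h2 : c2 = 0
      · right; simpa [h2] using hne
      · left; simp [h2, h]
    · convert hs using 1; module

theorem line_dim {B T 𝔇} (H : Sm B T) (K : Dv B T 𝔇) {f1 f2 : V6} (L : LineB B T f1 f2)
    (D : Fin 4 → Derivation ℤ ℂ ℂ) (hD : ∀ i, D i ∈ 𝔇) (p : V6)
    (hi : LinearIndependent ℂ fun i => ap (D i) p) (W : Submodule ℂ V6) (hW : Module.finrank ℂ W ≤ 2)
    (hs : ∀ E ∈ 𝔇, Stab E (Submodule.span ℂ {f1, f2}) → ap E p ∈ W) : False := by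
  let φ := Fintype.linearCombination ℂ (fun i => ap (D i) p)
  have hinj : Function.Injective φ := by
    rw [← LinearMap.ker_eq_bot]
    exact Fintype.linearIndependent_iff'.1 hi
  have hsum : ∀ c : Fin 4 → ℂ, ap (∑ i, c i • D i) p = φ c := by
    intro c
    simp only [φ, Fintype.linearCombination_apply, Fin.sum_univ_four, add_ap, smul_ap]
  let W' := W.comap φ
  have h1 : Module.finrank ℂ W' ≤ 2 := by
    refine le_trans ?_ hW
    refine LinearMap.finrank_le_finrank_of_injective (f := (φ.restrict (p := W') (q := W) (fun x hx => hx))) ?_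
    intro x y hxy
    exact Subtype.ext (hinj (congrArg Subtype.val hxy))
  have h2 := Submodule.finrank_quotient_add_finrank W'
  have h3 : Module.finrank ℂ (Fin 4 → ℂ) = 4 := by simp
  have h4 : 1 < Module.finrank ℂ ((Fin 4 → ℂ) ⧸ W') := by omega
  have : Nontrivial ((Fin 4 → ℂ) ⧸ W') := Module.nontrivial_of_finrank_pos (R := ℂ) (by omega)
  obtain ⟨x, hx⟩ := exists_ne (0 : (Fin 4 → ℂ) ⧸ W')
  obtain ⟨y, hxy⟩ := exists_linearIndependent_pair_of_one_lt_finrank h4 hx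
  obtain ⟨c, rfl⟩ := Submodule.Quotient.mk_surjective _ x
  obtain ⟨c', rfl⟩ := Submodule.Quotient.mk_surjective _ y
  have m : ∀ c : Fin 4 → ℂ, (∑ i, c i • D i) ∈ 𝔇 := fun c =>
    Submodule.sum_mem _ fun i _ => Submodule.smul_mem _ _ (hD i)
  obtain ⟨a, b, hab, hst⟩ := line_rank H K L _ (m c) _ (m c')
  have hmem := hs _ (add_mem (Submodule.smul_mem _ a (m c)) (Submodule.smul_mem _ b (m c'))) hst
  rw [add_ap, smul_ap, smul_ap, hsum, hsum, ← map_smul, ← map_smul, ← map_add] at hmem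
  have hq : a • c + b • c' ∈ W' := hmem
  rw [← Submodule.Quotient.mk_eq_zero, Submodule.Quotient.mk_add, Submodule.Quotient.mk_smul,
    Submodule.Quotient.mk_smul] at hq
  obtain ⟨h5, h6⟩ := LinearIndependent.pair_iff.1 hxy a b hq
  simp [h5, h6] at hab

theorem line_no_generic {B T 𝔇} (H : Sm B T) (K : Dv B T 𝔇) {f1 f2 : V6} (L : LineB B T f1 f2)
    (D : Fin 4 → Derivation ℤ ℂ ℂ) (hD : ∀ i, D i ∈ 𝔇) (p : V6) (hp : p ∈ Submodule.span ℂ {f1, f2})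
    (hi : LinearIndependent ℂ fun i => ap (D i) p) : False := by
  refine line_dim H K L D hD p hi (Submodule.span ℂ {f1, f2}) ?_ fun E _ hE => hE p hp
  have := finrank_span_finset_le_card (R := ℂ) ({f1, f2} : Finset V6)
  have h5 : ({f1, f2} : Finset V6).card ≤ 2 := Finset.card_le_two
  rw [show ((({f1, f2} : Finset V6)) : Set V6) = {f1, f2} by simp] at this
  unfold Set.finrank at this
  omega

end

section
open Topology Filter
set_option linter.unusedSimpArgs false
set_option linter.unusedVariables false

theorem adapted3 {B T} (H : Sm B T) {p : V6} (hp : p ≠ 0) (hpp : B p p = 0) :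
    ∃ u v : V6, ∃ ω : Fin 3 → V6, B p u = 0 ∧ 2 * B p v = 1 ∧ B u u = 1 ∧ B u v = 0 ∧ B v v = 0 ∧
      (∀ i, B p (ω i) = 0) ∧ (∀ i, B u (ω i) = 0) ∧ (∀ i, B v (ω i) = 0) ∧
      LinearIndependent ℂ ![p, u, v, ω 0, ω 1, ω 2] := by
  obtain ⟨v1, hv1⟩ : ∃ v, B p v ≠ 0 := by
    by_contra h
    push Not at h
    exact hp (H.nd p h)
  obtain ⟨v2, hv2⟩ : ∃ v, 2 * B p v = 1 := ⟨(2 * B p v1)⁻¹ • v1, by simp; field_simp⟩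
  obtain ⟨v, hv, hvv⟩ : ∃ v, 2 * B p v = 1 ∧ B v v = 0 := by
    refine ⟨v2 - B v2 v2 • p, ?_, ?_⟩
    · simp [hpp, hv2]
    · simp [hpp, H.bs v2 p]
      linear_combination (-B v2 v2) * hv2
  obtain ⟨u1, h1, h2, h3⟩ : ∃ u, B p u = 0 ∧ B v u = 0 ∧ B u u ≠ 0 := by
    by_contra hcon
    push Not at hcon
    have hz : ∀ x y, B p x = 0 → B v x = 0 → B p y = 0 → B v y = 0 → B x y = 0 := by
      intro x y a1 a2 a3 a4
      have e1 := hcon x a1 a2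
      have e2 := hcon y a3 a4
      have e3 := hcon (x + y) (by simp [a1, a3]) (by simp [a2, a4])
      simp [e1, e2, H.bs y x] at e3
      exact e3
    obtain ⟨x, hx1, hx2, hx3⟩ := pick_perp H (f1 := p) (f2 := v) (χ := 0)
    have : x = 0 := by
      refine H.nd x fun w => ?_
      have e := hz x (w - (2 * B p w) • v - (2 * B v w) • p) hx1 hx2
        (by simp [hpp]; linear_combination (-B p w) * hv)
        (by simp [hvv, H.bs v p]; linear_combination (-B v w) * hv)
      simpa [H.bs x v, H.bs x p, hx1, hx2] using e
    exact hx3 (by rw [this]; exact zero_mem _)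
  obtain ⟨k, hk⟩ := IsAlgClosed.exists_pow_nat_eq (B u1 u1) (n := 2) (by norm_num)
  have hk0 : k ≠ 0 := by rintro rfl; apply h3; rw [← hk]; simp
  obtain ⟨u, hu1, hu2, hu3⟩ : ∃ u, B p u = 0 ∧ B v u = 0 ∧ B u u = 1 := by
    refine ⟨k⁻¹ • u1, by simp [h1], by simp [h2], ?_⟩
    simp [← hk]; field_simp
  let φ : V6 →ₗ[ℂ] (ℂ × ℂ × ℂ) := (B p).prod ((B u).prod (B v))
  have hf := LinearMap.finrank_range_add_finrank_ker φ
  have hf2 : Module.finrank ℂ (LinearMap.range φ) ≤ 3 := by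
    have := Submodule.finrank_le (LinearMap.range φ)
    simpa using this
  have h6 : Module.finrank ℂ V6 = 6 := by simp
  obtain ⟨ω', hω'⟩ := exists_linearIndependent_of_le_finrank (R := ℂ) (M := LinearMap.ker φ) (n := 3) (by omega)
  have hω : ∀ i, B p (ω' i : V6) = 0 ∧ B u (ω' i : V6) = 0 ∧ B v (ω' i : V6) = 0 := by
    intro i
    have := (ω' i).2
    simpa [φ, LinearMap.mem_ker] using this
  have hli : LinearIndependent ℂ (fun i => (ω' i : V6)) := hω'.map' (LinearMap.ker φ).subtype (by simp)
  refine ⟨u, v, fun i => (ω' i : V6), hu1, hv, hu3, by rw [H.bs, hu2], hvv, fun i => (hω i).1, fun i => (hω i).2.1,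
    fun i => (hω i).2.2, ?_⟩
  have hup : B u p = 0 := by rw [H.bs, hu1]
  have huv : B u v = 0 := by rw [H.bs, hu2]
  have hpv : B p v ≠ 0 := by rintro h; simp [h] at hv
  have hvp : B v p ≠ 0 := by rw [H.bs]; exact hpv
  rw [Fintype.linearIndependent_iff] at hli ⊢
  intro g hg
  simp [Fin.sum_univ_succ] at hg
  have e1 := congrArg (B p) hg
  have e2 := congrArg (B u) hg
  have e3 := congrArg (B v) hg
  simp [hpp, hu1, hu2, hu3, hvv, hup, huv, hω, hpv, hvp] at e1 e2 e3
  have := hli ![g 3, g 4, g 5] (by simp [Fin.sum_univ_succ]; rw [← hg, e1, e2, e3]; simp)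
  have t0 := this 0
  have t1 := this 1
  have t2 := this 2
  simp at t0 t1 t2
  intro i
  fin_cases i <;> assumption

end

section
open Topology Filter
set_option linter.unusedSimpArgs false
set_option linter.unusedVariables false

def Bs (b : Fin 6 → Fin 6 → ℂ) (u v : V6) : ℂ := ∑ i, ∑ j, u i * v j * b i j
def Ts (b : Fin 6 → Fin 6 → Fin 6 → ℂ) (u v w : V6) : ℂ := ∑ i, ∑ j, ∑ k, u i * v j * w k * b i j k

abbrev ee (i : Fin 6) : V6 := Pi.single i 1

theorem v6_sum (u : V6) : u = ∑ i, u i • ee i := by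
  ext j
  simp [ee, Finset.sum_apply, Pi.single_apply]

theorem Bs_eq (B : V6 →ₗ[ℂ] V6 →ₗ[ℂ] ℂ) (u v : V6) : B u v = Bs (fun i j => B (ee i) (ee j)) u v := by
  conv_lhs => rw [v6_sum u, v6_sum v]
  simp only [Bs, map_sum, map_smul, LinearMap.sum_apply, LinearMap.smul_apply, smul_eq_mul, Finset.mul_sum]
  rw [Finset.sum_comm]
  refine Finset.sum_congr rfl fun i _ => Finset.sum_congr rfl fun j _ => by ring

theorem Ts_eq (T : V6 →ₗ[ℂ] V6 →ₗ[ℂ] V6 →ₗ[ℂ] ℂ) (u v w : V6) :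
    T u v w = Ts (fun i j k => T (ee i) (ee j) (ee k)) u v w := by
  have h1 : T u v w = ∑ i, u i * T (ee i) v w := by
    conv_lhs => rw [v6_sum u]
    simp only [map_sum, map_smul, LinearMap.sum_apply, LinearMap.smul_apply, smul_eq_mul]
  rw [h1, Ts]
  refine Finset.sum_congr rfl fun i _ => ?_
  rw [Bs_eq (T (ee i)) v w, Bs, Finset.mul_sum]
  refine Finset.sum_congr rfl fun j _ => ?_
  rw [Finset.mul_sum]
  refine Finset.sum_congr rfl fun k _ => by ring

theorem Bs_map (σ : ℂ ≃+* ℂ) {b} (hb : ∀ i j, σ (b i j) = b i j) (u v : V6) :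
    σ (Bs b u v) = Bs b (fun i => σ (u i)) (fun i => σ (v i)) := by
  simp [Bs, hb]
theorem Ts_map (σ : ℂ ≃+* ℂ) {b} (hb : ∀ i j k, σ (b i j k) = b i j k) (u v w : V6) :
    σ (Ts b u v w) = Ts b (fun i => σ (u i)) (fun i => σ (v i)) (fun i => σ (w i)) := by
  simp [Ts, hb]

theorem Bs_cd {E : Type*} [NormedAddCommGroup E] [NormedSpace ℂ E] {n} {b} {u v : E → V6} (hu : ContDiff ℂ n u)
    (hv : ContDiff ℂ n v) : ContDiff ℂ n fun x => Bs b (u x) (v x) := by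
  unfold Bs
  have h1 := contDiff_pi.1 hu
  have h2 := contDiff_pi.1 hv
  exact ContDiff.sum fun i _ => ContDiff.sum fun j _ => ((h1 i).mul (h2 j)).mul contDiff_const
theorem Ts_cd {E : Type*} [NormedAddCommGroup E] [NormedSpace ℂ E] {n} {b} {u v w : E → V6} (hu : ContDiff ℂ n u)
    (hv : ContDiff ℂ n v) (hw : ContDiff ℂ n w) : ContDiff ℂ n fun x => Ts b (u x) (v x) (w x) := by
  unfold Ts
  have h1 := contDiff_pi.1 hu
  have h2 := contDiff_pi.1 hv
  have h3 := contDiff_pi.1 hw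
  exact ContDiff.sum fun i _ => ContDiff.sum fun j _ => ContDiff.sum fun k _ =>
    (((h1 i).mul (h2 j)).mul (h3 k)).mul contDiff_const

/-- moving vectors -/
def mv (u0 : V6) (ω : Fin 3 → V6) (ξ : Fin 3 → ℂ) : V6 := fun i => u0 i + (ξ 0 * ω 0 i + ξ 1 * ω 1 i + ξ 2 * ω 2 i)

theorem mv_eq (u0 ω ξ) : mv u0 ω ξ = u0 + (ξ 0 • ω 0 + ξ 1 • ω 1 + ξ 2 • ω 2) := by
  ext i; simp [mv]

/-- the nine equations -/
def eqs (b : Fin 6 → Fin 6 → ℂ) (τ : Fin 6 → Fin 6 → Fin 6 → ℂ) (p u0 v0 : V6) (ω : Fin 3 → V6) (t : ℂ) (ξ : Fin 9 → ℂ) : Fin 9 → ℂ :=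
  let u := mv u0 ω ![ξ 0, ξ 1, ξ 2]
  let v := mv v0 ω ![ξ 3, ξ 4, ξ 5]
  ![(1 - t) * ξ 0 + t * (3 * Ts τ p p u) - ξ 6 * (2 * Bs b p u),
    (1 - t) * ξ 3 + t * (3 * Ts τ p p v) - ξ 6 * (2 * Bs b p v),
    t * (3 * Ts τ p u u) - ξ 6 * Bs b u u - ξ 7 * (2 * Bs b p u),
    t * (6 * Ts τ p u v) - ξ 6 * (2 * Bs b u v) - ξ 7 * (2 * Bs b p v) - ξ 8 * (2 * Bs b p u),
    t * (3 * Ts τ p v v) - ξ 6 * Bs b v v - ξ 8 * (2 * Bs b p v),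
    (1 - t) * ξ 1 + t * Ts τ u u u - ξ 7 * Bs b u u,
    (1 - t) * ξ 4 + t * (3 * Ts τ u u v) - ξ 7 * (2 * Bs b u v) - ξ 8 * Bs b u u,
    (1 - t) * ξ 2 + t * (3 * Ts τ u v v) - ξ 7 * Bs b v v - ξ 8 * (2 * Bs b u v),
    (1 - t) * ξ 5 + t * Ts τ v v v - ξ 8 * Bs b v v]

theorem eqs_cd (b τ p u0 v0 ω) : ContDiff ℂ 1 (fun x : ℂ × (Fin 9 → ℂ) => eqs b τ p u0 v0 ω x.1 x.2) := by
  have hu : ContDiff ℂ 1 (fun x : ℂ × (Fin 9 → ℂ) => mv u0 ω ![x.2 0, x.2 1, x.2 2]) := by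
    rw [contDiff_pi]; intro i; simp only [mv, Matrix.cons_val]; fun_prop
  have hv : ContDiff ℂ 1 (fun x : ℂ × (Fin 9 → ℂ) => mv v0 ω ![x.2 3, x.2 4, x.2 5]) := by
    rw [contDiff_pi]; intro i; simp only [mv, Matrix.cons_val]; fun_prop
  have hp : ContDiff ℂ 1 (fun x : ℂ × (Fin 9 → ℂ) => p) := contDiff_const
  have a1 := Ts_cd (b := τ) hp hp hu
  have a2 := Ts_cd (b := τ) hp hp hv
  have a3 := Ts_cd (b := τ) hp hu hu
  have a4 := Ts_cd (b := τ) hp hu hv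
  have a5 := Ts_cd (b := τ) hp hv hv
  have a6 := Ts_cd (b := τ) hu hu hu
  have a7 := Ts_cd (b := τ) hu hu hv
  have a8 := Ts_cd (b := τ) hu hv hv
  have a9 := Ts_cd (b := τ) hv hv hv
  have b1 := Bs_cd (b := b) hp hu
  have b2 := Bs_cd (b := b) hp hv
  have b3 := Bs_cd (b := b) hu hu
  have b4 := Bs_cd (b := b) hu hv
  have b5 := Bs_cd (b := b) hv hv
  rw [contDiff_pi]
  intro i
  fin_cases i <;> simp only [eqs, Fin.zero_eta, Fin.mk_one, Fin.reduceFinMk, Matrix.cons_val] <;> fun_prop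

theorem mv_map (σ : ℂ ≃+* ℂ) {u0 ω} (h1 : ∀ i, σ (u0 i) = u0 i) (h2 : ∀ k i, σ (ω k i) = ω k i) (x y z : ℂ) :
    (fun i => σ (mv u0 ω ![x, y, z] i)) = mv u0 ω ![σ x, σ y, σ z] := by
  ext i; simp [mv, h1, h2]

theorem eqs_map (σ : ℂ ≃+* ℂ) {b τ p u0 v0 ω} (hb : ∀ i j, σ (b i j) = b i j) (hτ : ∀ i j k, σ (τ i j k) = τ i j k)
    (hp : ∀ i, σ (p i) = p i) (hu : ∀ i, σ (u0 i) = u0 i) (hv : ∀ i, σ (v0 i) = v0 i) (hω : ∀ k i, σ (ω k i) = ω k i)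
    (t ξ) (h : eqs b τ p u0 v0 ω t ξ = 0) : eqs b τ p u0 v0 ω (σ t) (fun i => σ (ξ i)) = 0 := by
  have key : ∀ j, eqs b τ p u0 v0 ω (σ t) (fun i => σ (ξ i)) j = σ (eqs b τ p u0 v0 ω t ξ j) := by
    intro j
    have hp' : (fun i => σ (p i)) = p := funext hp
    fin_cases j <;>
    simp only [eqs, Fin.zero_eta, Fin.mk_one, Fin.reduceFinMk, Matrix.cons_val, map_add, map_sub, map_mul, Bs_map σ hb, Ts_map σ hτ, hp',
      mv_map σ hu hω, mv_map σ hv hω, map_one, map_ofNat]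
  ext j
  rw [key, h]; simp

end

section
open Topology Filter
set_option linter.unusedSimpArgs false
set_option linter.unusedVariables false

theorem phi_T {B T} (H : Sm B T) (p u v : V6) (r s z : ℂ) :
    T (r • p + s • u + z • v) (r • p + s • u + z • v) (r • p + s • u + z • v) =
    r^3 * T p p p + 3 * r^2*s*T p p u + 3*r^2*z*T p p v + 3*r*s^2*T p u u + 6*r*s*z*T p u v + 3*r*z^2*T p v v
     + s^3*T u u u + 3*s^2*z*T u u v + 3*s*z^2*T u v v + z^3*T v v v := by
  simp [H.t12 u p, H.t12 v p, H.t12 v u, H.t23 p u p, H.t23 p v p, H.t23 p v u, H.t23 u u p, H.t23 u v p,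
    H.t23 u v u, H.t23 v v p, H.t23 v v u]
  ring

theorem phi_B {B T} (H : Sm B T) (p u v : V6) (r s z : ℂ) :
    B (r • p + s • u + z • v) (r • p + s • u + z • v) =
    r^2 * B p p + 2 * r*s*B p u + 2*r*z*B p v + s^2*B u u + 2*s*z*B u v + z^2 * B v v := by
  simp [H.bs u p, H.bs v p, H.bs v u]
  ring

theorem hd_cube {E : Type*} [NormedAddCommGroup E] [NormedSpace ℂ E] (y e : E) :
    HasDerivAt (fun z : ℂ => z • y + z ^ 3 • e) y 0 := by
  have h1 := (hasDerivAt_id (0 : ℂ)).smul_const y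
  have h2 := (hasDerivAt_pow 3 (0 : ℂ)).smul_const e
  have h3 := h1.add h2
  simp at h3
  exact h3

theorem conic_near {B T} (H : Sm B T) {p : V6} (hp : p ≠ 0) (hpp : B p p = 0) (hppp : T p p p = 0) :
    ∃ X : Fin 6 → V6 →ₗ[ℂ] ℂ, ∀ ε > 0, ∃ t : ℂ, ‖t - 1‖ < ε ∧ ∃ u v : V6, ∃ l1 l2 l3 : ℂ,
      (∀ a b c : ℂ, a • p + b • u + c • v = 0 → a = 0 ∧ b = 0 ∧ c = 0) ∧
      ∀ r s z : ℂ, ∀ φ, φ = r • p + s • u + z • v →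
        (1 - t) * (X 3 φ * X 0 φ ^ 2 + X 4 φ * X 1 φ ^ 2 + X 5 φ * X 2 φ ^ 2) + t * T φ φ φ
        = (l1 * r + l2 * s + l3 * z) * B φ φ := by
  obtain ⟨u0, v0, ω, bpu, bpv, buu, buv, bvv, bpω, buω, bvω, hli⟩ := adapted3 H hp hpp
  choose X hX using fun j : Fin 6 => func_exists _ hli (fun i => if i = j then 1 else 0)
  refine ⟨X, fun ε hε => ?_⟩
  let b := (fun i j => B (ee i) (ee j))
  let τ := (fun i j k => T (ee i) (ee j) (ee k))
  let S : Set ℂ := Set.range (fun x : Fin 6 × Fin 6 => b x.1 x.2) ∪ Set.range (fun x : Fin 6 × Fin 6 × Fin 6 => τ x.1 x.2.1 x.2.2)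
    ∪ Set.range p ∪ Set.range u0 ∪ Set.range v0 ∪ Set.range (fun x : Fin 3 × Fin 6 => ω x.1 x.2)
  have hS : S.Countable := by
    refine Set.Countable.union (Set.Countable.union (Set.Countable.union (Set.Countable.union (Set.Countable.union ?_ ?_) ?_) ?_) ?_) ?_ <;>
    exact Set.countable_range _
  have hs1 : ∀ i j, b i j ∈ S := fun i j => by
    simp only [S, Set.mem_union]; left; left; left; left; left; exact ⟨(i, j), rfl⟩
  have hs2 : ∀ i j k, τ i j k ∈ S := fun i j k => by
    simp only [S, Set.mem_union]; left; left; left; left; right; exact ⟨(i, j, k), rfl⟩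
  have hs3 : ∀ i, p i ∈ S := fun i => by
    simp only [S, Set.mem_union]; left; left; left; right; exact ⟨i, rfl⟩
  have hs4 : ∀ i, u0 i ∈ S := fun i => by
    simp only [S, Set.mem_union]; left; left; right; exact ⟨i, rfl⟩
  have hs5 : ∀ i, v0 i ∈ S := fun i => by
    simp only [S, Set.mem_union]; left; right; exact ⟨i, rfl⟩
  have hs6 : ∀ k i, ω k i ∈ S := fun k i => by
    simp only [S, Set.mem_union]; right; exact ⟨(k, i), rfl⟩
  have hBs : ∀ x y, Bs b x y = B x y := fun x y => (Bs_eq B x y).symm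
  have hTs : ∀ x y z, Ts τ x y z = T x y z := fun x y z => (Ts_eq T x y z).symm
  have bωu : ∀ i, B (ω i) u0 = 0 := fun i => by rw [H.bs, buω]
  have bωv : ∀ i, B (ω i) v0 = 0 := fun i => by rw [H.bs, bvω]
  obtain ⟨t, ht, ξ, hξ⟩ := homotopy S hS (eqs b τ p u0 v0 ω)
    (fun σ hσ t ξ h => eqs_map σ (fun i j => hσ _ (hs1 i j)) (fun i j k => hσ _ (hs2 i j k)) (fun i => hσ _ (hs3 i))
      (fun i => hσ _ (hs4 i)) (fun i => hσ _ (hs5 i)) (fun k i => hσ _ (hs6 k i)) t ξ h) (eqs_cd b τ p u0 v0 ω) 0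
    (by
      ext j
      fin_cases j <;> simp [eqs])
    (by
      intro y
      let δ : Fin 9 → ℂ := ![y 0, y 5 - y 3, y 7, y 1 - y 2, y 6 - y 4, y 8, - y 2, - y 3, - y 4]
      let w1 := δ 0 • ω 0 + δ 1 • ω 1 + δ 2 • ω 2
      let w2 := δ 3 • ω 0 + δ 4 • ω 1 + δ 5 • ω 2
      refine ⟨δ, ?_⟩
      have hu : ∀ z : ℂ, mv u0 ω ![(0 + z • δ) 0, (0 + z • δ) 1, (0 + z • δ) 2] = u0 + z • w1 := by
        intro z; rw [mv_eq]; simp [w1]; module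
      have hv : ∀ z : ℂ, mv v0 ω ![(0 + z • δ) 3, (0 + z • δ) 4, (0 + z • δ) 5] = v0 + z • w2 := by
        intro z; rw [mv_eq]; simp [w2]; module
      have e1 : B p w1 = 0 := by simp [w1, bpω]
      have e2 : B p w2 = 0 := by simp [w2, bpω]
      have e3 : B u0 w1 = 0 := by simp [w1, buω]
      have e4 : B u0 w2 = 0 := by simp [w2, buω]
      have e5 : B v0 w1 = 0 := by simp [w1, bvω]
      have e6 : B v0 w2 = 0 := by simp [w2, bvω]
      have e7 : B w1 u0 = 0 := by rw [H.bs, e3]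
      have e8 : B w1 v0 = 0 := by rw [H.bs, e5]
      have e9 : B w2 u0 = 0 := by rw [H.bs, e4]
      have e10 : B w2 v0 = 0 := by rw [H.bs, e6]
      have key : ∀ z : ℂ, eqs b τ p u0 v0 ω 0 (0 + z • δ) = z • y + z ^ 3 • ![0, 0, y 2 * B w1 w1, 2 * y 2 * B w1 w2,
          y 2 * B w2 w2, y 3 * B w1 w1, 2 * y 3 * B w1 w2 + y 4 * B w1 w1, y 3 * B w2 w2 + 2 * y 4 * B w1 w2, y 4 * B w2 w2] := by
        intro z
        simp only [eqs, hBs, hTs, hu, hv]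
        ext j
        fin_cases j <;> simp [e1, e2, e3, e4, e5, e6, e7, e8, e9, e10, bpu, buu, buv, bvv, H.bs v0 u0, δ, bpv] <;> ring
      rw [show (fun z : ℂ => eqs b τ p u0 v0 ω 0 (0 + z • δ)) = _ from funext key]
      exact hd_cube _ _) 1 ε hε
  refine ⟨t, ht, mv u0 ω ![ξ 0, ξ 1, ξ 2], mv v0 ω ![ξ 3, ξ 4, ξ 5], ξ 6, ξ 7, ξ 8, ?_, ?_⟩
  · intro a b' c h
    rw [mv_eq, mv_eq] at h
    rw [Fintype.linearIndependent_iff] at hli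
    have := hli ![a, b', c, b' * ξ 0 + c * ξ 3, b' * ξ 1 + c * ξ 4, b' * ξ 2 + c * ξ 5] (by
      simp [Fin.sum_univ_succ]
      rw [← h]; simp; module)
    exact ⟨this 0, this 1, this 2⟩
  · intro r s z φ hφ
    set u := mv u0 ω ![ξ 0, ξ 1, ξ 2] with hu
    set v := mv v0 ω ![ξ 3, ξ 4, ξ 5] with hv
    have Xp : ∀ j, X j p = if (0 : Fin 6) = j then 1 else 0 := fun j => hX j 0
    have Xu : ∀ j, X j u0 = if (1 : Fin 6) = j then 1 else 0 := fun j => hX j 1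
    have Xv : ∀ j, X j v0 = if (2 : Fin 6) = j then 1 else 0 := fun j => hX j 2
    have X0 : ∀ j, X j (ω 0) = if (3 : Fin 6) = j then 1 else 0 := fun j => hX j 3
    have X1 : ∀ j, X j (ω 1) = if (4 : Fin 6) = j then 1 else 0 := fun j => hX j 4
    have X2 : ∀ j, X j (ω 2) = if (5 : Fin 6) = j then 1 else 0 := fun j => hX j 5
    have E0 : X 0 φ = r := by rw [hφ, hu, hv, mv_eq, mv_eq]; simp [Xp, Xu, Xv, X0, X1, X2]
    have E1 : X 1 φ = s := by rw [hφ, hu, hv, mv_eq, mv_eq]; simp [Xp, Xu, Xv, X0, X1, X2]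
    have E2 : X 2 φ = z := by rw [hφ, hu, hv, mv_eq, mv_eq]; simp [Xp, Xu, Xv, X0, X1, X2]
    have E3 : X 3 φ = s * ξ 0 + z * ξ 3 := by rw [hφ, hu, hv, mv_eq, mv_eq]; simp [Xp, Xu, Xv, X0, X1, X2]
    have E4 : X 4 φ = s * ξ 1 + z * ξ 4 := by rw [hφ, hu, hv, mv_eq, mv_eq]; simp [Xp, Xu, Xv, X0, X1, X2]
    have E5 : X 5 φ = s * ξ 2 + z * ξ 5 := by rw [hφ, hu, hv, mv_eq, mv_eq]; simp [Xp, Xu, Xv, X0, X1, X2]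
    rw [E0, E1, E2, E3, E4, E5, hφ, phi_T H, phi_B H, hpp, hppp]
    have g0 := congrFun hξ 0
    have g1 := congrFun hξ 1
    have g2 := congrFun hξ 2
    have g3 := congrFun hξ 3
    have g4 := congrFun hξ 4
    have g5 := congrFun hξ 5
    have g6 := congrFun hξ 6
    have g7 := congrFun hξ 7
    have g8 := congrFun hξ 8
    simp only [eqs, hBs, hTs, Matrix.cons_val, ← hu, ← hv, Pi.zero_apply] at g0 g1 g2 g3 g4 g5 g6 g7 g8
    linear_combination r^2*s*g0 + r^2*z*g1 + r*s^2*g2 + r*s*z*g3 + r*z^2*g4 + s^3*g5 + s^2*z*g6 + s*z^2*g7 + z^3*g8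

end

section
open Topology Filter
set_option linter.unusedSimpArgs false
set_option linter.unusedVariables false

theorem dps_eq (w : V6) : star w ⬝ᵥ w = ((∑ i, ‖w i‖ ^ 2 : ℝ) : ℂ) := by
  simp [dotProduct, ← Complex.conj_mul']

theorem dps_ne {w : V6} (hw : w ≠ 0) : star w ⬝ᵥ w ≠ 0 := by
  rw [dps_eq]
  intro h
  have h4 : (∑ i, ‖w i‖ ^ 2 : ℝ) = 0 := by exact_mod_cast h
  rw [Finset.sum_eq_zero_iff_of_nonneg fun i _ => by positivity] at h4
  apply hw
  ext i
  simpa using h4 i (Finset.mem_univ i)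

theorem dps_flip {a b : V6} (h : star a ⬝ᵥ b = 0) : star b ⬝ᵥ a = 0 := by
  have := congrArg star h
  simp only [dotProduct, star_sum, star_mul', Pi.star_apply, star_star, star_zero] at this
  rw [← this]
  simp only [dotProduct, Pi.star_apply]
  exact Finset.sum_congr rfl fun i _ => mul_comm _ _

theorem normalize_v {w : V6} (hw : w ≠ 0) : ∃ α : ℂ, star (α • w) ⬝ᵥ (α • w) = 1 := by
  have h1 : star w ⬝ᵥ w = ((∑ i, ‖w i‖ ^ 2 : ℝ) : ℂ) := by
    simp [dotProduct, ← Complex.conj_mul']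
  have h2 := dps_ne hw
  have h3 : 0 ≤ ∑ i, ‖w i‖ ^ 2 := Finset.sum_nonneg fun i _ => by positivity
  rw [h1] at h2
  have h4 : (∑ i, ‖w i‖ ^ 2 : ℝ) ≠ 0 := by exact_mod_cast h2
  refine ⟨((√(∑ i, ‖w i‖ ^ 2))⁻¹ : ℝ), ?_⟩
  rw [star_smul, smul_dotProduct, dotProduct_smul, h1]
  simp only [smul_eq_mul, RCLike.star_def, Complex.conj_ofReal]
  norm_cast
  have := Real.mul_self_sqrt h3
  have h5 : √(∑ i, ‖w i‖ ^ 2) ≠ 0 := by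
    intro h; rw [h] at this; exact h4 (by linarith)
  nth_rewrite 3 [← this]
  field_simp

theorem gs {p u v : V6} (hi : ∀ a b c : ℂ, a • p + b • u + c • v = 0 → a = 0 ∧ b = 0 ∧ c = 0) :
    ∃ u' v' : V6, ∃ a0 a1 a2 b0 b1 b2 : ℂ, u' = a0 • p + a1 • u + a2 • v ∧ v' = b0 • p + b1 • u + b2 • v ∧
     star u' ⬝ᵥ u' = 1 ∧ star v' ⬝ᵥ v' = 1 ∧ star p ⬝ᵥ u' = 0 ∧ star p ⬝ᵥ v' = 0 ∧ star u' ⬝ᵥ v' = 0 := by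
  have hp : p ≠ 0 := by
    rintro rfl
    have := (hi 1 0 0 (by simp)).1
    simp at this
  have hpp := dps_ne hp
  let x := (star p ⬝ᵥ u) / (star p ⬝ᵥ p)
  have hw : u - x • p ≠ 0 := by
    intro h
    have := (hi (-x) 1 0 (by rw [← h]; module)).2.1
    simp at this
  obtain ⟨α, hα⟩ := normalize_v hw
  set u' := α • (u - x • p) with hu'
  have h1 : star p ⬝ᵥ u' = 0 := by
    simp [hu', dotProduct_sub, x]; right; field_simp; simp
  have h1' : star u' ⬝ᵥ p = 0 := dps_flip h1
  have hα0 : α ≠ 0 := by rintro rfl; simp [hu'] at hα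
  let y := (star p ⬝ᵥ v) / (star p ⬝ᵥ p)
  let z := star u' ⬝ᵥ v
  have hw2 : v - y • p - z • u' ≠ 0 := by
    intro h
    have := (hi (-y + z * α * x) (- z * α) 1 (by rw [← h, hu']; module)).2.2
    simp at this
  obtain ⟨β, hβ⟩ := normalize_v hw2
  refine ⟨u', β • (v - y • p - z • u'), - α * x, α, 0, β * (- y + z * α * x), - β * z * α, β, by rw [hu']; module,
    by rw [hu']; module, hα, hβ, h1, ?_, ?_⟩
  · simp [dotProduct_sub, h1, y]; right; field_simp; simp
  · simp [dotProduct_sub, h1', hα, z]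

theorem lk_zero {l1 l2 l3 k0 k1 k2 k3 k4 : ℂ}
    (h : ∀ r s z : ℂ, (l1 * r + l2 * s + l3 * z) * (k0 * (r * s) + k1 * (r * z) + k2 * s ^ 2 + k3 * (s * z) + k4 * z ^ 2) = 0) :
    (l1 = 0 ∧ l2 = 0 ∧ l3 = 0) ∨ (k0 = 0 ∧ k1 = 0 ∧ k2 = 0 ∧ k3 = 0 ∧ k4 = 0) := by
  by_cases hl : ∀ r s z : ℂ, l1 * r + l2 * s + l3 * z = 0
  · left
    exact ⟨by simpa using hl 1 0 0, by simpa using hl 0 1 0, by simpa using hl 0 0 1⟩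
  right
  have hk : ∀ r s z : ℂ, k0 * (r * s) + k1 * (r * z) + k2 * s ^ 2 + k3 * (s * z) + k4 * z ^ 2 = 0 := by
    by_contra hk
    push Not at hl hk
    obtain ⟨r, s, z, hl⟩ := hl
    obtain ⟨r', s', z', hk⟩ := hk
    open Polynomial in
    let R : ℂ[X] := C r + X * C (r' - r)
    open Polynomial in
    let S : ℂ[X] := C s + X * C (s' - s)
    open Polynomial in
    let Z : ℂ[X] := C z + X * C (z' - z)
    open Polynomial in
    have hz : (C l1 * R + C l2 * S + C l3 * Z) * (C k0 * (R * S) + C k1 * (R * Z) + C k2 * S ^ 2 + C k3 * (S * Z) + C k4 * Z ^ 2) = 0 := by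
      apply Polynomial.funext
      intro x
      have := h (R.eval x) (S.eval x) (Z.eval x)
      simpa using this
    rcases mul_eq_zero.1 hz with h1 | h1
    · apply hl
      have := congrArg (Polynomial.eval 0) h1
      simpa [R, S, Z] using this
    · apply hk
      have := congrArg (Polynomial.eval 1) h1
      simpa [R, S, Z] using this
  have e1 := hk 0 1 0
  have e2 := hk 0 0 1
  have e3 := hk 1 1 0
  have e4 := hk 1 0 1
  have e5 := hk 0 1 1
  simp at e1 e2
  simp [e1, e2] at e3 e4 e5
  exact ⟨e3, e4, e1, e5, e2⟩

/-- a plane with `c = l κ`, `q = μ κ` -/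
theorem conic_exists {B T} (H : Sm B T) {p : V6} (hp : p ≠ 0) (hpp : B p p = 0) (hppp : T p p p = 0) :
    ∃ u v : V6, ∃ k : Fin 5 → ℂ, ∃ l1 l2 l3 μ : ℂ, 
      (∀ a b c : ℂ, a • p + b • u + c • v = 0 → a = 0 ∧ b = 0 ∧ c = 0) ∧ k ≠ 0 ∧
      ∀ r s z : ℂ, ∀ φ, φ = r • p + s • u + z • v →
        T φ φ φ = (l1 * r + l2 * s + l3 * z) * (k 0 * (r * s) + k 1 * (r * z) + k 2 * s ^ 2 + k 3 * (s * z) + k 4 * z ^ 2) ∧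
        B φ φ = μ * (k 0 * (r * s) + k 1 * (r * z) + k 2 * s ^ 2 + k 3 * (s * z) + k 4 * z ^ 2) := by
  obtain ⟨X, hX⟩ := conic_near H hp hpp hppp
  let K0 : Set (V6 × V6) := {x | star x.1 ⬝ᵥ x.1 = 1 ∧ star x.2 ⬝ᵥ x.2 = 1 ∧ star p ⬝ᵥ x.1 = 0 ∧ star p ⬝ᵥ x.2 = 0 ∧
    star x.1 ⬝ᵥ x.2 = 0}
  have nb : ∀ w : V6, star w ⬝ᵥ w = 1 → ‖w‖ ≤ 1 := by
    intro w hw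
    have h1 : star w ⬝ᵥ w = ((∑ i, ‖w i‖ ^ 2 : ℝ) : ℂ) := by
      simp [dotProduct, ← Complex.conj_mul']
    rw [h1] at hw
    have h2 : (∑ i, ‖w i‖ ^ 2 : ℝ) = 1 := by exact_mod_cast hw
    rw [pi_norm_le_iff_of_nonneg zero_le_one]
    intro i
    have := Finset.single_le_sum (f := fun i => ‖w i‖ ^ 2) (fun i _ => by positivity) (Finset.mem_univ i)
    simp only [h2] at this
    nlinarith [norm_nonneg (w i)]
  have hK0 : IsCompact K0 := by
    apply Metric.isCompact_of_isClosed_isBounded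
    · unfold K0
      simp only [dotProduct, Pi.star_apply]
      refine IsClosed.and ?_ (IsClosed.and ?_ (IsClosed.and ?_ (IsClosed.and ?_ ?_))) <;>
        exact isClosed_eq (by fun_prop) (by fun_prop)
    · refine (Metric.isBounded_closedBall (x := (0 : V6 × V6)) (r := 1)).subset ?_
      rintro ⟨u, v⟩ ⟨h1, h2, -⟩
      simp [nb u h1, nb v h2]
  let K := K0 ×ˢ (Metric.sphere (0 : Fin 5 → ℂ) 1 ×ˢ (Metric.sphere (0 : Fin 4 → ℂ) 1 ×ˢ Metric.sphere (0 : Fin 2 → ℂ) 1))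
  have hK : IsCompact K := hK0.prod ((isCompact_sphere _ _).prod ((isCompact_sphere _ _).prod (isCompact_sphere _ _)))
  let C : Set (ℂ × ((V6 × V6) × ((Fin 5 → ℂ) × ((Fin 4 → ℂ) × (Fin 2 → ℂ))))) :=
    {x | ∀ r s z : ℂ, x.2.2.2.1 0 * ((1 - x.1) * (X 3 (r • p + s • x.2.1.1 + z • x.2.1.2) * X 0 (r • p + s • x.2.1.1 + z • x.2.1.2) ^ 2
        + X 4 (r • p + s • x.2.1.1 + z • x.2.1.2) * X 1 (r • p + s • x.2.1.1 + z • x.2.1.2) ^ 2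
        + X 5 (r • p + s • x.2.1.1 + z • x.2.1.2) * X 2 (r • p + s • x.2.1.1 + z • x.2.1.2) ^ 2)
        + x.1 * T (r • p + s • x.2.1.1 + z • x.2.1.2) (r • p + s • x.2.1.1 + z • x.2.1.2) (r • p + s • x.2.1.1 + z • x.2.1.2))
        = (x.2.2.2.1 1 * r + x.2.2.2.1 2 * s + x.2.2.2.1 3 * z) * (x.2.2.1 0 * (r * s) + x.2.2.1 1 * (r * z) + x.2.2.1 2 * s ^ 2 + x.2.2.1 3 * (s * z) + x.2.2.1 4 * z ^ 2)
      ∧ x.2.2.2.2 0 * B (r • p + s • x.2.1.1 + z • x.2.1.2) (r • p + s • x.2.1.1 + z • x.2.1.2) =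
        x.2.2.2.2 1 * (x.2.2.1 0 * (r * s) + x.2.2.1 1 * (r * z) + x.2.2.1 2 * s ^ 2 + x.2.2.1 3 * (s * z) + x.2.2.1 4 * z ^ 2)}
  have cX : ∀ i, Continuous (X i) := fun i => LinearMap.continuous_of_finiteDimensional _
  have cB : Continuous fun y => B y y := by
    rw [show (fun y => B y y) = _ from funext fun y => Bs_eq B y y]
    exact (Bs_cd (n := 0) contDiff_id contDiff_id).continuous
  have cT : Continuous fun y => T y y y := by
    rw [show (fun y => T y y y) = _ from funext fun y => Ts_eq T y y y]
    exact (Ts_cd (n := 0) contDiff_id contDiff_id contDiff_id).continuous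
  have hC : IsClosed C := by
    simp only [C, Set.ofPred_forall]
    refine isClosed_iInter fun r => isClosed_iInter fun s => isClosed_iInter fun z => ?_
    have cφ : Continuous fun x : ℂ × ((V6 × V6) × ((Fin 5 → ℂ) × ((Fin 4 → ℂ) × (Fin 2 → ℂ)))) =>
      (r • p + s • x.2.1.1 + z • x.2.1.2) := by fun_prop
    have c1 := fun i => (cX i).comp cφ
    have c2 := cB.comp cφ
    have c3 := cT.comp cφ
    simp only [Function.comp_def] at c1 c2 c3
    refine IsClosed.and (isClosed_eq ?_ ?_) (isClosed_eq ?_ ?_)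
    · exact (by fun_prop : Continuous fun x : ℂ × ((V6 × V6) × ((Fin 5 → ℂ) × ((Fin 4 → ℂ) × (Fin 2 → ℂ)))) => x.2.2.2.1 0).mul
        (((continuous_const.sub continuous_fst).mul ((((c1 3).mul ((c1 0).pow 2)).add ((c1 4).mul ((c1 1).pow 2))).add
          ((c1 5).mul ((c1 2).pow 2)))).add (continuous_fst.mul c3))
    · fun_prop
    · fun_prop
    · fun_prop
  obtain ⟨⟨⟨u, v⟩, k, L, M⟩, ⟨⟨o1, o2, o3, o4, o5⟩, hk, hL, hM⟩, hx⟩ := limit_compact K hK C hC (by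
    intro ε hε
    obtain ⟨t, ht, u, v, l1, l2, l3, hi, heq⟩ := hX ε hε
    refine ⟨t, ht, ?_⟩
    obtain ⟨u', v', a0, a1, a2, b0, b1, b2, rfl, rfl, ho⟩ := gs hi
    set u' := a0 • p + a1 • u + a2 • v with hu'
    set v' := b0 • p + b1 • u + b2 • v with hv'
    have heq' : ∀ r s z : ℂ, ∀ φ, φ = r • p + s • u' + z • v' →
        (1 - t) * (X 3 φ * X 0 φ ^ 2 + X 4 φ * X 1 φ ^ 2 + X 5 φ * X 2 φ ^ 2) + t * T φ φ φ
        = (l1 * r + (l1 * a0 + l2 * a1 + l3 * a2) * s + (l1 * b0 + l2 * b1 + l3 * b2) * z) * B φ φ := by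
      intro r s z φ hφ
      rw [heq (r + a0 * s + b0 * z) (a1 * s + b1 * z) (a2 * s + b2 * z) φ (by rw [hφ, hu', hv']; module)]
      ring
    clear heq
    generalize l1 * a0 + l2 * a1 + l3 * a2 = l2' at heq'
    generalize l1 * b0 + l2 * b1 + l3 * b2 = l3' at heq'
    let κ : Fin 5 → ℂ := ![2 * B p u', 2 * B p v', B u' u', 2 * B u' v', B v' v']
    have hκ : ∀ r s z : ℂ, B (r • p + s • u' + z • v') (r • p + s • u' + z • v') =
      κ 0 * (r * s) + κ 1 * (r * z) + κ 2 * s ^ 2 + κ 3 * (s * z) + κ 4 * z ^ 2 := by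
      intro r s z
      rw [phi_B H, hpp]; simp [κ]; ring
    by_cases hκ0 : κ = 0
    · refine ⟨((u', v'), Pi.single 0 1, Pi.single 0 1, Pi.single 0 1), ⟨ho, ?_, ?_, ?_⟩, ?_⟩
      · simp [Pi.norm_single]
      · simp [Pi.norm_single]
      · simp [Pi.norm_single]
      · intro r s z
        rw [heq' r s z _ rfl, hκ, hκ0]
        simp
    · have nκ : (‖κ‖ : ℂ) ≠ 0 := by simpa using hκ0
      have nrm : ∀ {n : ℕ} (w : Fin n → ℂ), w ≠ 0 → ‖((‖w‖ : ℂ)⁻¹) • w‖ = 1 := by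
        intro n w hw
        rw [norm_smul, norm_inv, Complex.norm_real, norm_norm, inv_mul_cancel₀ (norm_ne_zero_iff.2 hw)]
      let L : Fin 4 → ℂ := ![1, ‖κ‖ * l1, ‖κ‖ * l2', ‖κ‖ * l3']
      let M : Fin 2 → ℂ := ![1, ‖κ‖]
      have hL : L ≠ 0 := fun h => by simpa [L] using congrFun h 0
      have hM : M ≠ 0 := fun h => by simpa [M] using congrFun h 0
      have nL : (‖L‖ : ℂ) ≠ 0 := by simpa using hL
      have nM : (‖M‖ : ℂ) ≠ 0 := by simpa using hM
      refine ⟨((u', v'), (‖κ‖ : ℂ)⁻¹ • κ, (‖L‖ : ℂ)⁻¹ • L, (‖M‖ : ℂ)⁻¹ • M), ⟨ho, ?_, ?_, ?_⟩, ?_⟩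
      · simp only [mem_sphere_iff_norm, sub_zero]; exact nrm _ hκ0
      · simp only [mem_sphere_iff_norm, sub_zero]; exact nrm _ hL
      · simp only [mem_sphere_iff_norm, sub_zero]; exact nrm _ hM
      · intro r s z
        dsimp only
        rw [heq' r s z _ rfl, hκ]
        simp only [Pi.smul_apply, smul_eq_mul]
        rw [show L 0 = 1 from rfl, show L 1 = ‖κ‖ * l1 from rfl, show L 2 = ‖κ‖ * l2' from rfl, show L 3 = ‖κ‖ * l3' from rfl,
          show M 0 = 1 from rfl, show M 1 = ‖κ‖ from rfl]
        constructor
        · field_simp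
        · field_simp)
  simp only [mem_sphere_iff_norm, sub_zero] at hk hL hM
  have hk0 : k ≠ 0 := by rintro rfl; simp at hk
  have hx' : ∀ r s z : ℂ, _ := hx
  dsimp only at hx' o1 o2 o3 o4 o5
  have hk5 : ¬ (k 0 = 0 ∧ k 1 = 0 ∧ k 2 = 0 ∧ k 3 = 0 ∧ k 4 = 0) := by
    rintro ⟨h0, h1, h2, h3, h4⟩
    apply hk0
    ext i; fin_cases i <;> assumption
  have hL0 : L 0 ≠ 0 := by
    intro h0
    rcases lk_zero (l1 := L 1) (l2 := L 2) (l3 := L 3) (k0 := k 0) (k1 := k 1) (k2 := k 2) (k3 := k 3) (k4 := k 4) (fun r s z => by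
      rw [← (hx' r s z).1, h0, zero_mul]) with h | h
    · have : L = 0 := by
        ext i; fin_cases i
        exacts [h0, h.1, h.2.1, h.2.2]
      simp [this] at hL
    · exact hk5 h
  have hM0 : M 0 ≠ 0 := by
    intro h0
    have hM1 : M 1 ≠ 0 := by
      intro h1
      have : M = 0 := by
        ext i; fin_cases i
        exacts [h0, h1]
      simp [this] at hM
    rcases lk_zero (l1 := 1) (l2 := 0) (l3 := 0) (k0 := k 0) (k1 := k 1) (k2 := k 2) (k3 := k 3) (k4 := k 4) (fun r s z => by
      have := (hx' r s z).2
      rw [h0, zero_mul, eq_comm, mul_eq_zero] at this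
      rw [this.resolve_left hM1, mul_zero]) with h | h
    · simp at h
    · exact hk5 h
  have c1 : star u ⬝ᵥ p = 0 := dps_flip o3
  have c2 : star v ⬝ᵥ u = 0 := dps_flip o5
  have c3 : star v ⬝ᵥ p = 0 := dps_flip o4
  refine ⟨u, v, k, L 1 / L 0, L 2 / L 0, L 3 / L 0, M 1 / M 0, ?_, hk0, ?_⟩
  · intro a b c h
    have e1 := congrArg (fun w => star p ⬝ᵥ w) h
    have e2 := congrArg (fun w => star u ⬝ᵥ w) h
    have e3 := congrArg (fun w => star v ⬝ᵥ w) h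
    simp [dotProduct_add, dotProduct_smul, o1, o2, o3, o4, o5, c1, c2, c3] at e1 e2 e3
    exact ⟨e1.resolve_right (dps_ne hp), e2, e3⟩
  · intro r s z φ hφ
    obtain ⟨h1, h2⟩ := hx' r s z
    rw [← hφ] at h1 h2
    constructor
    · field_simp
      linear_combination h1
    · field_simp
      linear_combination h2

end

section
open Topology Filter
set_option linter.unusedSimpArgs false
set_option linter.unusedVariables false

theorem root6 (c0 c1 c2 c3 c4 c5 c6 : ℂ) (h : c6 ≠ 0) : ∃ y : ℂ,
    c6 * y ^ 6 + c5 * y ^ 5 + c4 * y ^ 4 + c3 * y ^ 3 + c2 * y ^ 2 + c1 * y + c0 = 0 := by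
  open Polynomial in
  let P : Polynomial ℂ := C c6 * X ^ 6 + C c5 * X ^ 5 + C c4 * X ^ 4 + C c3 * X ^ 3 + C c2 * X ^ 2 + C c1 * X + C c0
  have hP : P.natDegree = 6 := by
    simp only [P]
    compute_degree!
  obtain ⟨x, hx⟩ := IsAlgClosed.exists_root P (by
    intro h0
    rw [Polynomial.natDegree_eq_of_degree_eq_some h0] at hP
    norm_num at hP)
  refine ⟨x, ?_⟩
  simpa [P, Polynomial.IsRoot] using hx

theorem T_sum3 {B T} (H : Sm B T) (a b c : ℂ) (u v w : V6) :
    T (a • u + b • v + c • w) (a • u + b • v + c • w) (a • u + b • v + c • w) =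
      a ^ 3 * T u u u + b ^ 3 * T v v v + c ^ 3 * T w w w + 3 * a ^ 2 * b * T u u v + 3 * a ^ 2 * c * T u u w
      + 3 * a * b ^ 2 * T u v v + 3 * a * c ^ 2 * T u w w + 3 * b ^ 2 * c * T v v w + 3 * b * c ^ 2 * T v w w
      + 6 * a * b * c * T u v w := by
  have e1 : T v u u = T u u v := by rw [H.t12, H.t23]
  have e2 : T u v u = T u u v := by rw [H.t23]
  have e3 : T w u u = T u u w := by rw [H.t12, H.t23]
  have e4 : T u w u = T u u w := by rw [H.t23]
  have e5 : T v u v = T u v v := by rw [H.t12]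
  have e6 : T v v u = T u v v := by rw [H.t23, H.t12]
  have e7 : T w u w = T u w w := by rw [H.t12]
  have e8 : T w w u = T u w w := by rw [H.t23, H.t12]
  have e9 : T w v v = T v v w := by rw [H.t12, H.t23]
  have e10 : T v w v = T v v w := by rw [H.t23]
  have e11 : T w v w = T v w w := by rw [H.t12]
  have e12 : T w w v = T v w w := by rw [H.t23, H.t12]
  have f1 : T u w v = T u v w := by rw [H.t23]
  have f2 : T v u w = T u v w := by rw [H.t12]
  have f3 : T v w u = T u v w := by rw [H.t23, H.t12]
  have f4 : T w u v = T u v w := by rw [H.t12, H.t23]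
  have f5 : T w v u = T u v w := by rw [H.t23, H.t12, H.t23]
  simp only [map_add, map_smul, LinearMap.add_apply, LinearMap.smul_apply, smul_eq_mul,
    e1, e2, e3, e4, e5, e6, e7, e8, e9, e10, e11, e12, f1, f2, f3, f4, f5]
  ring

theorem B_sum3 {B T} (H : Sm B T) (a b c : ℂ) (u v w : V6) :
    B (a • u + b • v + c • w) (a • u + b • v + c • w) =
      a ^ 2 * B u u + b ^ 2 * B v v + c ^ 2 * B w w + 2 * a * b * B u v + 2 * a * c * B u w
      + 2 * b * c * B v w := by
  simp only [map_add, map_smul, LinearMap.add_apply, LinearMap.smul_apply, smul_eq_mul, H.bs v u, H.bs w u, H.bs w v]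
  ring

theorem iso_ne {B T} (H : Sm B T) : ∃ a, a ≠ 0 ∧ B a a = 0 := by
  obtain ⟨x, y, hxy, h⟩ := quad_root (B (ee 0) (ee 0)) (2 * B (ee 0) (ee 1)) (B (ee 1) (ee 1))
  refine ⟨x • ee 0 + y • ee 1, ?_, ?_⟩
  · intro h
    have h0 := congrFun h 0
    have h1 := congrFun h 1
    simp [ee, Pi.single_apply] at h0 h1
    simp [h0, h1] at hxy
  · have := B_sum3 H x y 0 (ee 0) (ee 1) 0
    simp only [smul_zero, add_zero] at this
    rw [this]
    linear_combination h

theorem exists_u1 {B T} (H : Sm B T) : ∃ a, a ≠ 0 ∧ B a a = 0 ∧ T a a a ≠ 0 := by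
  by_contra hc
  push Not at hc
  obtain ⟨a, ha, haa⟩ := iso_ne H
  have hT := hc a ha haa
  obtain ⟨w, hw, hTw⟩ := H.sm a ha haa hT
  obtain ⟨u, v, ω, h1, h2, h3, h4, h5, -⟩ := adapted3 H ha haa
  set w' := w - (2 * B w v) • a with hw'
  have k1 : B a w' = 0 := by simp [hw', hw, haa]
  have k2 : T a a w' = T a a w := by simp [hw', hT]
  have k3 : B w' v = 0 := by simp [hw']; linear_combination (-B w v) * h2
  have key : ∀ e : ℂ, T (a + e • w' + (- e ^ 2 * B w' w') • v) (a + e • w' + (- e ^ 2 * B w' w') • v) (a + e • w' + (- e ^ 2 * B w' w') • v) = 0 := by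
    intro e
    have h0 : B (a + e • w' + (- e ^ 2 * B w' w') • v) (a + e • w' + (- e ^ 2 * B w' w') • v) = 0 := by
      have := B_sum3 H 1 e (- e ^ 2 * B w' w') a w' v
      rw [one_smul] at this
      rw [this, haa, k1, k3, h5]
      linear_combination (-e ^ 2 * B w' w') * h2
    by_cases hz : a + e • w' + (- e ^ 2 * B w' w') • v = 0
    · rw [hz]; simp
    · exact hc _ hz h0
  have key2 : ∀ e : ℂ, _ = (0:ℂ) := fun e => (T_sum3 H 1 e (- e ^ 2 * B w' w') a w' v).symm.trans (by rw [one_smul]; exact key e)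
  have x1 := key2 1
  have x2 := key2 (-1)
  have x3 := key2 2
  have x4 := key2 (-2)
  have x5 := key2 3
  have x6 := key2 (-3)
  rw [hT] at x1 x2 x3 x4 x5 x6
  apply hTw
  rw [← k2]
  linear_combination (3/4*(x1-x2) - 3/20 * (x3-x4) + 1/60*(x5-x6))/3

theorem gen_frame {B T} (H : Sm B T) : ∃ (u1 u2 : V6) (w : Fin 4 → V6), B u1 u1 = 0 ∧ B u2 u2 = 0 ∧ 2 * B u1 u2 = 1 ∧
    T u1 u1 u1 ≠ 0 ∧ T u2 u2 u2 ≠ 0 ∧ (∀ i, B u1 (w i) = 0) ∧ (∀ i, B u2 (w i) = 0) ∧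
    ∀ (a b : ℂ) (g : Fin 4 → ℂ), a • u1 + b • u2 + ∑ i, g i • w i = 0 → ∀ i, g i = 0 := by
  obtain ⟨p, hp, hpp, hT⟩ := exists_u1 H
  obtain ⟨u, v, ω, h1, h2, h3, h4, h5, h6, h7, h8, hind⟩ := adapted3 H hp hpp
  obtain ⟨e, he0, he⟩ : ∃ e : ℂ, e ≠ 0 ∧ T (p + e • u + (-e^2) • v) (p + e • u + (-e^2) • v) (p + e • u + (-e^2) • v) ≠ 0 := by
    by_contra hc
    push Not at hc
    have key2 : ∀ e : ℂ, e ≠ 0 → _ = (0:ℂ) := fun e he => (T_sum3 H 1 e (- e ^ 2) p u v).symm.trans (by rw [one_smul]; exact hc e he)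
    have x1 := key2 1 (by norm_num)
    have x2 := key2 2 (by norm_num)
    have x3 := key2 3 (by norm_num)
    have x4 := key2 4 (by norm_num)
    have x5 := key2 5 (by norm_num)
    have x6 := key2 6 (by norm_num)
    have x7 := key2 7 (by norm_num)
    apply hT
    linear_combination 7*x1-21*x2+35*x3-35*x4+21*x5-7*x6+x7
  rw [Fintype.linearIndependent_iff] at hind
  refine ⟨p, v - e⁻¹ • u - (e⁻¹ ^ 2) • p, ![u + (2 * e⁻¹) • p, ω 0, ω 1, ω 2], hpp, ?_, ?_, hT, ?_, ?_, ?_, ?_⟩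
  · simp only [map_sub, map_smul, LinearMap.sub_apply, LinearMap.smul_apply, smul_eq_mul, hpp, h1, h3, h4, h5, H.bs u p, H.bs v p, H.bs v u]
    linear_combination (-e⁻¹ ^ 2) * h2
  · simp only [map_sub, map_smul, LinearMap.sub_apply, LinearMap.smul_apply, smul_eq_mul, hpp, h1]
    linear_combination h2
  · rw [show v - e⁻¹ • u - (e⁻¹ ^ 2) • p = (-(e⁻¹ ^ 2)) • (p + e • u + (-e^2) • v) by
      match_scalars <;> field_simp]
    simp only [map_smul, LinearMap.smul_apply, smul_eq_mul]
    simpa [he0] using he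
  · intro i
    fin_cases i <;> simp [h1, h6, hpp]
  · intro i
    fin_cases i
    · simp [h1, h6, h7, h8, hpp, h3, H.bs u p, H.bs v u, H.bs v p, h4]
      linear_combination e⁻¹ * h2
    all_goals simp [h6, h7, h8]
  · intro a b g hg
    simp [Fin.sum_univ_succ] at hg
    have := hind ![a - b * e⁻¹ ^ 2 + g 0 * (2 * e⁻¹), g 0 - b * e⁻¹, b, g 1, g 2, g 3] (by
      simp [Fin.sum_univ_succ]
      rw [← hg]
      module)
    have j1 := this 1
    have j2 := this 2
    have j3 := this 3
    have j4 := this 4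
    have j5 := this 5
    simp at j1 j2 j3 j4 j5
    simp [j2] at j1
    intro i
    fin_cases i
    exacts [j1, j3, j4, j5]

theorem generic_pt {B T} (H : Sm B T) : ∃ 𝔇, Dv B T 𝔇 ∧ ∃ D : Fin 4 → Derivation ℤ ℂ ℂ, (∀ i, D i ∈ 𝔇) ∧
    ∃ p, p ≠ 0 ∧ B p p = 0 ∧ T p p p = 0 ∧ LinearIndependent ℂ fun i => ap (D i) p := by
  obtain ⟨u1, u2, w, b1, b2, b12, T1, T2, bw1, bw2, hind⟩ := gen_frame H
  let S : Set ℂ := (Set.range fun x : Fin 6 × Fin 6 => B (ee x.1) (ee x.2)) ∪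
    (Set.range fun x : Fin 6 × Fin 6 × Fin 6 => T (ee x.1) (ee x.2.1) (ee x.2.2)) ∪ Set.range u1 ∪ Set.range u2
      ∪ Set.range fun x : Fin 4 × Fin 6 => w x.1 x.2
  have hS : S.Countable := by
    simp only [S, Set.countable_union]
    exact ⟨⟨⟨⟨Set.countable_range _, Set.countable_range _⟩, Set.countable_range _⟩, Set.countable_range _⟩, Set.countable_range _⟩
  obtain ⟨t, D, hD, hDt⟩ := der_exists S hS
  let 𝔇 : Submodule ℂ (Derivation ℤ ℂ ℂ) :=
    { carrier := {D | ∀ s ∈ S, D s = 0}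
      add_mem' := fun {a b} ha hb s hs => by simp [ha s hs, hb s hs]
      zero_mem' := fun s hs => rfl
      smul_mem' := fun c a ha s hs => by simp [ha s hs] }
  have hK : Dv B T 𝔇 := by
    constructor
    · intro D hD D' hD' s hs
      rw [Derivation.commutator_apply, hD s hs, hD' s hs]; simp
    · intro D hD u v
      have hb : ∀ i j, D (B (ee i) (ee j)) = 0 := fun i j => hD _ (by left; left; left; left; exact ⟨(i, j), rfl⟩)
      rw [Bs_eq B, Bs_eq B (ap D u), Bs_eq B u (ap D v)]
      simp only [Bs, map_sum, Derivation.leibniz, hb, ap, smul_eq_mul, ← Finset.sum_add_distrib]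
      refine Finset.sum_congr rfl fun i _ => Finset.sum_congr rfl fun j _ => by ring
    · intro D hD u v z
      have hb : ∀ i j k, D (T (ee i) (ee j) (ee k)) = 0 := fun i j k => hD _ (by left; left; left; right; exact ⟨(i, j, k), rfl⟩)
      rw [Ts_eq T, Ts_eq T (ap D u), Ts_eq T u (ap D v), Ts_eq T u v (ap D z)]
      simp only [Ts, map_sum, Derivation.leibniz, hb, ap, smul_eq_mul, ← Finset.sum_add_distrib]
      refine Finset.sum_congr rfl fun i _ => Finset.sum_congr rfl fun j _ => Finset.sum_congr rfl fun k _ => by ring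
  refine ⟨𝔇, hK, D, fun i => hD i, ?_⟩
  have a1 : ∀ i, ap (D i) u1 = 0 := fun i => funext fun j => hD i _ (by left; left; right; exact ⟨j, rfl⟩)
  have a2 : ∀ i, ap (D i) u2 = 0 := fun i => funext fun j => hD i _ (by left; right; exact ⟨j, rfl⟩)
  have a3 : ∀ i k, ap (D i) (w k) = 0 := fun i k => funext fun j => hD i _ (by right; exact ⟨(k, j), rfl⟩)
  set s := ∑ i, t i • w i with hs
  have bs1 : B u1 s = 0 := by simp [hs, bw1]
  have bs2 : B u2 s = 0 := by simp [hs, bw2]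
  have hDs : ∀ i, ap (D i) s = w i := by
    intro i
    have : ap (D i) s = ∑ j, ap (D i) (t j • w j) := by
      ext k; simp [ap, hs]
    rw [this]
    simp [ap_smul, a3, hDt]
  suffices ∃ y1 y2 : ℂ, B (y1 • u1 + y2 • u2 + s) (y1 • u1 + y2 • u2 + s) = 0 ∧
      T (y1 • u1 + y2 • u2 + s) (y1 • u1 + y2 • u2 + s) (y1 • u1 + y2 • u2 + s) = 0 by
    obtain ⟨y1, y2, hB, hT⟩ := this
    have hli : LinearIndependent ℂ fun i => ap (D i) (y1 • u1 + y2 • u2 + s) := by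
      rw [Fintype.linearIndependent_iff]
      intro g hg
      simp only [ap_add, ap_smul, a1, a2, smul_zero, add_zero, hDs, smul_add, Finset.sum_add_distrib, smul_smul, ← Finset.sum_smul] at hg
      exact hind _ _ _ hg
    refine ⟨_, ?_, hB, hT, hli⟩
    intro h0
    have := hli.ne_zero 0
    rw [h0] at this
    apply this
    ext; simp [ap]
  set Q := B s s with hQ
  by_cases hQ0 : Q = 0
  · obtain ⟨x, z, hxz, hy⟩ := cubic_root (T u1 u1 u1) (3 * T u1 u1 s) (3 * T u1 s s) (T s s s)
    have hz : z ≠ 0 := by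
      rintro rfl
      simp [T1] at hy
      simp [hy] at hxz
    refine ⟨x / z, 0, ?_, ?_⟩
    · have := B_sum3 H (x / z) 0 1 u1 u2 s
      rw [one_smul] at this
      rw [this, b1, bs1, ← hQ, hQ0]; ring
    · have := T_sum3 H (x / z) 0 1 u1 u2 s
      rw [one_smul] at this
      rw [this]
      field_simp
      linear_combination hy
  · obtain ⟨y, hy⟩ := root6 (-Q ^ 3 * T u2 u2 u2) (3 * Q ^ 2 * T u2 u2 s) (3 * Q ^ 2 * T u1 u2 u2 - 3 * Q * T u2 s s)
      (T s s s - 6 * Q * T u1 u2 s) (3 * T u1 s s - 3 * Q * T u1 u1 u2) (3 * T u1 u1 s) (T u1 u1 u1) T1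
    have hy0 : y ≠ 0 := by
      rintro rfl
      simp [T2, hQ0] at hy
    refine ⟨y, -Q / y, ?_, ?_⟩
    · have := B_sum3 H y (-Q / y) 1 u1 u2 s
      rw [one_smul] at this
      rw [this, b1, b2, bs1, bs2, ← hQ]
      field_simp
      linear_combination (-Q * y ^ 2) * b12
    · have := T_sum3 H y (-Q / y) 1 u1 u2 s
      rw [one_smul] at this
      rw [this]
      field_simp
      linear_combination hy

end

section
open Topology Filter
set_option linter.unusedSimpArgs false
set_option linter.unusedVariables false

theorem perp_dim {B T} (H : Sm B T) {n : ℕ} (e : Fin n → V6) (he : LinearIndependent ℂ e) :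
    Module.finrank ℂ (LinearMap.ker (LinearMap.pi fun i => B (e i))) + n = 6 := by
  have hs : LinearMap.range (LinearMap.pi fun i => B (e i)) = ⊤ := by
    rw [LinearMap.range_eq_top]
    intro y
    obtain ⟨v, hv⟩ := H.dual e he y
    exact ⟨v, funext hv⟩
  have := LinearMap.finrank_range_add_finrank_ker (LinearMap.pi fun i => B (e i))
  rw [hs, finrank_top] at this
  simp at this
  omega

theorem lineB_of {B T} (H : Sm B T) {f1 f2 : V6} (hi : ∀ a b : ℂ, a • f1 + b • f2 = 0 → a = 0 ∧ b = 0)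
    (h : ∀ a b : ℂ, ∀ φ, φ = a • f1 + b • f2 → B φ φ = 0 ∧ T φ φ φ = 0) : LineB B T f1 f2 := by
  have hB := fun a b : ℂ => (B_sum3 H a b 0 f1 f2 0).symm.trans (by rw [(h a b _ (by simp)).1])
  have hT := fun a b : ℂ => (T_sum3 H a b 0 f1 f2 0).symm.trans (by rw [(h a b _ (by simp)).2])
  have b1 := hB 1 0
  have b2 := hB 0 1
  have b3 := hB 1 1
  have t1 := hT 1 0
  have t2 := hT 0 1
  have t3 := hT 1 1
  have t4 := hT 1 (-1)
  simp only [map_zero, LinearMap.zero_apply] at b1 b2 b3 t1 t2 t3 t4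
  refine ⟨hi, ?_, ?_, ?_, ?_, ?_, ?_, ?_⟩
  · linear_combination b1
  · linear_combination (b3 - b1 - b2) / 2
  · linear_combination b2
  · linear_combination t1
  · linear_combination (t3 - t4) / 6 - t2 / 3
  · linear_combination (t3 + t4) / 6 - t1 / 3
  · linear_combination t2

structure Gen (B : V6 →ₗ[ℂ] V6 →ₗ[ℂ] ℂ) (T : V6 →ₗ[ℂ] V6 →ₗ[ℂ] V6 →ₗ[ℂ] ℂ)
    (𝔇 : Submodule ℂ (Derivation ℤ ℂ ℂ)) (D : Fin 4 → Derivation ℤ ℂ ℂ) (p : V6) : Prop where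
  K : Dv B T 𝔇
  hD : ∀ i, D i ∈ 𝔇
  p0 : p ≠ 0
  pp : B p p = 0
  ppp : T p p p = 0
  li : LinearIndependent ℂ fun i => ap (D i) p

theorem conic_nondeg {B T 𝔇 D p} (H : Sm B T) (G : Gen B T 𝔇 D p) : ∃ (u v : V6) (lam : V6 →ₗ[ℂ] ℂ),
    (∀ a b c : ℂ, a • p + b • u + c • v = 0 → a = 0 ∧ b = 0 ∧ c = 0) ∧ B p u = 0 ∧ B u u ≠ 0 ∧ B p v ≠ 0 ∧
    ∀ r s z : ℂ, ∀ φ, φ = r • p + s • u + z • v → T φ φ φ = lam φ * B φ φ := by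
  obtain ⟨u, v, k, l1, l2, l3, μ, hi, hk, h⟩ := conic_exists H G.p0 G.pp G.ppp
  have thru : ∀ s z : ℂ, (s ≠ 0 ∨ z ≠ 0) → k 0 * s + k 1 * z = 0 → k 2 * s ^ 2 + k 3 * s * z + k 4 * z ^ 2 = 0 → False := by
    intro s z hsz h1 h2
    have L : LineB B T p (s • u + z • v) := by
      refine lineB_of H ?_ ?_
      · intro a b hab
        obtain ⟨x1, x2, x3⟩ := hi a (b * s) (b * z) (by rw [← hab]; module)
        refine ⟨x1, ?_⟩
        rcases hsz with h | h
        · exact (mul_eq_zero.1 x2).resolve_right h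
        · exact (mul_eq_zero.1 x3).resolve_right h
      · intro a b φ hφ
        have := h a (b * s) (b * z) φ (by rw [hφ]; module)
        rw [show k 0*(a*(b*s))+k 1*(a*(b*z))+k 2*(b*s)^2+k 3*(b*s*(b*z))+k 4*(b*z)^2 = 0 by
          linear_combination a * b * h1 + b ^ 2 * h2] at this
        simpa [and_comm] using this
    exact line_no_generic H G.K L D G.hD p (Submodule.subset_span (by simp)) G.li
  have hk01 : ¬ (k 0 = 0 ∧ k 1 = 0) := by
    rintro ⟨h0, h1⟩
    obtain ⟨s, z, hsz, hh⟩ := quad_root (k 2) (k 3) (k 4)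
    exact thru s z hsz (by simp [h0, h1]) hh
  have hΔ : k 2 * (-k 1) ^ 2 + k 3 * (-k 1) * k 0 + k 4 * k 0 ^ 2 ≠ 0 := by
    intro hh
    refine thru (-k 1) (k 0) ?_ (by ring) hh
    by_contra hc
    push Not at hc
    exact hk01 ⟨hc.2, by simpa using hc.1⟩
  have hBB := fun r s z : ℂ => (B_sum3 H r s z p u v).symm.trans (h r s z _ rfl).2
  by_cases hμ : μ = 0
  · exfalso
    subst hμ
    have bpu : B p u = 0 := by
      have x1 := hBB 1 1 0
      have x2 := hBB 0 1 0
      have x3 := hBB 1 0 0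
      linear_combination (x1 - x2 - x3) / 2
    have bpv : B p v = 0 := by
      have x1 := hBB 1 0 1
      have x2 := hBB 0 0 1
      have x3 := hBB 1 0 0
      linear_combination (x1 - x2 - x3) / 2
    have buv : B u v = 0 := by
      have x1 := hBB 0 1 1
      have x2 := hBB 0 0 1
      have x3 := hBB 0 1 0
      linear_combination (x1 - x2 - x3) / 2
    have bvv : B v v = 0 := by linear_combination hBB 0 0 1
    have buu : B u u = 0 := by linear_combination hBB 0 1 0
    by_cases hl1 : l1 = 0
    · subst hl1
      -- line through p contained in `l = 0`
      by_cases hl : l2 = 0 ∧ l3 = 0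
      · obtain ⟨rfl, rfl⟩ := hl
        have L : LineB B T p u := lineB_of H (fun a b hab => by
            have := hi a b 0 (by rw [← hab]; module)
            exact ⟨this.1, this.2.1⟩) (fun a b φ hφ => by
            have := h a b 0 φ (by rw [hφ]; module)
            exact ⟨this.2.trans (by ring), this.1.trans (by ring)⟩)
        exact line_no_generic H G.K L D G.hD p (Submodule.subset_span (by simp)) G.li
      · have L : LineB B T p (l3 • u - l2 • v) := lineB_of H (fun a b hab => by
            obtain ⟨x1, x2, x3⟩ := hi a (b * l3) (- b * l2) (by rw [← hab]; module)
            refine ⟨x1, ?_⟩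
            by_contra hb
            simp [hb] at x2 x3
            exact hl ⟨x3, x2⟩) (fun a b φ hφ => by
            have := h a (b * l3) (-b * l2) φ (by rw [hφ]; module)
            exact ⟨this.2.trans (by ring), this.1.trans (by ring)⟩)
        exact line_no_generic H G.K L D G.hD p (Submodule.subset_span (by simp)) G.li
    · -- line `l = 0` spanned by `u - l2/l1 p`, `v - l3/l1 p`
      set f1 := u - (l2 / l1) • p with hf1
      set f2 := v - (l3 / l1) • p with hf2
      have L : LineB B T f1 f2 := lineB_of H (fun a b hab => by
            have := hi (-a * (l2 / l1) - b * (l3 / l1)) a b (by rw [← hab, hf1, hf2]; module)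
            exact this.2) (fun a b φ hφ => by
            have := h (-a * (l2 / l1) - b * (l3 / l1)) a b φ (by rw [hφ, hf1, hf2]; module)
            refine ⟨this.2.trans (by ring), this.1.trans ?_⟩
            have : l1*(-a * (l2 / l1) - b * (l3 / l1))+l2*a+l3*b = 0 := by field_simp; ring
            rw [this, zero_mul])
      obtain ⟨y0, hy0⟩ := H.surj (T p p)
      have hTT := fun r s z : ℂ => (T_sum3 H r s z p u v).symm.trans (h r s z _ rfl).1
      have tpu : 3 * T p p u = l1 * k 0 := by
        have x1 := hTT 1 1 0
        have x2 := hTT (-1) 1 0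
        have x3 := hTT 0 1 0
        linear_combination (x1 + x2) / 2 - x3
      have tpv : 3 * T p p v = l1 * k 1 := by
        have x1 := hTT 1 0 1
        have x2 := hTT (-1) 0 1
        have x3 := hTT 0 0 1
        linear_combination (x1 + x2) / 2 - x3
      have bpf1 : B p f1 = 0 := by simp [hf1, bpu, G.pp]
      have bpf2 : B p f2 = 0 := by simp [hf2, bpv, G.pp]
      have hli : LinearIndependent ℂ ![f1, f2, p, y0] := by
        rw [Fintype.linearIndependent_iff]
        intro g hg
        simp [Fin.sum_univ_succ] at hg
        have g3 : g 3 = 0 := by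
          by_contra h3
          have e1 := congrArg (fun x => B x u) hg
          have e2 := congrArg (fun x => B x v) hg
          simp [hf1, hf2, hy0, bpu, bpv, buv, buu, bvv, H.bs v u, h3] at e1 e2
          apply hk01
          rw [e1] at tpu
          rw [e2] at tpv
          simpa [hl1, eq_comm] using And.intro tpu tpv
        have := hi (-g 0 * (l2 / l1) - g 1 * (l3 / l1) + g 2) (g 0) (g 1) (by
          rw [g3] at hg
          rw [← hg, hf1, hf2]; module)
        obtain ⟨x1, x2, x3⟩ := this
        simp [x2, x3] at x1
        intro i
        fin_cases i
        exacts [x2, x3, x1, g3]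
      have hdim := perp_dim H _ hli
      refine line_dim H G.K L D G.hD p G.li (LinearMap.ker (LinearMap.pi fun i => B ((![f1, f2, p, y0] : Fin 4 → V6) i))) (Nat.le_of_eq (Nat.add_right_cancel (m := 4) hdim)) ?_
      intro E hE hst
      have st : ∀ y ∈ Submodule.span ℂ {f1, f2}, B y p = 0 := by
        intro y hy
        obtain ⟨a, b, rfl⟩ := Submodule.mem_span_pair.1 hy
        simp [H.bs f1 p, H.bs f2 p, bpf1, bpf2]
      have s1 := st _ (hst f1 (Submodule.subset_span (by simp)))
      have s2 := st _ (hst f2 (Submodule.subset_span (by simp)))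
      have d1 := G.K.dB E hE f1 p
      have d2 := G.K.dB E hE f2 p
      have d3 := G.K.dB E hE p p
      have d4 := G.K.dT E hE p p p
      rw [H.bs f1, bpf1, s1, map_zero] at d1
      rw [H.bs f2, bpf2, s2, map_zero] at d2
      rw [G.pp, H.bs (ap E p), map_zero] at d3
      rw [G.ppp, H.t12 (ap E p), H.t23 p (ap E p), map_zero] at d4
      rw [LinearMap.mem_ker]
      ext i
      fin_cases i
      · simp; linear_combination -d1
      · simp; linear_combination -d2
      · simp; linear_combination -d3/2
      · simp [hy0]; linear_combination -d4/3
  · obtain ⟨lam, hlam⟩ := func_exists ![p, u, v] (by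
      rw [Fintype.linearIndependent_iff]
      intro g hg
      simp [Fin.sum_univ_succ] at hg
      have := hi (g 0) (g 1) (g 2) (by rw [← hg]; module)
      intro i; fin_cases i
      exacts [this.1, this.2.1, this.2.2]) ![l1 / μ, l2 / μ, l3 / μ]
    have q0 := hlam 0
    have q1 := hlam 1
    have q2 := hlam 2
    simp at q0 q1 q2
    have bpu : 2 * B p u = μ * k 0 := by
      have x1 := hBB 1 1 0
      have x2 := hBB 0 1 0
      have x3 := hBB 1 0 0
      linear_combination (x1 - x2 - x3)
    have bpv : 2 * B p v = μ * k 1 := by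
      have x1 := hBB 1 0 1
      have x2 := hBB 0 0 1
      have x3 := hBB 1 0 0
      linear_combination (x1 - x2 - x3)
    have hlamB : ∀ r s z : ℂ, ∀ φ, φ = r • p + s • u + z • v → T φ φ φ = lam φ * B φ φ := by
      intro r s z φ hφ
      rw [(h r s z φ hφ).1, (h r s z φ hφ).2]
      rw [hφ]
      simp [q0, q1, q2]
      field_simp
    have b1 : B p (-k 1 • u + k 0 • v) = 0 := by
      simp; linear_combination (-k 1 * bpu + k 0 * bpv) / 2
    have b2 : B (-k 1 • u + k 0 • v) (-k 1 • u + k 0 • v) ≠ 0 := by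
      rw [(h 0 (-k 1) (k 0) _ (by module)).2]
      refine mul_ne_zero hμ ?_
      convert hΔ using 1
      ring
    by_cases h0 : k 0 = 0
    · have h1 : k 1 ≠ 0 := fun h1 => hk01 ⟨h0, h1⟩
      refine ⟨-k 1 • u + k 0 • v, v, lam, ?_, b1, b2, ?_, ?_⟩
      · intro a b c hh
        obtain ⟨x1, x2, x3⟩ := hi a (-b * k 1) (b * k 0 + c) (by rw [← hh]; module)
        simp [h1] at x2
        simp [x2] at x3
        exact ⟨x1, x2, x3⟩
      · intro hh; rw [hh] at bpv; simp [hμ, h1] at bpv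
      · intro r s z φ hφ
        exact hlamB r (-s * k 1) (s * k 0 + z) φ (by rw [hφ]; module)
    · refine ⟨-k 1 • u + k 0 • v, u, lam, ?_, b1, b2, ?_, ?_⟩
      · intro a b c hh
        obtain ⟨x1, x2, x3⟩ := hi a (-b * k 1 + c) (b * k 0) (by rw [← hh]; module)
        simp [h0] at x3
        simp [x3] at x2
        exact ⟨x1, x3, x2⟩
      · intro hh; rw [hh] at bpu; simp [hμ, h0] at bpu
      · intro r s z φ hφ
        exact hlamB r (-s * k 1 + z) (s * k 0) φ (by rw [hφ]; module)

end

section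
set_option linter.unusedSimpArgs false
set_option linter.unusedVariables false

def cr {R : Type*} [CommRing R] (a b : Fin 3 → R) : Fin 3 → R :=
  ![a 1 * b 2 - a 2 * b 1, a 2 * b 0 - a 0 * b 2, a 0 * b 1 - a 1 * b 0]

theorem parallel (f g : Fin 3 → Polynomial ℂ) (hpar : ∀ i j, f i * g j = f j * g i)
    (hroot : ∀ x, ∃ i, (g i).eval x ≠ 0) (hf : ∀ i, (f i).natDegree ≤ 4) (j) (hj : (g j).coeff 4 ≠ 0) :
    ∃ α : ℂ, ∀ i, f i = Polynomial.C α * g i := by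
  have htop : Ideal.span (Set.range g) = ⊤ := by
    have hpr : (Ideal.span (Set.range g)).IsPrincipal := inferInstance
    obtain ⟨d, hd⟩ := hpr
    have hdg : ∀ i, d ∣ g i := fun i => by
      rw [← Ideal.mem_span_singleton]
      rw [Ideal.submodule_span_eq] at hd
      rw [← hd]
      exact Ideal.subset_span ⟨i, rfl⟩
    rw [hd, Ideal.submodule_span_eq, Ideal.span_singleton_eq_top, Polynomial.isUnit_iff_degree_eq_zero]
    by_contra h0
    obtain ⟨x, hx⟩ := IsAlgClosed.exists_root d h0
    obtain ⟨i, hi⟩ := hroot x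
    obtain ⟨e, he⟩ := hdg i
    rw [he, Polynomial.eval_mul, hx.eq_zero, zero_mul] at hi
    exact hi rfl
  have h1 : (1 : Polynomial ℂ) ∈ Ideal.span (Set.range g) := by rw [htop]; trivial
  obtain ⟨c, hc⟩ := (Ideal.mem_span_range_iff_exists_fun).1 h1
  have hα : ∀ i, f i = (∑ k, c k * f k) * g i := by
    intro i
    calc f i = f i * ∑ k, c k * g k := by rw [hc, mul_one]
      _ = _ := by
        rw [Finset.mul_sum, Finset.sum_mul]
        refine Finset.sum_congr rfl fun k _ => ?_
        rw [mul_assoc, hpar k i]; ring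
  set A := ∑ k, c k * f k
  have hA : A.natDegree = 0 := by
    by_cases h0 : A = 0
    · rw [h0]; simp
    have h4 := Polynomial.le_natDegree_of_ne_zero hj
    have hgj : g j ≠ 0 := fun h => by rw [h] at hj; simp at hj
    have := hf j
    rw [hα j, Polynomial.natDegree_mul h0 hgj] at this
    omega
  refine ⟨A.coeff 0, fun i => ?_⟩
  rw [← Polynomial.eq_C_of_natDegree_eq_zero hA]
  exact hα i

noncomputable def pl (v : Fin 3 → ℂ) : Polynomial ℂ := Polynomial.C (v 0) + Polynomial.C (v 1) * Polynomial.X + Polynomial.C (v 2) * Polynomial.X ^ 2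

theorem pl_add (v w) : pl (v + w) = pl v + pl w := by simp [pl]; ring
theorem pl_smul (c : ℂ) (v) : pl (c • v) = Polynomial.C c * pl v := by simp [pl]; ring
theorem pl_deg (v) : (pl v).natDegree ≤ 2 := by unfold pl; compute_degree
theorem pl_eval (v x) : (pl v).eval x = v 0 + v 1 * x + v 2 * x ^ 2 := by simp [pl]
theorem pl_inj {v w} (h : pl v = pl w) : v = w := by
  have h0 := congrArg (fun p => Polynomial.coeff p 0) h
  have h1 := congrArg (fun p => Polynomial.coeff p 1) h
  have h2 := congrArg (fun p => Polynomial.coeff p 2) h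
  simp [pl, Polynomial.coeff_X, Polynomial.coeff_C, Polynomial.coeff_X_pow] at h0 h1 h2
  ext i; fin_cases i
  exacts [h0, h1, h2]

theorem deg_mul2 {m n : ℕ} {p q : Polynomial ℂ} (hp : p.natDegree ≤ m) (hq : q.natDegree ≤ n) : (p * q).natDegree ≤ m + n :=
  Polynomial.natDegree_mul_le.trans (add_le_add hp hq)

theorem cr_deg {a b : Fin 3 → Polynomial ℂ} (ha : ∀ i, (a i).natDegree ≤ 2) (hb : ∀ i, (b i).natDegree ≤ 2) (i) :
    (cr a b i).natDegree ≤ 4 := by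
  fin_cases i <;> exact (Polynomial.natDegree_sub_le _ _).trans (max_le (deg_mul2 (ha _) (hb _)) (deg_mul2 (ha _) (hb _)))

noncomputable def ps (α : Fin 3 → Fin 3 → ℂ) : Fin 3 → Polynomial ℂ := fun i => pl (α i)

theorem ps_inj {v w} (h : ps v = ps w) : v = w := funext fun i => pl_inj (congrFun h i)

structure PG (α β : Fin 3 → Fin 3 → ℂ) : Prop where
  root : ∀ x, ∃ i, (cr (ps α) (ps β) i).eval x ≠ 0
  top : ∃ j, (cr (ps α) (ps β) j).coeff 4 ≠ 0

theorem PG.ker {α β} (h : PG α β) (δ : Fin 3 → Fin 3 → ℂ) (hδ : ∑ i, ps δ i * cr (ps α) (ps β) i = 0) :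
    ∃ x y : ℂ, δ = x • α + y • β := by
  obtain ⟨j, hj⟩ := h.top
  have hpd : ∀ α : Fin 3 → Fin 3 → ℂ, ∀ i, (ps α i).natDegree ≤ 2 := fun α i => pl_deg _
  have hA : ∃ x : ℂ, ∀ i, cr (ps δ) (ps β) i = Polynomial.C x * cr (ps α) (ps β) i := by
    refine parallel _ _ ?_ h.root (cr_deg (hpd _) (hpd _)) j hj
    simp [Fin.sum_univ_succ, cr] at hδ
    intro i k
    fin_cases i <;> fin_cases k <;> simp [cr]
    · linear_combination (ps β 2) * hδ
    · linear_combination -(ps β 1) * hδ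
    · linear_combination -(ps β 2) * hδ
    · linear_combination (ps β 0) * hδ
    · linear_combination (ps β 1) * hδ
    · linear_combination -(ps β 0) * hδ
  have hB : ∃ x : ℂ, ∀ i, cr (ps α) (ps δ) i = Polynomial.C x * cr (ps α) (ps β) i := by
    refine parallel _ _ ?_ h.root (cr_deg (hpd _) (hpd _)) j hj
    simp [Fin.sum_univ_succ, cr] at hδ
    intro i k
    fin_cases i <;> fin_cases k <;> simp [cr]
    · linear_combination -(ps α 2) * hδ
    · linear_combination (ps α 1) * hδ
    · linear_combination (ps α 2) * hδ
    · linear_combination -(ps α 0) * hδ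
    · linear_combination -(ps α 1) * hδ
    · linear_combination (ps α 0) * hδ
  obtain ⟨x, hx⟩ := hA
  obtain ⟨y, hy⟩ := hB
  refine ⟨x, y, ps_inj ?_⟩
  have hne : cr (ps α) (ps β) j ≠ 0 := fun h => by rw [h] at hj; simp at hj
  have e : ∀ i, ps (x • α + y • β) i = Polynomial.C x * ps α i + Polynomial.C y * ps β i := by
    intro i; simp only [ps, Pi.add_apply, Pi.smul_apply, pl_add, pl_smul]
  have x0 := hx 0
  have x1 := hx 1
  have x2 := hx 2
  have y0 := hy 0
  have y1 := hy 1
  have y2 := hy 2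
  simp only [cr, Matrix.cons_val] at x0 x1 x2 y0 y1 y2
  ext1 i
  apply mul_right_cancel₀ hne
  rw [e]
  generalize ps α = a at *
  generalize ps β = b at *
  generalize ps δ = d at *
  generalize Polynomial.C x = X at *
  generalize Polynomial.C y = Y at *
  clear hj hne hδ hx hy
  fin_cases j <;> fin_cases i <;> simp only [cr, Fin.zero_eta, Fin.mk_one, Fin.reduceFinMk, Matrix.cons_val]
  · linear_combination a 0 * x0 - b 1 * y1 - b 2 * y2
  · linear_combination a 1 * x0 + b 1 * y0
  · linear_combination a 2 * x0 + b 2 * y0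
  · linear_combination a 0 * x1 + b 0 * y1
  · linear_combination a 1 * x1 - b 0 * y0 - b 2 * y2
  · linear_combination a 2 * x1 + b 2 * y1
  · linear_combination a 0 * x2 + b 0 * y2
  · linear_combination a 1 * x2 + b 1 * y2
  · linear_combination a 2 * x2 - b 1 * y1 - b 0 * y0

theorem PG.surj1 {α β} (h : PG α β) (P : Polynomial ℂ) (hP : P.natDegree ≤ 6) :
    ∃ δ, ∑ i, ps δ i * cr (ps α) (ps β) i = P := by
  have hpd : ∀ α : Fin 3 → Fin 3 → ℂ, ∀ i, (ps α i).natDegree ≤ 2 := fun α i => pl_deg _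
  have hdeg : ∀ δ, (∑ i, ps δ i * cr (ps α) (ps β) i).natDegree ≤ 6 := fun δ =>
    Polynomial.natDegree_sum_le_of_forall_le _ _ fun i _ => deg_mul2 (hpd _ _) (cr_deg (hpd _) (hpd _) _)
  have hext : ∀ p q : Polynomial ℂ, p.natDegree ≤ 6 → q.natDegree ≤ 6 → (∀ n : Fin 7, p.coeff n = q.coeff n) → p = q := by
    intro p q hp hq hh
    ext n
    by_cases hn : n < 7
    · exact hh ⟨n, hn⟩
    · rw [Polynomial.coeff_eq_zero_of_natDegree_lt (by omega), Polynomial.coeff_eq_zero_of_natDegree_lt (by omega)]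
  let Φ : (Fin 3 → Fin 3 → ℂ) →ₗ[ℂ] (Fin 7 → ℂ) :=
    { toFun := fun δ n => (∑ i, ps δ i * cr (ps α) (ps β) i).coeff n
      map_add' := fun x y => by
        ext n
        simp only [ps, Pi.add_apply, pl_add, add_mul, Finset.sum_add_distrib, Polynomial.coeff_add]
      map_smul' := fun c x => by
        ext n
        simp only [ps, Pi.smul_apply, pl_smul, mul_assoc, ← Finset.mul_sum, Polynomial.coeff_C_mul, RingHom.id_apply, smul_eq_mul] }
  have hker : LinearMap.ker Φ ≤ Submodule.span ℂ {α, β} := by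
    intro δ hδ
    obtain ⟨x, y, rfl⟩ := h.ker δ (hext _ _ (hdeg _) (by simp) fun n => by
      rw [LinearMap.mem_ker] at hδ
      exact (congrFun hδ n).trans (by simp))
    exact Submodule.mem_span_pair.2 ⟨x, y, rfl⟩
  have h1 := Submodule.finrank_mono hker
  have h2 : Module.finrank ℂ (Submodule.span ℂ {α, β}) ≤ 2 := by
    classical
    have := finrank_span_finset_le_card (R := ℂ) ({α, β} : Finset (Fin 3 → Fin 3 → ℂ))
    rw [show ((({α, β} : Finset (Fin 3 → Fin 3 → ℂ))) : Set (Fin 3 → Fin 3 → ℂ)) = {α, β} by simp] at this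
    exact this.trans Finset.card_le_two
  have h3 := LinearMap.finrank_range_add_finrank_ker Φ
  have h4 : Module.finrank ℂ (Fin 3 → Fin 3 → ℂ) = 9 := by rw [Module.finrank_pi_fintype]; simp
  have h5 : LinearMap.range Φ = ⊤ := by
    apply Submodule.eq_top_of_finrank_eq
    have := Submodule.finrank_le (LinearMap.range Φ)
    have h6 : Module.finrank ℂ (Fin 7 → ℂ) = 7 := by simp
    omega
  obtain ⟨δ, hδ⟩ := LinearMap.range_eq_top.1 h5 (fun n => P.coeff n)
  exact ⟨δ, hext _ _ (hdeg _) hP fun n => congrFun hδ n⟩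

theorem cr_add_left {R : Type*} [CommRing R] (a a' b : Fin 3 → R) (i) : cr (a + a') b i = cr a b i + cr a' b i := by
  fin_cases i <;> simp [cr] <;> ring
theorem cr_add_right {R : Type*} [CommRing R] (a b b' : Fin 3 → R) (i) : cr a (b + b') i = cr a b i + cr a b' i := by
  fin_cases i <;> simp [cr] <;> ring
theorem cr_smul_left {R : Type*} [CommRing R] (c : R) (a b : Fin 3 → R) (i) : cr (c • a) b i = c * cr a b i := by
  fin_cases i <;> simp [cr] <;> ring
theorem cr_smul_right {R : Type*} [CommRing R] (c : R) (a b : Fin 3 → R) (i) : cr a (c • b) i = c * cr a b i := by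
  fin_cases i <;> simp [cr] <;> ring
theorem ps_add (a b) : ps (a + b) = ps a + ps b := funext fun i => pl_add _ _
theorem ps_smul (c : ℂ) (a) : ps (c • a) = Polynomial.C c • ps a := funext fun i => pl_smul _ _

theorem PG.surj2 {α β} (h : PG α β) (P : Fin 3 → Polynomial ℂ) (hP : ∀ i, (P i).natDegree ≤ 4) :
    ∃ δ ε, ∀ i, cr (ps δ) (ps β) i + cr (ps α) (ps ε) i = P i := by
  have hpd : ∀ α : Fin 3 → Fin 3 → ℂ, ∀ i, (ps α i).natDegree ≤ 2 := fun α i => pl_deg _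
  have hdeg : ∀ δ ε i, (cr (ps δ) (ps β) i + cr (ps α) (ps ε) i).natDegree ≤ 4 := fun δ ε i =>
    (Polynomial.natDegree_add_le _ _).trans (max_le (cr_deg (hpd _) (hpd _) _) (cr_deg (hpd _) (hpd _) _))
  have hext : ∀ p q : Polynomial ℂ, p.natDegree ≤ 4 → q.natDegree ≤ 4 → (∀ n : Fin 5, p.coeff n = q.coeff n) → p = q := by
    intro p q hp hq hh
    ext n
    by_cases hn : n < 5
    · exact hh ⟨n, hn⟩
    · rw [Polynomial.coeff_eq_zero_of_natDegree_lt (by omega), Polynomial.coeff_eq_zero_of_natDegree_lt (by omega)]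
  let Φ : ((Fin 3 → Fin 3 → ℂ) × (Fin 3 → Fin 3 → ℂ)) →ₗ[ℂ] (Fin 3 → Fin 5 → ℂ) :=
    { toFun := fun δ i n => (cr (ps δ.1) (ps β) i + cr (ps α) (ps δ.2) i).coeff n
      map_add' := fun x y => by
        ext i n
        simp only [Prod.fst_add, Prod.snd_add, ps_add, cr_add_left, cr_add_right, Polynomial.coeff_add, Pi.add_apply]
        ring
      map_smul' := fun c x => by
        ext i n
        simp only [Prod.smul_fst, Prod.smul_snd, ps_smul, cr_smul_left, cr_smul_right, ← mul_add, Polynomial.coeff_C_mul, Pi.smul_apply, RingHom.id_apply, smul_eq_mul] }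
  have hker : LinearMap.ker Φ ≤ Submodule.span ℂ {(α, -β), (β, 0), (0, α)} := by
    rintro ⟨δ, ε⟩ hδ
    have h0 : ∀ i, cr (ps δ) (ps β) i + cr (ps α) (ps ε) i = 0 := fun i => hext _ _ (hdeg _ _ _) (by simp) fun n => by
      rw [LinearMap.mem_ker] at hδ
      exact (congrFun (congrFun hδ i) n).trans (by simp)
    have z0 := h0 0
    have z1 := h0 1
    have z2 := h0 2
    simp only [cr, Matrix.cons_val] at z0 z1 z2
    obtain ⟨x, y, hxy⟩ := h.ker δ (by
      simp only [Fin.sum_univ_three, cr, Matrix.cons_val]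
      linear_combination - ps α 0 * z0 - ps α 1 * z1 - ps α 2 * z2)
    obtain ⟨z, w, hzw⟩ := h.ker ε (by
      simp only [Fin.sum_univ_three, cr, Matrix.cons_val]
      linear_combination - ps β 0 * z0 - ps β 1 * z1 - ps β 2 * z2)
    subst hxy hzw
    obtain ⟨j, hj⟩ := h.top
    have hw : w = -x := by
      have := congrArg (fun p => Polynomial.coeff p 4) (h0 j)
      have c0 : ∀ a : Fin 3 → Polynomial ℂ, ∀ i, cr a a i = 0 := fun a i => by fin_cases i <;> simp [cr] <;> ring
      simp only [ps_add, ps_smul, cr_add_left, cr_add_right, cr_smul_left, cr_smul_right, c0, mul_zero, add_zero, zero_add,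
        Polynomial.coeff_add, Polynomial.coeff_C_mul, Polynomial.coeff_zero, ← add_mul] at this
      rw [← Polynomial.C_add, Polynomial.coeff_C_mul] at this
      have := (mul_eq_zero.1 this).resolve_right hj
      linear_combination this
    subst hw
    rw [Submodule.mem_span_triple]
    exact ⟨x, y, z, by ext <;> simp <;> ring⟩
  have h1 := Submodule.finrank_mono hker
  have h2 : Module.finrank ℂ (Submodule.span ℂ {((α, -β) : (Fin 3 → Fin 3 → ℂ) × (Fin 3 → Fin 3 → ℂ)), (β, 0), (0, α)}) ≤ 3 := by
    classical
    have := finrank_span_finset_le_card (R := ℂ) ({(α, -β), (β, 0), (0, α)} : Finset ((Fin 3 → Fin 3 → ℂ) × (Fin 3 → Fin 3 → ℂ)))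
    simp only [Finset.coe_insert, Finset.coe_singleton] at this
    exact this.trans Finset.card_le_three
  have h3 := LinearMap.finrank_range_add_finrank_ker Φ
  have h4 : Module.finrank ℂ ((Fin 3 → Fin 3 → ℂ) × (Fin 3 → Fin 3 → ℂ)) = 18 := by rw [Module.finrank_prod, Module.finrank_pi_fintype]; simp
  have h5 : LinearMap.range Φ = ⊤ := by
    apply Submodule.eq_top_of_finrank_eq
    have := Submodule.finrank_le (LinearMap.range Φ)
    have h6 : Module.finrank ℂ (Fin 3 → Fin 5 → ℂ) = 15 := by rw [Module.finrank_pi_fintype]; simp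
    omega
  obtain ⟨⟨δ, ε⟩, hδ⟩ := LinearMap.range_eq_top.1 h5 (fun i n => (P i).coeff n)
  exact ⟨δ, ε, fun i => hext _ _ (hdeg _ _ _) (hP i) fun n => congrFun (congrFun hδ i) n⟩

end

section
open Topology Filter
set_option linter.unusedSimpArgs false
set_option linter.unusedVariables false

structure Fr (B : V6 →ₗ[ℂ] V6 →ₗ[ℂ] ℂ) (T : V6 →ₗ[ℂ] V6 →ₗ[ℂ] V6 →ₗ[ℂ] ℂ)
    (e ω : Fin 3 → V6) (m : Fin 3 → ℂ) : Prop where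
  b00 : B (e 0) (e 0) = 0
  b01 : B (e 0) (e 1) = 0
  b02 : 2 * B (e 0) (e 2) = -1
  b11 : B (e 1) (e 1) = 1
  b12 : B (e 1) (e 2) = 0
  b22 : B (e 2) (e 2) = 0
  bo : ∀ i j, B (e i) (ω j) = 0
  ind : LinearIndependent ℂ (Sum.elim e ω)
  cub : ∀ r s z : ℂ, ∀ φ, φ = r • e 0 + s • e 1 + z • e 2 → T φ φ φ = (m 0 * r + m 1 * s + m 2 * z) * (s ^ 2 - r * z)

theorem frame_exists {B T 𝔇 D p} (H : Sm B T) (G : Gen B T 𝔇 D p) : ∃ e ω m, Fr B T e ω m ∧ e 0 = p := by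
  obtain ⟨u, v, lam, hi, bpu, buu, bpv, hT⟩ := conic_nondeg H G
  obtain ⟨y, hy⟩ := IsAlgClosed.exists_pow_nat_eq (B u u) (n := 2) (by norm_num)
  have hy0 : y ≠ 0 := by rintro rfl; simp at hy; exact buu hy.symm
  set e1 := y⁻¹ • u with he1
  have b11 : B e1 e1 = 1 := by simp [he1, ← hy]; field_simp
  have b01 : B p e1 = 0 := by simp [he1, bpu]
  set v1 := v - B v e1 • e1 with hv1
  have c1 : B e1 v1 = 0 := by simp [hv1, b11, H.bs e1 v]
  have c2 : B p v1 ≠ 0 := by simpa [hv1, b01] using bpv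
  set e2 := (-(2 * B p v1)⁻¹) • (v1 - (B v1 v1 / (2 * B p v1)) • p) with he2
  have b02 : 2 * B p e2 = -1 := by simp [he2, G.pp]; field_simp
  have b12 : B e1 e2 = 0 := by simp [he2, c1, H.bs e1 p, b01]
  have b22 : B e2 e2 = 0 := by
    simp [he2, G.pp, H.bs v1 p, c2]
    field_simp
    ring
  set e : Fin 3 → V6 := ![p, e1, e2] with he
  have b10 : B e1 p = 0 := by rw [H.bs]; exact b01
  have b20 : 2 * B e2 p = -1 := by rw [H.bs]; exact b02
  have b21 : B e2 e1 = 0 := by rw [H.bs]; exact b12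
  have hind : ∀ g : Fin 3 → ℂ, (∀ j, B (e j) (∑ i, g i • e i) = 0) → g = 0 := by
    intro g hg
    have h0 := hg 0
    have h1 := hg 1
    have h2 := hg 2
    simp [Fin.sum_univ_succ, he, G.pp, b01, b10, b11, b12, b21, b22] at h0 h1 h2
    ext i; fin_cases i
    · simp
      rcases h2 with h | h
      · exact h
      · rw [h] at b20; simp at b20
    · exact h1
    · simp
      rcases h0 with h | h
      · exact h
      · rw [h] at b02; simp at b02
  have hli : LinearIndependent ℂ e := by
    rw [Fintype.linearIndependent_iff]
    intro g hg i
    rw [hind g (fun j => by rw [hg, map_zero])]; rfl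
  have hdim := perp_dim H e hli
  have hdim' : Module.finrank ℂ (LinearMap.ker (LinearMap.pi fun i => B (e i))) = 3 := Nat.add_right_cancel (m := 3) hdim
  let bs := Module.finBasisOfFinrankEq ℂ _ hdim'
  have hbo : ∀ i j, B (e i) (bs j) = 0 := fun i j => congrFun (LinearMap.mem_ker.1 (bs j).2) i
  refine ⟨e, fun i => bs i, fun i => lam (e i), ⟨G.pp, b01, b02, b11, b12, b22, hbo, ?_, ?_⟩, rfl⟩
  · rw [Fintype.linearIndependent_iff]
    intro g hg
    simp only [Fintype.sum_sum_type, Sum.elim_inl, Sum.elim_inr] at hg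
    have h1 := hind (fun i => g (Sum.inl i)) (fun j => by
      have := congrArg (B (e j)) hg
      simpa [hbo] using this)
    have h2 : ∀ i, g (Sum.inl i) = 0 := fun i => congrFun h1 i
    simp only [h2, zero_smul, Finset.sum_const_zero, zero_add] at hg
    have h3 := Fintype.linearIndependent_iff.1 bs.linearIndependent (fun i => g (Sum.inr i)) (by
      apply Subtype.ext
      simpa using hg)
    rintro (i | i)
    exacts [h2 i, h3 i]
  · intro r s z φ hφ
    have hφ' : φ = r • p + s • e1 + z • e2 := hφ
    have hB := B_sum3 H r s z p e1 e2
    rw [← hφ', G.pp, b11, b22, b01, b12] at hB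
    rw [hT (r + z * ((2 * B p v1)⁻¹ * (B v1 v1 / (2 * B p v1)))) (s * y⁻¹ + z * (2 * B p v1)⁻¹ * B v e1 * y⁻¹) (-z * (2 * B p v1)⁻¹) φ (by
      rw [hφ', he2, hv1, he1]; module), hB, hφ']
    simp [he]
    linear_combination (r * z * (lam p * r + lam e1 * s + lam e2 * z)) * b02

theorem Fr.co {B T e ω m} (F : Fr B T e ω m) : ∃ E X : Fin 3 → V6 →ₗ[ℂ] ℂ, (∀ i j, E i (e j) = if i = j then 1 else 0) ∧
    (∀ i j, E i (ω j) = 0) ∧ (∀ i j, X i (e j) = 0) ∧ (∀ i j, X i (ω j) = if i = j then 1 else 0) ∧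
    ∀ y, y = ∑ i, E i y • e i + ∑ i, X i y • ω i := by
  choose E hE using fun i => func_exists _ F.ind (Sum.elim (fun j => if i = j then 1 else 0) (fun _ => (0 : ℂ)))
  choose X hX using fun i => func_exists _ F.ind (Sum.elim (fun _ => (0 : ℂ)) (fun j : Fin 3 => if i = j then 1 else 0))
  have a1 : ∀ i j, E i (e j) = if i = j then 1 else 0 := fun i j => hE i (Sum.inl j)
  have a2 : ∀ i j, E i (ω j) = 0 := fun i j => hE i (Sum.inr j)
  have a3 : ∀ i j, X i (e j) = 0 := fun i j => hX i (Sum.inl j)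
  have a4 : ∀ i j, X i (ω j) = if i = j then 1 else 0 := fun i j => hX i (Sum.inr j)
  refine ⟨E, X, a1, a2, a3, a4, fun y => ?_⟩
  obtain ⟨c, hc⟩ := span_exists (by simp) _ F.ind y
  simp only [Fintype.sum_sum_type, Sum.elim_inl, Sum.elim_inr] at hc
  have h1 : ∀ i, E i y = c (Sum.inl i) := fun i => by rw [hc]; simp [a1, a2]
  have h2 : ∀ i, X i y = c (Sum.inr i) := fun i => by rw [hc]; simp [a3, a4]
  simp only [h1, h2]
  exact hc

theorem Fr.pol {B T e ω m} (H : Sm B T) (F : Fr B T e ω m) {w y : V6} {r s z r' s' z' : ℂ} (hw : w = r • e 0 + s • e 1 + z • e 2)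
    (hy : y = r' • e 0 + s' • e 1 + z' • e 2) :
    3 * T w w y = (m 0 * r' + m 1 * s' + m 2 * z') * B w w + 2 * (m 0 * r + m 1 * s + m 2 * z) * B w y := by
  have key := fun a b : ℂ => (T_sum3 H a b 0 w y 0).symm.trans (F.cub (a * r + b * r') (a * s + b * s') (a * z + b * z') _ (by
    rw [hw, hy]; module))
  have x1 := key 1 1
  have x2 := key (-1) 1
  have x3 := key 0 1
  have hB1 : B w w = s ^ 2 - r * z := by
    have := B_sum3 H r s z (e 0) (e 1) (e 2)
    rw [← hw, F.b00, F.b01, F.b11, F.b12, F.b22] at this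
    rw [this]; linear_combination r * z * F.b02
  have hB2 : 2 * B w y = 2 * s * s' - r * z' - r' * z := by
    rw [hw, hy]
    simp only [map_add, map_smul, LinearMap.add_apply, LinearMap.smul_apply, smul_eq_mul, F.b00, F.b01, F.b11, F.b12, F.b22, H.bs (e 1) (e 0), H.bs (e 2) (e 0), H.bs (e 2) (e 1)]
    linear_combination (r * z' + z * r') * F.b02
  simp only [map_zero, LinearMap.zero_apply] at x1 x2 x3
  rw [hB1]
  linear_combination (x1 + x2) / 2 - x3 - (m 0 * r + m 1 * s + m 2 * z) * hB2

theorem Fr.nz {B T e ω m} (H : Sm B T) (F : Fr B T e ω m) {w : V6} {r s z : ℂ} (hw : w = r • e 0 + s • e 1 + z • e 2)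
    (hw0 : w ≠ 0) (hB : B w w = 0) : ∃ i, T w w (ω i) ≠ 0 := by
  by_contra hc
  push Not at hc
  have h3 := F.pol H hw hw
  rw [hB] at h3
  obtain ⟨y, hy1, hy2⟩ := H.sm w hw0 hB (by linear_combination h3 / 3)
  obtain ⟨E, X, a1, a2, a3, a4, hdec⟩ := F.co
  apply hy2
  have hbo : ∀ j, B w (ω j) = 0 := fun j => by rw [hw]; simp [F.bo]
  have hp := F.pol H hw (y := ∑ i, E i y • e i) (Fin.sum_univ_three _)
  rw [hdec y] at hy1 ⊢
  simp only [map_add, map_sum, map_smul, hbo, hc, smul_zero, Finset.sum_const_zero, add_zero] at hy1 ⊢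
  rw [hB] at hp
  simp only [map_sum, map_smul, hy1] at hp
  linear_combination hp / 3

end

section
open Topology Filter
set_option linter.unusedSimpArgs false
set_option linter.unusedVariables false

theorem Fr.motion {B T e ω m 𝔇} (H : Sm B T) (F : Fr B T e ω m) (K : Dv B T 𝔇) {D} (hD : D ∈ 𝔇)
    (E X : Fin 3 → V6 →ₗ[ℂ] ℂ) (hdec : ∀ y, y = ∑ i, E i y • e i + ∑ i, X i y • ω i) (τ : ℂ) (w) (hw : w = e 0 + τ • e 1 + τ ^ 2 • e 2) :
    ∑ i, (pl fun j => X i (ap D (e j))).eval τ * T w w (ω i) = 0 := by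
  have hw' : w = (1 : ℂ) • e 0 + τ • e 1 + τ ^ 2 • e 2 := by rw [one_smul, hw]
  have hB1 : B w w = 0 := by
    have := B_sum3 H 1 τ (τ ^ 2) (e 0) (e 1) (e 2)
    rw [← hw', F.b00, F.b01, F.b11, F.b12, F.b22] at this
    rw [this]; linear_combination τ ^ 2 * F.b02
  have hT1 : T w w w = 0 := by
    rw [F.cub _ _ _ _ hw']; ring
  set Y := ap D (e 0) + τ • ap D (e 1) + τ ^ 2 • ap D (e 2) with hY
  set w1 := e 1 + (2 * τ) • e 2 with hw1
  have hap : ap D w = Y + D τ • w1 := by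
    rw [hw, ap_add, ap_add, ap_smul, ap_smul, hY, hw1, pow_two, Derivation.leibniz]
    simp only [smul_eq_mul]
    module
  have hBw1 : B w w1 = 0 := by
    rw [hw, hw1]
    simp only [map_add, map_smul, LinearMap.add_apply, LinearMap.smul_apply, smul_eq_mul, F.b01, F.b11, F.b12, F.b22, H.bs (e 2) (e 1)]
    linear_combination τ * F.b02
  have hTw1 : T w w w1 = 0 := by
    have := F.pol H hw' (y := w1) (r' := 0) (s' := 1) (z' := 2 * τ) (by rw [hw1]; module)
    rw [hB1, hBw1] at this
    linear_combination this / 3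
  have hBY : B w Y = 0 := by
    have := K.dB D hD w w
    rw [hB1, hap, H.bs (Y + D τ • w1), map_zero] at this
    simp only [map_add, map_smul, hBw1, smul_zero, add_zero] at this
    linear_combination -this / 2
  have hTY : T w w Y = 0 := by
    have := K.dT D hD w w w
    rw [hT1, hap, H.t12 (Y + D τ • w1), H.t23 w (Y + D τ • w1), map_zero] at this
    simp only [map_add, map_smul, hTw1, smul_zero, add_zero] at this
    linear_combination -this / 3
  have hbo : ∀ j, B w (ω j) = 0 := fun j => by rw [hw]; simp [F.bo]
  have hX : ∀ i, (pl fun j => X i (ap D (e j))).eval τ = X i Y := by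
    intro i; rw [pl_eval, hY]; simp; ring
  have hp := F.pol H hw' (y := ∑ i, E i Y • e i) (Fin.sum_univ_three _)
  rw [hdec Y] at hBY hTY
  simp only [hX]
  simp only [map_add, map_sum, map_smul, hbo, smul_zero, mul_zero, Finset.sum_const_zero, add_zero, smul_eq_mul] at hBY hTY
  rw [hB1] at hp
  simp only [map_sum, map_smul, hBY, smul_eq_mul] at hp
  linear_combination hTY - hp / 3

theorem two_dirs {B T e ω m 𝔇 D p} (H : Sm B T) (G : Gen B T 𝔇 D p) (F : Fr B T e ω m) (hp : e 0 = p)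
    (E X : Fin 3 → V6 →ₗ[ℂ] ℂ) (hdec : ∀ y, y = ∑ i, E i y • e i + ∑ i, X i y • ω i) :
    ∃ D1 ∈ 𝔇, ∃ D2 ∈ 𝔇, ∃ j, cr (fun i => X i (ap D1 p)) (fun i => X i (ap D2 p)) j ≠ 0 := by
  let φ := Fintype.linearCombination ℂ (fun i => ap (D i) p)
  have hinj : LinearMap.ker φ = ⊥ := Fintype.linearIndependent_iff'.1 G.li
  have hsum : ∀ c : Fin 4 → ℂ, ap (∑ i, c i • D i) p = φ c := by
    intro c
    simp only [φ, Fintype.linearCombination_apply, Fin.sum_univ_four, add_ap, smul_ap]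
  have hmem : ∀ c : Fin 4 → ℂ, (∑ i, c i • D i) ∈ 𝔇 := fun c => Submodule.sum_mem _ fun i _ => 𝔇.smul_mem _ (G.hD i)
  have hperp : ∀ c, B p (φ c) = 0 := by
    intro c
    have := G.K.dB _ (hmem c) p p
    rw [G.pp, H.bs (ap _ p), hsum, map_zero] at this
    linear_combination -this / 2
  let Ψ : (Fin 4 → ℂ) →ₗ[ℂ] (Fin 3 → ℂ) := (LinearMap.pi X) ∘ₗ φ
  have hk : Module.finrank ℂ (LinearMap.ker Ψ) ≤ 2 := by
    have h1 : (LinearMap.ker Ψ).map φ ≤ Submodule.span ℂ {e 0, e 1} := by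
      rintro _ ⟨c, hc, rfl⟩
      have hc' : ∀ i, X i (φ c) = 0 := fun i => congrFun (LinearMap.mem_ker.1 hc) i
      have hd := hdec (φ c)
      simp only [hc', zero_smul, Finset.sum_const_zero, add_zero, Fin.sum_univ_three] at hd
      have hq := hperp c
      rw [hd, ← hp] at hq
      simp only [map_add, map_smul, F.b00, F.b01, smul_zero, zero_add, smul_eq_mul] at hq
      have h2 : E 2 (φ c) = 0 := by linear_combination -2 * hq + E 2 (φ c) * F.b02
      rw [Submodule.mem_span_pair]
      rw [h2, zero_smul, add_zero] at hd
      exact ⟨_, _, hd.symm⟩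
    have h2 := Submodule.finrank_mono h1
    have h3 : Module.finrank ℂ (Submodule.span ℂ {e 0, e 1}) ≤ 2 := by
      have := finrank_span_finset_le_card (R := ℂ) ({e 0, e 1} : Finset V6)
      rw [Finset.coe_pair] at this
      exact this.trans Finset.card_le_two
    have h4 := LinearMap.finrank_le_finrank_of_injective (f := φ.restrict (p := LinearMap.ker Ψ) (q := (LinearMap.ker Ψ).map φ) fun x hx => ⟨x, hx, rfl⟩)
      (fun x y h => Subtype.ext (LinearMap.ker_eq_bot.1 hinj (congrArg Subtype.val h)))
    omega
  have hr := LinearMap.finrank_range_add_finrank_ker Ψ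
  simp only [Module.finrank_fin_fun] at hr
  have hr2 : 1 < Module.finrank ℂ (LinearMap.range Ψ) := by omega
  obtain ⟨x, hx⟩ : ∃ x : LinearMap.range Ψ, x ≠ 0 := by
    have : Nontrivial (LinearMap.range Ψ) := Module.nontrivial_of_finrank_pos (R := ℂ) (by omega)
    exact exists_ne 0
  obtain ⟨y, hxy⟩ := exists_linearIndependent_pair_of_one_lt_finrank hr2 hx
  obtain ⟨⟨_, c, rfl⟩, hc⟩ : ∃ x', x' = x := ⟨x, rfl⟩
  obtain ⟨⟨_, d, rfl⟩, hd⟩ : ∃ x', x' = y := ⟨y, rfl⟩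
  subst hc hd
  have hli2 : LinearIndependent ℂ ![Ψ c, Ψ d] := by
    rw [LinearIndependent.pair_iff] at hxy ⊢
    exact fun s t h => hxy s t (Subtype.ext h)
  rw [← crossProduct_ne_zero_iff_linearIndependent] at hli2
  refine ⟨_, hmem c, _, hmem d, ?_⟩
  rw [hsum, hsum]
  by_contra hcon
  push Not at hcon
  apply hli2
  ext j
  rw [cross_apply]
  exact hcon j

theorem ab_exists {B T e ω m 𝔇 D p} (H : Sm B T) (G : Gen B T 𝔇 D p) (F : Fr B T e ω m) (hp : e 0 = p) :
    ∃ α β, PG α β ∧ ∀ i τ w, w = e 0 + τ • e 1 + τ ^ 2 • e 2 → (cr (ps α) (ps β) i).eval τ = (3 / 2) * T w w (ω i) := by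
  obtain ⟨E, X, hE1, hE2, hX1, hX2, hdec⟩ := F.co
  obtain ⟨D1, hD1, D2, hD2, j, hj⟩ := two_dirs H G F hp E X hdec
  set α : Fin 3 → Fin 3 → ℂ := fun i j => X i (ap D1 (e j)) with hα
  set β : Fin 3 → Fin 3 → ℂ := fun i j => X i (ap D2 (e j)) with hβ
  have m1 := fun τ => F.motion H G.K hD1 E X hdec τ _ rfl
  have m2 := fun τ => F.motion H G.K hD2 E X hdec τ _ rfl
  let γ : Fin 3 → Polynomial ℂ := fun i => Polynomial.C (T (e 0) (e 0) (ω i)) + Polynomial.C (2 * T (e 0) (e 1) (ω i)) * Polynomial.X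
    + Polynomial.C (2 * T (e 0) (e 2) (ω i) + T (e 1) (e 1) (ω i)) * Polynomial.X ^ 2 + Polynomial.C (2 * T (e 1) (e 2) (ω i)) * Polynomial.X ^ 3
    + Polynomial.C (T (e 2) (e 2) (ω i)) * Polynomial.X ^ 4
  have hγ : ∀ i τ, (γ i).eval τ = T (e 0 + τ • e 1 + τ ^ 2 • e 2) (e 0 + τ • e 1 + τ ^ 2 • e 2) (ω i) := by
    intro i τ
    simp only [γ, Polynomial.eval_add, Polynomial.eval_mul, Polynomial.eval_C, Polynomial.eval_X, Polynomial.eval_pow, map_add, map_smul,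
      LinearMap.add_apply, LinearMap.smul_apply, smul_eq_mul, H.t12 (e 1) (e 0), H.t12 (e 2) (e 0), H.t12 (e 2) (e 1)]
    ring
  have hroot : ∀ x, ∃ i, (γ i).eval x ≠ 0 := by
    intro x
    simp only [hγ]
    refine F.nz H (r := 1) (s := x) (z := x ^ 2) (by rw [one_smul]) (fun h => ?_) ?_
    · have := congrArg (E 0) h
      simp [hE1] at this
    · have := B_sum3 H 1 x (x ^ 2) (e 0) (e 1) (e 2)
      rw [one_smul, F.b00, F.b01, F.b11, F.b12, F.b22] at this
      rw [this]; linear_combination x ^ 2 * F.b02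
  have htop : ∃ i, T (e 2) (e 2) (ω i) ≠ 0 := by
    refine F.nz H (r := 0) (s := 0) (z := 1) (by module) (fun h => ?_) F.b22
    have := congrArg (E 2) h
    simp [hE1] at this
  have hcf : ∀ i, (γ i).coeff 4 = T (e 2) (e 2) (ω i) := by
    intro i
    simp only [γ, Polynomial.coeff_add, Polynomial.coeff_C_mul, Polynomial.coeff_X, Polynomial.coeff_C, Polynomial.coeff_X_pow]
    norm_num
  obtain ⟨k, hk⟩ := htop
  have q1 : ∑ i, ps α i * γ i = 0 := Polynomial.funext fun τ => by
    rw [Polynomial.eval_finsetSum, Polynomial.eval_zero, ← m1 τ]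
    exact Finset.sum_congr rfl fun i _ => by rw [Polynomial.eval_mul, hγ]; rfl
  have q2 : ∑ i, ps β i * γ i = 0 := Polynomial.funext fun τ => by
    rw [Polynomial.eval_finsetSum, Polynomial.eval_zero, ← m2 τ]
    exact Finset.sum_congr rfl fun i _ => by rw [Polynomial.eval_mul, hγ]; rfl
  rw [Fin.sum_univ_three] at q1 q2
  obtain ⟨ρ, hρ⟩ := parallel (cr (ps α) (ps β)) γ (by
    intro i j
    fin_cases i <;> fin_cases j <;> simp only [cr, Fin.zero_eta, Fin.mk_one, Fin.reduceFinMk, Matrix.cons_val]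
    · linear_combination ps β 2 * q1 - ps α 2 * q2
    · linear_combination -ps β 1 * q1 + ps α 1 * q2
    · linear_combination -ps β 2 * q1 + ps α 2 * q2
    · linear_combination ps β 0 * q1 - ps α 0 * q2
    · linear_combination ps β 1 * q1 - ps α 1 * q2
    · linear_combination -ps β 0 * q1 + ps α 0 * q2) hroot (fun i => cr_deg (fun i => pl_deg _) (fun i => pl_deg _) i) k (by rwa [hcf])
  have hρ0 : ρ ≠ 0 := by
    rintro rfl
    apply hj
    have h0 := congrArg (Polynomial.eval 0) (hρ j)
    rw [map_zero, zero_mul, Polynomial.eval_zero] at h0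
    rw [← h0, ← hp]
    fin_cases j <;> simp [cr, ps, pl_eval, hα, hβ]
  have hfin : ∀ i, cr (ps α) (ps ((3 / 2 / ρ) • β)) i = Polynomial.C (3 / 2) * γ i := by
    intro i
    rw [ps_smul, cr_smul_right, hρ, ← mul_assoc, ← Polynomial.C_mul, div_mul_cancel₀ _ hρ0]
  refine ⟨α, (3 / 2 / ρ) • β, ⟨fun x => ?_, k, ?_⟩, ?_⟩
  · obtain ⟨i, hi⟩ := hroot x
    exact ⟨i, by rw [hfin]; simpa using hi⟩
  · rw [hfin, Polynomial.coeff_C_mul, hcf]; simpa using hk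
  · rintro i τ w rfl
    rw [hfin, Polynomial.eval_mul, Polynomial.eval_C, hγ]

end

section
open Topology Filter
set_option linter.unusedSimpArgs false
set_option linter.unusedVariables false

noncomputable def Qd : Submodule ℂ ((Fin 3 → ℂ) → ℂ) := Submodule.span ℂ (Set.range fun (p : Fin 3 × Fin 3) r => r p.1 * r p.2)
noncomputable def Cd : Submodule ℂ ((Fin 3 → ℂ) → ℂ) := Submodule.span ℂ (Set.range fun (p : Fin 3 × Fin 3 × Fin 3) r => r p.1 * r p.2.1 * r p.2.2)

theorem Qd_iff {g} : g ∈ Qd ↔ ∃ k : Fin 3 → Fin 3 → ℂ, ∀ r, g r = ∑ i, ∑ j, k i j * (r i * r j) := by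
  rw [Qd, Submodule.mem_span_range_iff_exists_fun]
  constructor
  · rintro ⟨c, rfl⟩
    refine ⟨fun i j => c (i, j), fun r => ?_⟩
    simp only [Finset.sum_apply, Pi.smul_apply, smul_eq_mul, Fintype.sum_prod_type]
  · rintro ⟨k, hk⟩
    refine ⟨fun p => k p.1 p.2, funext fun r => ?_⟩
    simp only [hk, Finset.sum_apply, Pi.smul_apply, smul_eq_mul, Fintype.sum_prod_type]

theorem Cd_iff {g} : g ∈ Cd ↔ ∃ k : Fin 3 → Fin 3 → Fin 3 → ℂ, ∀ r, g r = ∑ i, ∑ j, ∑ l, k i j l * (r i * r j * r l) := by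
  rw [Cd, Submodule.mem_span_range_iff_exists_fun]
  constructor
  · rintro ⟨c, rfl⟩
    refine ⟨fun i j l => c (i, j, l), fun r => ?_⟩
    simp only [Finset.sum_apply, Pi.smul_apply, smul_eq_mul, Fintype.sum_prod_type]
  · rintro ⟨k, hk⟩
    refine ⟨fun p => k p.1 p.2.1 p.2.2, funext fun r => ?_⟩
    simp only [hk, Finset.sum_apply, Pi.smul_apply, smul_eq_mul, Fintype.sum_prod_type]

noncomputable def ln (v r : Fin 3 → ℂ) : ℂ := v 0 * r 0 + v 1 * r 1 + v 2 * r 2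

theorem Qd_mul (u v) : (fun r => ln u r * ln v r) ∈ Qd :=
  Qd_iff.2 ⟨fun i j => u i * v j, fun r => by simp only [Fin.sum_univ_three, ln]; ring⟩

theorem Cd_mul (u) {g} (hg : g ∈ Qd) : (fun r => ln u r * g r) ∈ Cd := by
  obtain ⟨k, hk⟩ := Qd_iff.1 hg
  exact Cd_iff.2 ⟨fun i j l => u i * k j l, fun r => by simp only [hk, Fin.sum_univ_three, ln]; ring⟩

def cn (τ : ℂ) : Fin 3 → ℂ := fun i => τ ^ (i : ℕ)

theorem ln_cn (v τ) : ln v (cn τ) = (pl v).eval τ := by simp [ln, cn, pl_eval]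

theorem Qd_pol {g} (hg : g ∈ Qd) : ∃ P : Polynomial ℂ, P.natDegree ≤ 4 ∧ ∀ τ, P.eval τ = g (cn τ) := by
  obtain ⟨k, hk⟩ := Qd_iff.1 hg
  refine ⟨∑ i, ∑ j, Polynomial.C (k i j) * Polynomial.X ^ (i.val + j.val), ?_, fun τ => ?_⟩
  · refine Polynomial.natDegree_sum_le_of_forall_le _ _ fun i _ => Polynomial.natDegree_sum_le_of_forall_le _ _ fun j _ => ?_
    exact (Polynomial.natDegree_C_mul_X_pow_le _ _).trans (by omega)
  · simp only [hk, Polynomial.eval_finsetSum, Polynomial.eval_mul, Polynomial.eval_C, Polynomial.eval_pow, Polynomial.eval_X, cn, pow_add]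

theorem Cd_pol {g} (hg : g ∈ Cd) : ∃ P : Polynomial ℂ, P.natDegree ≤ 6 ∧ ∀ τ, P.eval τ = g (cn τ) := by
  obtain ⟨k, hk⟩ := Cd_iff.1 hg
  refine ⟨∑ i, ∑ j, ∑ l, Polynomial.C (k i j l) * Polynomial.X ^ (i.val + j.val + l.val), ?_, fun τ => ?_⟩
  · refine Polynomial.natDegree_sum_le_of_forall_le _ _ fun i _ => Polynomial.natDegree_sum_le_of_forall_le _ _ fun j _ =>
      Polynomial.natDegree_sum_le_of_forall_le _ _ fun l _ => ?_
    exact (Polynomial.natDegree_C_mul_X_pow_le _ _).trans (by omega)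
  · simp only [hk, Polynomial.eval_finsetSum, Polynomial.eval_mul, Polynomial.eval_C, Polynomial.eval_pow, Polynomial.eval_X, cn, pow_add]

theorem coef7 (c : Fin 7 → ℂ) (h : ∀ τ : ℂ, ∑ i, c i * τ ^ (i : ℕ) = 0) (i) : c i = 0 := by
  have h0 : ∑ i, Polynomial.C (c i) * Polynomial.X ^ (i : ℕ) = 0 := Polynomial.funext fun τ => by
    simpa [Polynomial.eval_finsetSum] using h τ
  have := congrArg (fun p => Polynomial.coeff p i) h0
  simpa [Polynomial.finsetSum_coeff, Polynomial.coeff_X_pow, Fin.val_inj] using this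

theorem Cd_van {g} (hg : g ∈ Cd) (h0 : ∀ τ, g (cn τ) = 0) : ∃ n : Fin 3 → ℂ, ∀ r, g r = ln n r * (r 1 ^ 2 - r 0 * r 2) := by
  obtain ⟨k, hk⟩ := Cd_iff.1 hg
  have h1 := coef7 ![k 0 0 0, k 0 0 1 + k 0 1 0 + k 1 0 0, k 0 0 2 + k 0 2 0 + k 2 0 0 + (k 0 1 1 + k 1 0 1 + k 1 1 0),
    k 0 1 2 + k 0 2 1 + k 1 0 2 + k 1 2 0 + k 2 0 1 + k 2 1 0 + k 1 1 1, k 0 2 2 + k 2 0 2 + k 2 2 0 + (k 1 1 2 + k 1 2 1 + k 2 1 1),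
    k 1 2 2 + k 2 1 2 + k 2 2 1, k 2 2 2] (fun τ => by
      refine Eq.trans ?_ (h0 τ)
      rw [hk]
      simp only [Fin.sum_univ_succ, cn]
      simp
      ring)
  have c0 := h1 0
  have c1 := h1 1
  have c2 := h1 2
  have c3 := h1 3
  have c4 := h1 4
  have c5 := h1 5
  have c6 := h1 6
  simp only [Matrix.cons_val] at c0 c1 c2 c3 c4 c5 c6
  refine ⟨![k 0 1 1 + k 1 0 1 + k 1 1 0, k 1 1 1, k 1 1 2 + k 1 2 1 + k 2 1 1], fun r => ?_⟩
  rw [hk]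
  simp only [Fin.sum_univ_three, ln, Matrix.cons_val]
  linear_combination r 0 ^ 3 * c0 + r 0 ^ 2 * r 1 * c1 + r 0 ^ 2 * r 2 * c2 + r 0 * r 1 * r 2 * c3 + r 0 * r 2 ^ 2 * c4 + r 1 * r 2 ^ 2 * c5 + r 2 ^ 3 * c6

theorem Qd_van {g} (hg : g ∈ Qd) (h0 : ∀ τ, g (cn τ) = 0) : ∃ n : ℂ, ∀ r, g r = n * (r 1 ^ 2 - r 0 * r 2) := by
  obtain ⟨k, hk⟩ := Qd_iff.1 hg
  have h1 := coef7 ![k 0 0, k 0 1 + k 1 0, k 0 2 + k 2 0 + k 1 1, k 1 2 + k 2 1, k 2 2, 0, 0] (fun τ => by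
      refine Eq.trans ?_ (h0 τ)
      rw [hk]
      simp only [Fin.sum_univ_succ, cn]
      simp
      ring)
  have c0 := h1 0
  have c1 := h1 1
  have c2 := h1 2
  have c3 := h1 3
  have c4 := h1 4
  simp only [Matrix.cons_val] at c0 c1 c2 c3 c4
  refine ⟨k 1 1, fun r => ?_⟩
  rw [hk]
  simp only [Fin.sum_univ_three]
  linear_combination r 0 ^ 2 * c0 + r 0 * r 1 * c1 + r 0 * r 2 * c2 + r 1 * r 2 * c3 + r 2 ^ 2 * c4

def I2 (B : V6 →ₗ[ℂ] V6 →ₗ[ℂ] ℂ) (X : Fin 3 → V6 →ₗ[ℂ] ℂ) : Submodule ℂ (V6 → ℂ) where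
  carrier := {Y | ∃ (L : Fin 3 → Fin 3 → V6 →ₗ[ℂ] ℂ) (l : V6 →ₗ[ℂ] ℂ), ∀ φ, Y φ = ∑ i, ∑ j, X i φ * X j φ * L i j φ + l φ * B φ φ}
  zero_mem' := ⟨0, 0, fun φ => by simp⟩
  add_mem' := by
    rintro f g ⟨L, l, h⟩ ⟨L', l', h'⟩
    refine ⟨L + L', l + l', fun φ => ?_⟩
    simp only [Pi.add_apply, h, h', LinearMap.add_apply, mul_add, Finset.sum_add_distrib]
    ring
  smul_mem' := by
    rintro c f ⟨L, l, h⟩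
    refine ⟨c • L, c • l, fun φ => ?_⟩
    simp only [Pi.smul_apply, h, LinearMap.smul_apply, mul_add, Finset.mul_sum, smul_eq_mul]
    congr 1
    · exact Finset.sum_congr rfl fun i _ => Finset.sum_congr rfl fun j _ => by ring
    · ring

theorem I2_xx (B X) (i j) (L : V6 →ₗ[ℂ] ℂ) : (fun φ => X i φ * X j φ * L φ) ∈ I2 B X := by
  refine ⟨fun i' j' => if i' = i ∧ j' = j then L else 0, 0, fun φ => ?_⟩
  rw [Finset.sum_eq_single i, Finset.sum_eq_single j] <;> simp +contextual

theorem I2_q (B X) (l : V6 →ₗ[ℂ] ℂ) : (fun φ => l φ * B φ φ) ∈ I2 B X := ⟨0, l, fun φ => by simp⟩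

theorem I2_c {B T e ω m} (H : Sm B T) (F : Fr B T e ω m) {E X : Fin 3 → V6 →ₗ[ℂ] ℂ} (hdec : ∀ y, y = ∑ i, E i y • e i + ∑ i, X i y • ω i)
    (l : V6 →ₗ[ℂ] ℂ) : (fun φ => l φ * (E 1 φ ^ 2 - E 0 φ * E 2 φ)) ∈ I2 B X := by
  have hq : (fun φ => l φ * (E 1 φ ^ 2 - E 0 φ * E 2 φ)) =
      (fun φ => l φ * B φ φ) - ∑ i, ∑ j, fun φ => X i φ * X j φ * (B (ω i) (ω j) • l) φ := by
    funext φ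
    have : B φ φ = E 1 φ ^ 2 - E 0 φ * E 2 φ + ∑ i, ∑ j, X i φ * X j φ * B (ω i) (ω j) := by
      conv_lhs => rw [hdec φ]
      simp only [Fin.sum_univ_three, map_add, map_smul, LinearMap.add_apply, LinearMap.smul_apply, smul_eq_mul, F.bo, F.b00, F.b01, F.b11, F.b12, F.b22,
        H.bs (e 1) (e 0), H.bs (e 2) (e 0), H.bs (e 2) (e 1), H.bs (ω _) (e _)]
      linear_combination E 0 φ * E 2 φ * F.b02
    simp only [Pi.sub_apply, Finset.sum_apply, this, LinearMap.smul_apply, smul_eq_mul, mul_add, Finset.mul_sum]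
    rw [add_sub_assoc, ← Finset.sum_sub_distrib]
    simp only [← Finset.sum_sub_distrib]
    rw [left_eq_add]
    exact Finset.sum_eq_zero fun i _ => Finset.sum_eq_zero fun j _ => by ring
  rw [hq]
  exact Submodule.sub_mem _ (I2_q _ _ _) (Submodule.sum_mem _ fun i _ => Submodule.sum_mem _ fun j _ => I2_xx _ _ _ _ _)

theorem I2_Q {B T e ω m} (H : Sm B T) (F : Fr B T e ω m) {E X : Fin 3 → V6 →ₗ[ℂ] ℂ} (hdec : ∀ y, y = ∑ i, E i y • e i + ∑ i, X i y • ω i)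
    {g} (hg : g ∈ Qd) (h0 : ∀ τ, g (cn τ) = 0) (i) : (fun φ => X i φ * g fun j => E j φ) ∈ I2 B X := by
  obtain ⟨n, hn⟩ := Qd_van hg h0
  convert I2_c H F hdec (n • X i) using 2 with φ
  rw [hn, LinearMap.smul_apply, smul_eq_mul]; ring

theorem I2_C {B T e ω m} (H : Sm B T) (F : Fr B T e ω m) {E X : Fin 3 → V6 →ₗ[ℂ] ℂ} (hdec : ∀ y, y = ∑ i, E i y • e i + ∑ i, X i y • ω i)
    {g} (hg : g ∈ Cd) (h0 : ∀ τ, g (cn τ) = 0) : (fun φ => g fun j => E j φ) ∈ I2 B X := by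
  obtain ⟨n, hn⟩ := Cd_van hg h0
  convert I2_c H F hdec (n 0 • E 0 + n 1 • E 1 + n 2 • E 2) using 2 with φ
  rw [hn]; simp [ln]

theorem split_y {e ω : Fin 3 → V6} (B) {E X : Fin 3 → V6 →ₗ[ℂ] ℂ} (hdec : ∀ y, y = ∑ i, E i y • e i + ∑ i, X i y • ω i)
    (y : V6 →ₗ[ℂ] V6 →ₗ[ℂ] V6 →ₗ[ℂ] ℂ) (π : (Fin 3 → ℂ) → V6) (hπ : ∀ r, π r = ∑ i, r i • e i) :
    (fun r => y (π r) (π r) (π r)) ∈ Cd ∧ (∀ i, (fun r => y (π r) (π r) (ω i) + y (π r) (ω i) (π r) + y (ω i) (π r) (π r)) ∈ Qd) ∧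
    (fun φ => y φ φ φ - y (π fun j => E j φ) (π fun j => E j φ) (π fun j => E j φ) - ∑ i, X i φ * (y (π fun j => E j φ) (π fun j => E j φ) (ω i) + y (π fun j => E j φ) (ω i) (π fun j => E j φ) + y (ω i) (π fun j => E j φ) (π fun j => E j φ))) ∈ I2 B X := by
  refine ⟨Cd_iff.2 ⟨fun i j k => y (e i) (e j) (e k), fun r => ?_⟩, fun i => Qd_iff.2 ⟨fun j k => y (e j) (e k) (ω i) + y (e j) (ω i) (e k) + y (ω i) (e j) (e k), fun r => ?_⟩, ?_⟩
  · simp only [hπ, Fin.sum_univ_three, map_add, map_smul, LinearMap.add_apply, LinearMap.smul_apply, smul_eq_mul]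
    ring
  · simp only [hπ, Fin.sum_univ_three, map_add, map_smul, LinearMap.add_apply, LinearMap.smul_apply, smul_eq_mul]
    ring
  · let P : V6 →ₗ[ℂ] V6 := ∑ i, (E i).smulRight (e i)
    have hP : ∀ φ, π (fun j => E j φ) = P φ := fun φ => by simp [P, hπ]
    have hE : ∀ φ, φ = P φ + ∑ i, X i φ • ω i := fun φ => by rw [← hP, hπ]; exact hdec φ
    convert Submodule.sum_mem (I2 B X) (t := Finset.univ) (f := fun i => ∑ j, fun φ => X i φ * X j φ *
      (y (ω i) (ω j) + (y (ω i)).flip (ω j) ∘ₗ P + ((y.flip (ω i)).flip (ω j)) ∘ₗ P) φ) fun i _ => Submodule.sum_mem _ fun j _ => I2_xx _ _ _ _ _ using 1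
    funext φ
    simp only [hP, Finset.sum_apply, LinearMap.add_apply, LinearMap.comp_apply, LinearMap.flip_apply]
    have : ∀ i j, y (ω i) (ω j) φ = y (ω i) (ω j) (P φ) + ∑ k, X k φ * y (ω i) (ω j) (ω k) := fun i j => by
      conv_lhs => rw [hE φ]
      simp
    simp only [this]
    conv_lhs => enter [1, 1]; rw [hE φ]
    simp only [Fin.sum_univ_three, map_add, map_smul, LinearMap.add_apply, LinearMap.smul_apply, smul_eq_mul]
    ring

end

section
open Topology Filter
set_option linter.unusedSimpArgs false
set_option linter.unusedVariables false

noncomputable def lf (E : Fin 3 → V6 →ₗ[ℂ] ℂ) (v : Fin 3 → ℂ) : V6 →ₗ[ℂ] ℂ := v 0 • E 0 + v 1 • E 1 + v 2 • E 2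
theorem lf_ap (E v φ) : lf E v φ = ln v fun j => E j φ := by simp [lf, ln]
noncomputable def cl (α β : Fin 3 → Fin 3 → ℂ) (i : Fin 3) (r : Fin 3 → ℂ) : ℂ := cr (fun i => ln (α i) r) (fun i => ln (β i) r) i
theorem cl_mem (α β i) : cl α β i ∈ Qd := by
  fin_cases i
  · exact Submodule.sub_mem _ (Qd_mul (α 1) (β 2)) (Qd_mul (α 2) (β 1))
  · exact Submodule.sub_mem _ (Qd_mul (α 2) (β 0)) (Qd_mul (α 0) (β 2))
  · exact Submodule.sub_mem _ (Qd_mul (α 0) (β 1)) (Qd_mul (α 1) (β 0))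
theorem cl_cn (α β i τ) : cl α β i (cn τ) = (cr (ps α) (ps β) i).eval τ := by
  fin_cases i <;> simp [cl, cr, ln_cn, ps]

theorem decomp {B T} (H : Sm B T) : ∃ (x a b : Fin 3 → V6 →ₗ[ℂ] ℂ) (S : Fin 3 → Fin 3 → V6 →ₗ[ℂ] ℂ) (l : V6 →ₗ[ℂ] ℂ),
    (∀ φ, T φ φ φ = 2 * ∑ i, x i φ * cr (fun i => a i φ) (fun i => b i φ) i + ∑ i, ∑ j, x i φ * x j φ * S i j φ + l φ * B φ φ) ∧
    ∀ y : V6 →ₗ[ℂ] V6 →ₗ[ℂ] V6 →ₗ[ℂ] ℂ, ∃ (x' a' b' : Fin 3 → V6 →ₗ[ℂ] ℂ) (S' : Fin 3 → Fin 3 → V6 →ₗ[ℂ] ℂ) (l' : V6 →ₗ[ℂ] ℂ), ∀ φ,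
      y φ φ φ = 2 * ∑ i, x' i φ * cr (fun i => a i φ) (fun i => b i φ) i
        + 2 * ∑ i, x i φ * (cr (fun i => a' i φ) (fun i => b i φ) i + cr (fun i => a i φ) (fun i => b' i φ) i)
        + ∑ i, ∑ j, (x' i φ * x j φ + x i φ * x' j φ) * S i j φ + ∑ i, ∑ j, x i φ * x j φ * S' i j φ + l' φ * B φ φ := by
  obtain ⟨𝔇, K, D, hD, p, p0, pp, ppp, li⟩ := generic_pt H
  have G : Gen B T 𝔇 D p := ⟨K, hD, p0, pp, ppp, li⟩
  obtain ⟨e, ω, m, F, hp⟩ := frame_exists H G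
  obtain ⟨α, β, hPG, hab⟩ := ab_exists H G F hp
  obtain ⟨E, X, -, -, -, -, hdec⟩ := F.co
  let π : (Fin 3 → ℂ) → V6 := fun r => ∑ i, r i • e i
  have hπ : ∀ r, π r = ∑ i, r i • e i := fun r => rfl
  have hcn : ∀ τ, π (cn τ) = e 0 + τ • e 1 + τ ^ 2 • e 2 := fun τ => by simp [hπ, Fin.sum_univ_three, cn]
  have hcr : ∀ (α β : Fin 3 → Fin 3 → ℂ) φ i, cr (fun i => lf E (α i) φ) (fun i => lf E (β i) φ) i = cl α β i fun j => E j φ := fun α β φ i => by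
    simp only [lf_ap]; rfl
  have h1 : (fun φ => T φ φ φ - 2 * ∑ i, X i φ * cl α β i fun j => E j φ) ∈ I2 B X := by
    obtain ⟨m1, m2, m3⟩ := split_y B hdec T π hπ
    have c1 := I2_C H F hdec m1 fun τ => by
      show T (π (cn τ)) (π (cn τ)) (π (cn τ)) = 0
      rw [F.cub 1 τ (τ ^ 2) _ (by rw [one_smul]; exact hcn τ)]; ring
    have c2 := fun i => I2_Q H F hdec (Submodule.sub_mem _ (m2 i) (Submodule.smul_mem _ 2 (cl_mem α β i))) (fun τ => by
      have h := hab i τ _ (hcn τ)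
      simp only [Pi.sub_apply, Pi.smul_apply, smul_eq_mul, cl_cn, h]
      rw [H.t23 _ (ω i), H.t12 (ω i), H.t23 _ (ω i)]; ring) i
    convert Submodule.add_mem _ (Submodule.add_mem _ m3 c1) (Submodule.sum_mem _ fun i (_ : i ∈ Finset.univ) => c2 i) using 1
    funext φ
    simp only [Pi.add_apply, Pi.sub_apply, Finset.sum_apply, Pi.smul_apply, smul_eq_mul, Fin.sum_univ_three]
    ring
  obtain ⟨S, l, hS⟩ := h1
  refine ⟨X, fun i => lf E (α i), fun i => lf E (β i), S, l, fun φ => ?_, fun y => ?_⟩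
  · simp only [hcr]
    linear_combination hS φ
  obtain ⟨m1, m2, m3⟩ := split_y B hdec y π hπ
  obtain ⟨P, hP, hPe⟩ := Cd_pol m1
  obtain ⟨δ, hδ⟩ := hPG.surj1 (Polynomial.C (1 / 2) * P) ((Polynomial.natDegree_C_mul_le _ _).trans hP)
  have c1 := I2_C H F hdec (Submodule.sub_mem _ m1 (Submodule.smul_mem _ 2 (Submodule.sum_mem _ fun i (_ : i ∈ Finset.univ) => Cd_mul (δ i) (cl_mem α β i)))) (fun τ => by
    have := congrArg (Polynomial.eval τ) hδ
    simp only [Polynomial.eval_finsetSum, Polynomial.eval_mul, Polynomial.eval_C, hPe, ps] at this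
    simp only [Pi.sub_apply, Pi.smul_apply, smul_eq_mul, Finset.sum_apply, cl_cn, ln_cn, ps]
    linear_combination -2 * this)
  have m4 : ∀ i, (fun r => ∑ j, ln (δ j) r * ln (fun k => S i j (e k) + S j i (e k)) r) ∈ Qd := fun i => by
    convert Submodule.sum_mem Qd fun j (_ : j ∈ Finset.univ) => Qd_mul (δ j) (fun k => S i j (e k) + S j i (e k)) using 1
    funext r
    simp only [Finset.sum_apply]
  have m5 := fun i => Submodule.sub_mem _ (m2 i) (m4 i)
  choose R hR hRe using fun i => Qd_pol (m5 i)
  obtain ⟨α', β', hα⟩ := hPG.surj2 (fun i => Polynomial.C (1 / 2) * R i) fun i => ((Polynomial.natDegree_C_mul_le _ _).trans (hR i))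
  have c2 := fun i => I2_Q H F hdec (Submodule.sub_mem _ (m5 i) (Submodule.smul_mem _ 2 (Submodule.add_mem _ (cl_mem α' β i) (cl_mem α β' i)))) (fun τ => by
    have := congrArg (Polynomial.eval τ) (hα i)
    simp only [Polynomial.eval_add, Polynomial.eval_mul, Polynomial.eval_C, hRe] at this
    rw [Pi.sub_apply, Pi.smul_apply, smul_eq_mul, Pi.add_apply, cl_cn, cl_cn]
    linear_combination -2 * this) i
  have c3 : (∑ i, ∑ j, ∑ k, fun φ => X i φ * X k φ * ((S i j (ω k) + S j i (ω k)) • lf E (δ j)) φ) ∈ I2 B X :=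
    Submodule.sum_mem _ fun i _ => Submodule.sum_mem _ fun j _ => Submodule.sum_mem _ fun k _ => I2_xx _ _ _ _ _
  obtain ⟨S', l', h'⟩ := Submodule.sub_mem _ (Submodule.add_mem _ (Submodule.add_mem _ m3 c1) (Submodule.sum_mem _ fun i (_ : i ∈ Finset.univ) => c2 i)) c3
  refine ⟨fun i => lf E (δ i), fun i => lf E (α' i), fun i => lf E (β' i), S', l', fun φ => ?_⟩
  have h := h' φ
  have hs : ∀ i j, S i j φ = S i j (e 0) * E 0 φ + S i j (e 1) * E 1 φ + S i j (e 2) * E 2 φ + ∑ k, X k φ * S i j (ω k) := fun i j => by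
    conv_lhs => rw [hdec φ]
    simp only [Fin.sum_univ_three, map_add, map_smul, smul_eq_mul]; ring
  rw [add_assoc, ← h]
  simp only [hcr]
  simp only [hs, Pi.add_apply, Pi.sub_apply, Finset.sum_apply, Pi.smul_apply, smul_eq_mul, LinearMap.smul_apply, lf_ap]
  simp only [Fin.sum_univ_three, ln]
  ring

end

section
open Topology Filter
set_option linter.unusedSimpArgs false
set_option linter.unusedVariables false

abbrev G6 := Fin 6 → Fin 6 → Fin 6 → ℂ
def tn (u v w : V6) : G6 := fun i j k => u i * v j * w k

noncomputable def ct (φ : V6) : G6 →ₗ[ℂ] ℂ where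
  toFun y := ∑ i, ∑ j, ∑ k, y i j k * (φ i * φ j * φ k)
  map_add' y y' := by simp only [Pi.add_apply, add_mul, Finset.sum_add_distrib]
  map_smul' c y := by simp only [Pi.smul_apply, smul_eq_mul, Finset.mul_sum, mul_assoc, RingHom.id_apply]

noncomputable def ev (u φ : V6) : ℂ := ∑ i, u i * φ i
theorem ev_add (u v φ) : ev (u + v) φ = ev u φ + ev v φ := by simp [ev, add_mul, Finset.sum_add_distrib]
theorem ev_ex (L : V6 →ₗ[ℂ] ℂ) : ∃ u, ∀ φ, ev u φ = L φ :=
  ⟨fun i => L (Pi.single i 1), fun φ => by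
    conv_rhs => rw [pi_eq_sum_univ' φ]
    simp only [map_sum, map_smul, smul_eq_mul, ev]
    exact Finset.sum_congr rfl fun i _ => by rw [mul_comm]⟩

theorem ct_tn (φ u v w) : ct φ (tn u v w) = ev u φ * ev v φ * ev w φ := by
  simp only [ct, tn, LinearMap.coe_mk, AddHom.coe_mk]
  rw [ev, ev, ev, Finset.sum_mul_sum, Finset.sum_mul]
  refine Finset.sum_congr rfl fun i _ => ?_
  rw [Finset.sum_mul_sum]
  exact Finset.sum_congr rfl fun j _ => Finset.sum_congr rfl fun k _ => by ring

@[fun_prop]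
theorem tn_cd {E : Type*} [NormedAddCommGroup E] [NormedSpace ℂ E] {u v w : E → V6} (hu : ContDiff ℂ 1 u) (hv : ContDiff ℂ 1 v) (hw : ContDiff ℂ 1 w) :
    ContDiff ℂ 1 fun p => tn (u p) (v p) (w p) := by
  refine contDiff_pi.2 fun i => contDiff_pi.2 fun j => contDiff_pi.2 fun k => ?_
  exact ((contDiff_pi.1 hu i).mul (contDiff_pi.1 hv j)).mul (contDiff_pi.1 hw k)

theorem tn_der {u v w : ℂ → V6} {u' v' w' : V6} {t} (hu : HasDerivAt u u' t) (hv : HasDerivAt v v' t) (hw : HasDerivAt w w' t) :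
    HasDerivAt (fun z => tn (u z) (v z) (w z)) (tn u' (v t) (w t) + tn (u t) v' (w t) + tn (u t) (v t) w') t := by
  refine hasDerivAt_pi.2 fun i => hasDerivAt_pi.2 fun j => hasDerivAt_pi.2 fun k => ?_
  refine (((hasDerivAt_pi.1 hu i).mul (hasDerivAt_pi.1 hv j)).mul (hasDerivAt_pi.1 hw k)).congr_deriv ?_
  simp only [Pi.add_apply, tn, Pi.mul_apply]; ring

noncomputable def dt (u v w : Fin 3 → V6) : G6 := ∑ i, (tn (u i) (v (i + 1)) (w (i + 2)) - tn (u i) (v (i + 2)) (w (i + 1)))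
noncomputable def st (u v : Fin 3 → V6) (S : Fin 3 → Fin 3 → V6) : G6 := ∑ i, ∑ j, tn (u i) (v j) (S i j + S j i)
noncomputable def qt (b : Fin 6 → V6) (l : V6) : G6 := ∑ j, tn l (Pi.single j 1) (b j)

theorem ct_dt (φ u v w) : ct φ (dt u v w) = ∑ i, ev (u i) φ * cr (fun i => ev (v i) φ) (fun i => ev (w i) φ) i := by
  simp only [dt, map_sum, map_sub, ct_tn]
  simp only [Fin.sum_univ_three, cr, Matrix.cons_val, Fin.reduceAdd, zero_add]
  ring
theorem ct_st (φ u v S) : ct φ (st u v S) = ∑ i, ∑ j, ev (u i) φ * ev (v j) φ * (ev (S i j) φ + ev (S j i) φ) := by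
  simp only [st, map_sum, ct_tn, ev_add]
theorem ct_qt (φ b l) : ct φ (qt b l) = ev l φ * ∑ j, φ j * ev (b j) φ := by
  simp only [qt, map_sum, ct_tn, Finset.mul_sum]
  refine Finset.sum_congr rfl fun j _ => ?_
  rw [show ev (Pi.single j 1) φ = φ j by simp [ev, Pi.single_apply], mul_assoc]

@[fun_prop]
theorem dt_cd {E : Type*} [NormedAddCommGroup E] [NormedSpace ℂ E] {u v w : E → Fin 3 → V6} (hu : ContDiff ℂ 1 u) (hv : ContDiff ℂ 1 v) (hw : ContDiff ℂ 1 w) :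
    ContDiff ℂ 1 fun p => dt (u p) (v p) (w p) := by
  unfold dt; fun_prop
@[fun_prop]
theorem st_cd {E : Type*} [NormedAddCommGroup E] [NormedSpace ℂ E] {u v : E → Fin 3 → V6} {S : E → Fin 3 → Fin 3 → V6} (hu : ContDiff ℂ 1 u) (hv : ContDiff ℂ 1 v)
    (hS : ContDiff ℂ 1 S) : ContDiff ℂ 1 fun p => st (u p) (v p) (S p) := by
  unfold st; fun_prop
@[fun_prop]
theorem qt_cd (b) {E : Type*} [NormedAddCommGroup E] [NormedSpace ℂ E] {u : E → V6} (hu : ContDiff ℂ 1 u) : ContDiff ℂ 1 fun p => qt b (u p) := by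
  unfold qt; fun_prop

theorem dt_der {u v w : ℂ → Fin 3 → V6} {u' v' w' : Fin 3 → V6} {t} (hu : HasDerivAt u u' t) (hv : HasDerivAt v v' t) (hw : HasDerivAt w w' t) :
    HasDerivAt (fun z => dt (u z) (v z) (w z)) (dt u' (v t) (w t) + dt (u t) v' (w t) + dt (u t) (v t) w') t := by
  rw [hasDerivAt_pi] at hu hv hw
  refine (HasDerivAt.fun_sum fun i (_ : i ∈ Finset.univ) => ((tn_der (hu i) (hv (i + 1)) (hw (i + 2))).sub (tn_der (hu i) (hv (i + 2)) (hw (i + 1))))).congr_deriv ?_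
  simp only [dt, ← Finset.sum_add_distrib]
  exact Finset.sum_congr rfl fun i _ => by abel

theorem st_der {u v : ℂ → Fin 3 → V6} {u' v' : Fin 3 → V6} {S : ℂ → Fin 3 → Fin 3 → V6} {S'} {t} (hu : HasDerivAt u u' t) (hv : HasDerivAt v v' t) (hS : HasDerivAt S S' t) :
    HasDerivAt (fun z => st (u z) (v z) (S z)) (st u' (v t) (S t) + st (u t) v' (S t) + st (u t) (v t) S') t := by
  rw [hasDerivAt_pi] at hu hv hS
  refine (HasDerivAt.fun_sum fun i (_ : i ∈ Finset.univ) => HasDerivAt.fun_sum fun j (_ : j ∈ Finset.univ) =>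
    tn_der (hu i) (hv j) ((hasDerivAt_pi.1 (hS i) j).add (hasDerivAt_pi.1 (hS j) i))).congr_deriv ?_
  simp only [st, ← Finset.sum_add_distrib, Pi.add_apply]

theorem qt_der (b) {u : ℂ → V6} {u'} {t} (hu : HasDerivAt u u' t) : HasDerivAt (fun z => qt b (u z)) (qt b u') t := by
  refine (HasDerivAt.fun_sum fun i (_ : i ∈ Finset.univ) => tn_der hu (hasDerivAt_const t _) (hasDerivAt_const t _)).congr_deriv ?_
  refine Finset.sum_congr rfl fun i _ => ?_
  funext a b c
  simp [tn]

noncomputable def NN : Submodule ℂ G6 := ⨅ φ, LinearMap.ker (ct φ)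

abbrev EE := (Fin 3 → V6) × (Fin 3 → V6) × (Fin 3 → V6) × (Fin 3 → Fin 3 → V6) × V6 × NN

noncomputable def ff (b : Fin 6 → V6) (p : ℂ × EE) : G6 :=
  (2 : ℂ) • dt p.2.1 p.2.2.1 p.2.2.2.1 + st p.2.1 p.2.1 p.2.2.2.2.1 + qt b p.2.2.2.2.2.1
  + p.1 ^ 2 • (st p.2.2.2.1 p.2.2.2.1 p.2.2.2.2.1 - st p.2.2.1 p.2.2.1 p.2.2.2.2.1)
  + p.1 ^ 4 • dt (fun i => p.2.2.2.2.1 0 i + p.2.2.2.2.1 i 0) (fun i => p.2.2.2.2.1 1 i + p.2.2.2.2.1 i 1) (fun i => p.2.2.2.2.1 2 i + p.2.2.2.2.1 i 2)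
  + NN.subtypeL p.2.2.2.2.2.2

theorem ff_cd (b) : ContDiff ℂ 1 (ff b) := by
  unfold ff
  fun_prop

theorem perturb {B T} (H : Sm B T) : ∃ (η : ℂ) (x a b : Fin 3 → V6) (S : Fin 3 → Fin 3 → V6) (l : V6), η ≠ 0 ∧ (∀ i j, S i j = S j i) ∧
    ∀ φ, T φ φ φ = 2 * ∑ i, ev (x i) φ * cr (fun i => ev (a i) φ) (fun i => ev (b i) φ) i + ∑ i, ∑ j, ev (x i) φ * ev (x j) φ * ev (S i j) φ
      + η ^ 2 * ∑ i, ∑ j, (ev (b i) φ * ev (b j) φ - ev (a i) φ * ev (a j) φ) * ev (S i j) φ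
      + η ^ 4 * ∑ i, ev (S 0 i) φ * cr (fun i => ev (S 1 i) φ) (fun i => ev (S 2 i) φ) i + ev l φ * B φ φ := by
  obtain ⟨x, a, b, S, l, h1, h2⟩ := decomp H
  choose bv hbv using fun j => ev_ex (B (Pi.single j 1))
  have hB : ∀ φ, ∑ j, φ j * ev (bv j) φ = B φ φ := fun φ => by
    simp only [hbv]
    conv_rhs => enter [1]; rw [pi_eq_sum_univ' φ]
    simp only [map_sum, map_smul, LinearMap.sum_apply, LinearMap.smul_apply, smul_eq_mul]
  choose x0 hx using fun i => ev_ex (x i)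
  choose a0 ha using fun i => ev_ex (a i)
  choose b0 hb using fun i => ev_ex (b i)
  choose S0 hS using fun i j => ev_ex ((1 / 2 : ℂ) • S i j)
  obtain ⟨l0, hl⟩ := ev_ex l
  have h0 := open_image (ff bv) (ff_cd bv) (x0, a0, b0, S0, l0, 0) (fun y => by
    let yl : V6 →ₗ[ℂ] V6 →ₗ[ℂ] V6 →ₗ[ℂ] ℂ := ∑ i, ∑ j, ∑ k, y i j k •
      (LinearMap.proj i : V6 →ₗ[ℂ] ℂ).smulRight ((LinearMap.proj j : V6 →ₗ[ℂ] ℂ).smulRight (LinearMap.proj k : V6 →ₗ[ℂ] ℂ))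
    have hyl : ∀ φ, yl φ φ φ = ct φ y := fun φ => by
      simp only [yl, LinearMap.sum_apply, LinearMap.smul_apply, LinearMap.smulRight_apply, LinearMap.proj_apply, smul_eq_mul, ct, LinearMap.coe_mk, AddHom.coe_mk]
      exact Finset.sum_congr rfl fun i _ => Finset.sum_congr rfl fun j _ => Finset.sum_congr rfl fun k _ => by ring
    obtain ⟨x', a', b', S', l', h3⟩ := h2 yl
    choose x1 hx1 using fun i => ev_ex (x' i)
    choose a1 ha1 using fun i => ev_ex (a' i)
    choose b1 hb1 using fun i => ev_ex (b' i)
    choose S1 hS1 using fun i j => ev_ex ((1 / 2 : ℂ) • S' i j)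
    obtain ⟨l1, hl1⟩ := ev_ex l'
    let dd : G6 := (2 : ℂ) • (dt x1 a0 b0 + dt x0 a1 b0 + dt x0 a0 b1) + (st x1 x0 S0 + st x0 x1 S0 + st x0 x0 S1) + qt bv l1
    have hn : y - dd ∈ NN := by
      simp only [NN, Submodule.mem_iInf, LinearMap.mem_ker]
      intro φ
      rw [map_sub, ← hyl, h3]
      simp only [dd, map_add, map_smul, ct_dt, ct_st, ct_qt, hB, hx, ha, hb, hS, hl, hx1, ha1, hb1, hS1, hl1, smul_eq_mul, LinearMap.smul_apply, Fin.sum_univ_three]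
      ring
    refine ⟨(x1, a1, b1, S1, l1, ⟨y - dd, hn⟩), ?_⟩
    have hline : ∀ {E : Type} [NormedAddCommGroup E] [NormedSpace ℂ E] (u v : E), HasDerivAt (fun z : ℂ => u + z • v) v 0 := fun u v => by
      simpa using ((hasDerivAt_id (0 : ℂ)).smul_const v).const_add u
    have hd := ((((dt_der (hline x0 x1) (hline a0 a1) (hline b0 b1)).const_smul (2 : ℂ)).add (st_der (hline x0 x1) (hline x0 x1) (hline S0 S1))).add
      (qt_der bv (hline l0 l1))).add (hline 0 (y - dd))
    simp only [zero_smul, add_zero] at hd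
    refine (hd.congr_deriv (add_sub_cancel _ _)).congr_of_eventuallyEq (Eventually.of_forall fun z => ?_)
    simp [ff])
  obtain ⟨η, ⟨⟨x1, a1, b1, S1, l1, n⟩, he⟩, hη⟩ := ((h0.filter_mono (nhdsWithin_le_nhds (s := {0}ᶜ))).and self_mem_nhdsWithin).exists
  refine ⟨η, x1, a1, b1, fun i j => S1 i j + S1 j i, l1, hη, fun i j => add_comm _ _, fun φ => ?_⟩
  have h := congrArg (ct φ) he
  have hn : ct φ n = 0 := LinearMap.mem_ker.1 ((Submodule.mem_iInf _).1 n.2 φ)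
  simp only [ff, map_add, map_smul, map_sub, ct_dt, ct_st, ct_qt, hB, hx, ha, hb, hS, hl, smul_eq_mul, Submodule.subtypeL_apply, hn, ev_add, ZeroMemClass.coe_zero, map_zero, LinearMap.smul_apply] at h
  rw [h1]
  simp only [ev_add, Fin.sum_univ_three] at h ⊢
  linear_combination -h

end

noncomputable section
open MvPolynomial Matrix

def As {R α : Type*} [CommRing R] {n : ℕ} (t : (Fin n → α) → R) (v : Fin n → α) : R :=
  ∑ σ : Equiv.Perm (Fin n), ((Equiv.Perm.sign σ : ℤ) : R) * t (v ∘ σ)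

theorem As_succ {R α : Type*} [CommRing R] {n : ℕ} (t : (Fin (n + 1) → α) → R) (v : Fin (n + 1) → α) :
    As t v = ∑ p : Fin (n + 1), (if p = 0 then 1 else -1) * As (fun u => t (Fin.cons (v p) u)) (fun i => v (Equiv.swap 0 p i.succ)) := by
  rw [As, ← Equiv.sum_comp Equiv.Perm.decomposeFin.symm, Fintype.sum_prod_type]
  refine Finset.sum_congr rfl fun p _ => ?_
  rw [As, Finset.mul_sum]
  refine Finset.sum_congr rfl fun σ _ => ?_
  rw [Equiv.Perm.decomposeFin.symm_sign]
  have : v ∘ ⇑(Equiv.Perm.decomposeFin.symm (p, σ)) = Fin.cons (v p) ((fun i => v (Equiv.swap 0 p i.succ)) ∘ σ) := by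
    funext i
    refine Fin.cases ?_ (fun i => ?_) i
    · simp
    · simp
  rw [this]
  split_ifs <;> simp

theorem As_zero {R α : Type*} [CommRing R] (t : (Fin 0 → α) → R) (v : Fin 0 → α) : As t v = t v := by
  simp [As, Subsingleton.elim _ v]

theorem As4 {R α : Type*} [CommRing R] (M : α → α → R) (hM : ∀ i j, M j i = -M i j) (k : R) (v : Fin 4 → α) :
    As (fun u => k * M (u 0) (u 1) * M (u 2) (u 3)) v =
      8 * k * (M (v 0) (v 1) * M (v 2) (v 3) - M (v 0) (v 2) * M (v 1) (v 3) + M (v 0) (v 3) * M (v 1) (v 2)) := by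
  simp only [As_succ, As_zero, Fin.sum_univ_succ, Finset.univ_unique, Finset.sum_singleton, Fin.default_eq_zero]
  have k1 : ∀ {n} (a : α) (b : Fin (n + 1) → α), (Fin.cons a b : Fin (n + 2) → α) 1 = b 0 := fun a b => rfl
  have k2 : ∀ (a : α) (b : Fin 3 → α), (Fin.cons a b : Fin 4 → α) 2 = b 1 := fun a b => rfl
  have k3 : ∀ (a : α) (b : Fin 3 → α), (Fin.cons a b : Fin 4 → α) 3 = b 2 := fun a b => rfl
  have k4 : ∀ (a : α) (b : Fin 2 → α), (Fin.cons a b : Fin 3 → α) 2 = b 1 := fun a b => rfl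
  simp [Equiv.swap_apply_def, Fin.ext_iff, k1, k2, k3, k4]
  simp only [hM (v 0) (v 1), hM (v 0) (v 2), hM (v 0) (v 3), hM (v 1) (v 2), hM (v 1) (v 3), hM (v 2) (v 3)]
  ring

theorem As6 {R α : Type*} [CommRing R] (M : α → α → R) (hM : ∀ i j, M j i = -M i j) (v : Fin 6 → α) :
    As (fun u => M (u 0) (u 1) * M (u 2) (u 3) * M (u 4) (u 5)) v =
      48 * (M (v 0) (v 1) * (M (v 2) (v 3) * M (v 4) (v 5) - M (v 2) (v 4) * M (v 3) (v 5) + M (v 2) (v 5) * M (v 3) (v 4))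
        - M (v 0) (v 2) * (M (v 1) (v 3) * M (v 4) (v 5) - M (v 1) (v 4) * M (v 3) (v 5) + M (v 1) (v 5) * M (v 3) (v 4))
        + M (v 0) (v 3) * (M (v 1) (v 2) * M (v 4) (v 5) - M (v 1) (v 4) * M (v 2) (v 5) + M (v 1) (v 5) * M (v 2) (v 4))
        - M (v 0) (v 4) * (M (v 1) (v 2) * M (v 3) (v 5) - M (v 1) (v 3) * M (v 2) (v 5) + M (v 1) (v 5) * M (v 2) (v 3))
        + M (v 0) (v 5) * (M (v 1) (v 2) * M (v 3) (v 4) - M (v 1) (v 3) * M (v 2) (v 4) + M (v 1) (v 4) * M (v 2) (v 3))) := by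
  have h : ∀ a b (w : Fin 4 → α), As (fun u : Fin 4 → α => M ((Fin.cons a (Fin.cons b u : Fin 5 → α) : Fin 6 → α) 0) ((Fin.cons a (Fin.cons b u : Fin 5 → α) : Fin 6 → α) 1)
      * M ((Fin.cons a (Fin.cons b u : Fin 5 → α) : Fin 6 → α) 2) ((Fin.cons a (Fin.cons b u : Fin 5 → α) : Fin 6 → α) 3)
      * M ((Fin.cons a (Fin.cons b u : Fin 5 → α) : Fin 6 → α) 4) ((Fin.cons a (Fin.cons b u : Fin 5 → α) : Fin 6 → α) 5)) w = _ :=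
    fun a b w => As4 M hM (M a b) w
  rw [As_succ]
  simp only [As_succ (n := 4), h]
  simp only [Fin.sum_univ_succ, Finset.univ_unique, Finset.sum_singleton, Fin.default_eq_zero]
  simp [Equiv.swap_apply_def, Fin.ext_iff]
  simp only [hM (v 0) (v 1), hM (v 0) (v 2), hM (v 0) (v 3), hM (v 0) (v 4), hM (v 0) (v 5), hM (v 1) (v 2), hM (v 1) (v 3), hM (v 1) (v 4), hM (v 1) (v 5),
    hM (v 2) (v 3), hM (v 2) (v 4), hM (v 2) (v 5), hM (v 3) (v 4), hM (v 3) (v 5), hM (v 4) (v 5)]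
  ring

theorem pf6 {R : Type*} [CommRing R] [Algebra ℚ R] (M : Matrix (Fin (2 * 3)) (Fin (2 * 3)) R) (hM : ∀ i j, M j i = -M i j) :
    pfaffian M = M 0 1 * (M 2 3 * M 4 5 - M 2 4 * M 3 5 + M 2 5 * M 3 4) - M 0 2 * (M 1 3 * M 4 5 - M 1 4 * M 3 5 + M 1 5 * M 3 4)
        + M 0 3 * (M 1 2 * M 4 5 - M 1 4 * M 2 5 + M 1 5 * M 2 4) - M 0 4 * (M 1 2 * M 3 5 - M 1 3 * M 2 5 + M 1 5 * M 2 3)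
        + M 0 5 * (M 1 2 * M 3 4 - M 1 3 * M 2 4 + M 1 4 * M 2 3) := by
  have h1 : pfaffian M = algebraMap ℚ R (48⁻¹) * As (fun u => M (u 0) (u 1) * M (u 2) (u 3) * M (u 4) (u 5)) (id : Fin 6 → Fin (2 * 3)) := by
    rw [pfaffian, As]
    congr 1
    · norm_num [Nat.factorial]
    · refine Finset.sum_congr rfl fun σ _ => ?_
      rw [zsmul_eq_mul, Fin.prod_univ_three]
      rfl
  rw [h1, As6 _ hM, ← mul_assoc, ← map_ofNat (algebraMap ℚ R) 48, ← map_mul, inv_mul_cancel₀ (by norm_num), map_one, one_mul]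
  rfl

end

noncomputable section
open MvPolynomial Matrix
open Topology Filter
set_option linter.unusedSimpArgs false
set_option linter.unusedVariables false

theorem pdc (i j : Fin 6) (p : MvPolynomial (Fin 6) ℂ) : pderiv i (pderiv j p) = pderiv j (pderiv i p) := by
  have h : ⁅(pderiv i : Derivation ℂ (MvPolynomial (Fin 6) ℂ) (MvPolynomial (Fin 6) ℂ)), (pderiv j : Derivation ℂ (MvPolynomial (Fin 6) ℂ) (MvPolynomial (Fin 6) ℂ))⁆ = 0 := by
    refine MvPolynomial.derivation_ext fun k => ?_
    rw [Derivation.commutator_apply]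
    simp only [pderiv_X, Pi.single_apply, Derivation.coe_zero, Pi.zero_apply]
    split_ifs <;> simp
  have := congrArg (fun D => D p) h
  simpa [Derivation.commutator_apply, sub_eq_zero] using this

theorem hom1 {p : MvPolynomial (Fin 6) ℂ} (hp : p.IsHomogeneous 1) (a) : eval a p = ∑ i, a i * coeff 0 (pderiv i p) := by
  have := congrArg (eval a) hp.sum_X_mul_pderiv
  simp only [map_sum, map_mul, eval_X, one_smul] at this
  rw [← this]
  refine Finset.sum_congr rfl fun i _ => ?_
  have h0 : (pderiv i p).totalDegree = 0 := by
    have := (hp.pderiv (i := i)).totalDegree_le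
    omega
  rw [totalDegree_eq_zero_iff_eq_C.1 h0, eval_C, coeff_C, if_pos rfl]

theorem hom2 {p : MvPolynomial (Fin 6) ℂ} (hp : p.IsHomogeneous 2) (a) : 2 * eval a p = ∑ i, ∑ j, a i * a j * coeff 0 (pderiv j (pderiv i p)) := by
  have := congrArg (eval a) hp.sum_X_mul_pderiv
  simp only [map_sum, map_mul, eval_X, map_nsmul] at this
  have h2 : 2 * eval a p = ∑ i, a i * eval a (pderiv i p) := by rw [this, nsmul_eq_mul]; push_cast; ring
  rw [h2]
  refine Finset.sum_congr rfl fun i _ => ?_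
  rw [hom1 hp.pderiv, Finset.mul_sum]
  exact Finset.sum_congr rfl fun j _ => by ring

theorem hom3 {p : MvPolynomial (Fin 6) ℂ} (hp : p.IsHomogeneous 3) (a) : 6 * eval a p = ∑ i, ∑ j, ∑ k, a i * a j * a k * coeff 0 (pderiv k (pderiv j (pderiv i p))) := by
  have := congrArg (eval a) hp.sum_X_mul_pderiv
  simp only [map_sum, map_mul, eval_X, map_nsmul] at this
  have h3 : 6 * eval a p = 2 * ∑ i, a i * eval a (pderiv i p) := by rw [this, nsmul_eq_mul]; push_cast; ring
  rw [h3, Finset.mul_sum]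
  refine Finset.sum_congr rfl fun i _ => ?_
  rw [show 2 * (a i * eval a (pderiv i p)) = a i * (2 * eval a (pderiv i p)) by ring, hom2 hp.pderiv, Finset.mul_sum]
  refine Finset.sum_congr rfl fun j _ => ?_
  rw [Finset.mul_sum]
  exact Finset.sum_congr rfl fun k _ => by ring

theorem bt_exists (q c : MvPolynomial (Fin 6) ℂ) (hq : q.IsHomogeneous 2) (hc : c.IsHomogeneous 3)
    (hQsm : ∀ a : Fin 6 → ℂ, a ≠ 0 → eval a q = 0 → ∃ i, eval a (pderiv i q) ≠ 0)
    (hXsm : ∀ a : Fin 6 → ℂ, a ≠ 0 → eval a q = 0 → eval a c = 0 →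
      LinearIndependent ℂ ![(fun i => eval a (pderiv i q)), fun i => eval a (pderiv i c)]) :
    ∃ B T, Sm B T ∧ (∀ φ, eval φ q = B φ φ) ∧ ∀ φ, eval φ c = T φ φ φ := by
  let pr : Fin 6 → V6 →ₗ[ℂ] ℂ := fun i => LinearMap.proj i
  let B : V6 →ₗ[ℂ] V6 →ₗ[ℂ] ℂ := ∑ i, ∑ j, (coeff 0 (pderiv j (pderiv i q)) / 2) • (pr i).smulRight (pr j)
  let T : V6 →ₗ[ℂ] V6 →ₗ[ℂ] V6 →ₗ[ℂ] ℂ := ∑ i, ∑ j, ∑ k, (coeff 0 (pderiv k (pderiv j (pderiv i c))) / 6) • (pr i).smulRight ((pr j).smulRight (pr k))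
  have hB : ∀ u v, B u v = ∑ i, ∑ j, (coeff 0 (pderiv j (pderiv i q)) / 2) * (u i * v j) := fun u v => by
    simp [B, pr]
  have hT : ∀ u v w, T u v w = ∑ i, ∑ j, ∑ k, (coeff 0 (pderiv k (pderiv j (pderiv i c))) / 6) * (u i * (v j * w k)) := fun u v w => by
    simp [T, pr]
  have bs : ∀ u v, B u v = B v u := fun u v => by
    rw [hB, hB, Finset.sum_comm]
    exact Finset.sum_congr rfl fun i _ => Finset.sum_congr rfl fun j _ => by rw [pdc i j]; ring
  have t12 : ∀ u v w, T u v w = T v u w := fun u v w => by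
    rw [hT, hT, Finset.sum_comm]
    exact Finset.sum_congr rfl fun i _ => Finset.sum_congr rfl fun j _ => Finset.sum_congr rfl fun k _ => by rw [pdc i j]; ring
  have t23 : ∀ u v w, T u v w = T u w v := fun u v w => by
    rw [hT, hT]
    refine Finset.sum_congr rfl fun i _ => ?_
    rw [Finset.sum_comm]
    exact Finset.sum_congr rfl fun j _ => Finset.sum_congr rfl fun k _ => by rw [pdc j k]; ring
  have eB : ∀ φ, eval φ q = B φ φ := fun φ => by
    rw [← mul_right_inj' (two_ne_zero (α := ℂ)), hom2 hq, hB]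
    simp only [Finset.mul_sum]
    exact Finset.sum_congr rfl fun i _ => Finset.sum_congr rfl fun j _ => by ring
  have eT : ∀ φ, eval φ c = T φ φ φ := fun φ => by
    rw [← mul_right_inj' (show (6 : ℂ) ≠ 0 by norm_num), hom3 hc, hT]
    simp only [Finset.mul_sum]
    exact Finset.sum_congr rfl fun i _ => Finset.sum_congr rfl fun j _ => Finset.sum_congr rfl fun k _ => by ring
  have dB : ∀ φ i, eval φ (pderiv i q) = 2 * B φ (Pi.single i 1) := fun φ i => by
    have e : B (Pi.single i 1) φ = ∑ j, (coeff 0 (pderiv j (pderiv i q)) / 2) * φ j := by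
      rw [hB, Finset.sum_eq_single i (fun b _ hb => by simp [Pi.single_eq_of_ne hb]) (fun h => absurd (Finset.mem_univ i) h)]
      exact Finset.sum_congr rfl fun j _ => by rw [Pi.single_eq_same]; ring
    rw [hom1 hq.pderiv, bs, e, Finset.mul_sum]
    exact Finset.sum_congr rfl fun j _ => by ring
  have dT : ∀ φ i, eval φ (pderiv i c) = 3 * T φ φ (Pi.single i 1) := fun φ i => by
    have e : T (Pi.single i 1) φ φ = ∑ j, ∑ k, (coeff 0 (pderiv k (pderiv j (pderiv i c))) / 6) * (φ j * φ k) := by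
      rw [hT, Finset.sum_eq_single i (fun b _ hb => by simp [Pi.single_eq_of_ne hb]) (fun h => absurd (Finset.mem_univ i) h)]
      exact Finset.sum_congr rfl fun j _ => Finset.sum_congr rfl fun k _ => by rw [Pi.single_eq_same]; ring
    rw [← mul_right_inj' (two_ne_zero (α := ℂ)), hom2 hc.pderiv, t23, t12, e]
    simp only [Finset.mul_sum]
    exact Finset.sum_congr rfl fun j _ => Finset.sum_congr rfl fun k _ => by ring
  refine ⟨B, T, ⟨bs, t12, t23, fun v hv => ?_, fun a ha h1 h2 => ?_⟩, eB, eT⟩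
  · by_contra h0
    obtain ⟨i, hi⟩ := hQsm v h0 (by rw [eB, hv])
    exact hi (by rw [dB, hv, mul_zero])
  · have hl := hXsm a ha (by rw [eB, h1]) (by rw [eT, h2])
    obtain ⟨i, hi⟩ := hQsm a ha (by rw [eB, h1])
    by_contra hcon
    push Not at hcon
    rw [LinearIndependent.pair_iff] at hl
    refine hi (neg_eq_zero.1 (hl (eval a (pderiv i c)) (-eval a (pderiv i q)) ?_).2)
    funext j
    have := hcon (B a (Pi.single i 1) • Pi.single j 1 - B a (Pi.single j 1) • Pi.single i 1) (by simp; ring)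
    simp only [map_sub, map_smul, smul_eq_mul] at this
    simp only [Pi.add_apply, Pi.smul_apply, smul_eq_mul, dB, dT, Pi.zero_apply]
    linear_combination -6 * this

def lnp (u : V6) : MvPolynomial (Fin 6) ℂ := ∑ i, C (u i) * X i
theorem lnp_hom (u) : (lnp u).IsHomogeneous 1 := IsHomogeneous.sum _ _ _ fun i _ => by
  simpa using (isHomogeneous_C (Fin 6) (u i)).mul (isHomogeneous_X ℂ i)
theorem lnp_ev (u φ) : eval φ (lnp u) = ev u φ := by simp [lnp, ev]
theorem ev_sub (u v φ) : ev (u - v) φ = ev u φ - ev v φ := by simp [ev, sub_mul, Finset.sum_sub_distrib]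
theorem ev_smul (c : ℂ) (v φ) : ev (c • v) φ = c * ev v φ := by simp [ev, mul_assoc, Finset.mul_sum]
theorem ev_neg (v φ) : ev (-v) φ = -ev v φ := by simp [ev]
theorem ev_zero (φ) : ev 0 φ = 0 := by simp [ev]

def mm (k l : Fin 3 → V6) (A : Fin 3 → Fin 3 → V6) : Matrix (Fin 6) (Fin 6) V6 :=
  !![0, -k 2, k 1, A 0 0, A 0 1, A 0 2;
    k 2, 0, -k 0, A 1 0, A 1 1, A 1 2;
    -k 1, k 0, 0, A 2 0, A 2 1, A 2 2;
    -A 0 0, -A 1 0, -A 2 0, 0, l 2, -l 1;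
    -A 0 1, -A 1 1, -A 2 1, -l 2, 0, l 0;
    -A 0 2, -A 1 2, -A 2 2, l 1, -l 0, 0]

theorem mm_skew (k l A i j) : mm k l A j i = -mm k l A i j := by
  fin_cases i <;> fin_cases j <;> simp [mm]

/-- Let `X = V(q) ∩ V(c) ⊂ P^5` be a smooth prime Fano threefold of
genus 4, the complete intersection of a *non-singular* quadric `Q = V(q)` and a cubic
`V(c)`.  Then the equation `c` of `X` in the homogeneous coordinate ring
`R(Q) = ℂ[x₀,…,x₅]/(q)` is the pfaffian of a `6 × 6` skew-symmetric matrix `M` of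
linear forms, i.e. `M` represents a map `ψ : O_Q(-1)^6 → O_Q^6` with `Pf(M) = c`
in `R(Q)`. -/
theorem cubic_in_smooth_quadric_is_pfaffian (q c : MvPolynomial (Fin 6) ℂ)
    (hq : q.IsHomogeneous 2) (hc : c.IsHomogeneous 3)
    -- the quadric `Q = V(q) ⊂ P^5` is non-singular
    (hQsm : ∀ a : Fin 6 → ℂ, a ≠ 0 → eval a q = 0 → ∃ i, eval a (pderiv i q) ≠ 0)
    -- `X = V(q, c)` is a smooth (complete intersection) threefold
    (hXsm : ∀ a : Fin 6 → ℂ, a ≠ 0 → eval a q = 0 → eval a c = 0 →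
      LinearIndependent ℂ
        ![(fun i => eval a (pderiv i q)), fun i => eval a (pderiv i c)]) :
    ∃ M : Matrix (Fin (2 * 3)) (Fin (2 * 3)) (MvPolynomial (Fin 6) ℂ),
      Mᵀ = -M ∧ (∀ i j, (M i j).IsHomogeneous 1) ∧
      Ideal.Quotient.mk (Ideal.span {q}) (pfaffian M) =
        Ideal.Quotient.mk (Ideal.span {q}) c := by
  obtain ⟨B, T, H, eB, eT⟩ := bt_exists q c hq hc hQsm hXsm
  obtain ⟨η, x, a, b, S, l, hη, hS, hT⟩ := perturb H
  obtain ⟨μ, hμ⟩ := IsAlgClosed.exists_pow_nat_eq (-(η ^ 2)⁻¹) (n := 3) (by norm_num)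
  have hμ' : μ ^ 3 * η ^ 2 = -1 := by rw [hμ]; field_simp
  let A : Fin 3 → Fin 3 → V6 := fun i j => η ^ 2 • S i j + η • (!![0, -b 2, b 1; b 2, 0, -b 0; -b 1, b 0, 0] : Matrix (Fin 3) (Fin 3) V6) i j
  let N := mm (fun i => x i + η • a i) (fun i => x i - η • a i) A
  let M : Matrix (Fin (2 * 3)) (Fin (2 * 3)) (MvPolynomial (Fin 6) ℂ) := fun i j => lnp (μ • N i j)
  have hM : ∀ i j, M j i = -M i j := fun i j => by
    show lnp (μ • N j i) = -lnp (μ • N i j)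
    rw [show N j i = -N i j from mm_skew _ _ _ _ _]
    simp [lnp]
  refine ⟨M, Matrix.ext fun i j => hM i j, fun i j => lnp_hom _, ?_⟩
  have key : pfaffian M = c - q * lnp l := by
    refine MvPolynomial.funext fun φ => ?_
    rw [pf6 M hM]
    have h := hT φ
    obtain ⟨Y, hY⟩ : ∃ Y, Y = (2 * ∑ i, ev (x i) φ * cr (fun i => ev (a i) φ) (fun i => ev (b i) φ) i + ∑ i, ∑ j, ev (x i) φ * ev (x j) φ * ev (S i j) φ + η ^ 2 * ∑ i, ∑ j, (ev (b i) φ * ev (b j) φ - ev (a i) φ * ev (a j) φ) * ev (S i j) φ + η ^ 4 * ∑ i, ev (S 0 i) φ * cr (fun i => ev (S 1 i) φ) (fun i => ev (S 2 i) φ) i) := ⟨_, rfl⟩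
    rw [← hY] at h
    simp only [map_add, map_sub, map_mul, eB, eT, lnp_ev, h, M, ev_smul]
    simp only [N, mm, A, Matrix.of_apply, Matrix.cons_val, Fin.isValue, ev_add, ev_sub, ev_smul, ev_neg, ev_zero, Fin.sum_univ_three, cr,
      hS 1 0, hS 2 0, hS 2 1]
    simp only [Fin.sum_univ_three, cr, hS 1 0, hS 2 0, hS 2 1, Matrix.cons_val, Fin.isValue] at hY
    linear_combination -Y * hμ' + μ ^ 3 * η ^ 2 * hY
  rw [key, Ideal.Quotient.eq, Ideal.mem_span_singleton]
  exact ⟨-lnp l, by ring⟩
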